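/- arXiv:1805.06171 — 9 statements merged into one kernel-verified Lean document; each statement's English description precedes it below -/
import Mathlib

section
/- For every cycle C_n of order n = 2k + x, where k ≥ 2 and 1 ≤ x ≤ 2k − 1, the k-labeled packing number satisfies: λ^k(C_n) ≥ 2 if x = 1 and k is even, and λ^k(C_n) ≥ x + 2 otherwise. -/
/-- The edge set of the cycle `C_n`, whose vertex set is `ZMod n` and whose edges join
each vertex `v` to `v + 1`. -/
def cycleEdges (n : ℕ) : Set (Sym2 (ZMod n)) :=
  {e | ∃ v : ZMod n, e = s(v, v + 1)}

/-- `f`, a labeling of the `n` vertices of `K_n` using exactly `p` distinct labels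
(i.e. a surjection onto `Fin p`), together with `k` bijections `σ 1, …, σ k` from the
vertices of `C_n` to the vertices of `K_n`, is a `p`-labeled packing of `k` copies of
`C_n` into `K_n`: the images of the edges of `C_n` are edges of `K_n` (non-loops),
the images of the edge set under the `σ i` are pairwise disjoint, and for every vertex
`v` of `C_n` all the images `σ i v` carry the same label. -/
def IsLabeledPacking (n k p : ℕ) (f : ZMod n → Fin p)
    (σ : Fin k → (ZMod n ≃ ZMod n)) : Prop :=
  Function.Surjective f ∧
  (∀ i : Fin k, ∀ e ∈ cycleEdges n, ¬ (Sym2.map (σ i) e).IsDiag) ∧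
  (∀ i j : Fin k, i ≠ j →
    Disjoint (Sym2.map (σ i) '' cycleEdges n) (Sym2.map (σ j) '' cycleEdges n)) ∧
  (∀ i j : Fin k, ∀ v : ZMod n, f (σ i v) = f (σ j v))

/-- The `k`-labeled packing number `λ^k(C_n)`: the largest `p` such that there is a
`p`-labeled packing of `k` copies of `C_n` into `K_n`. -/
noncomputable def labeledPackingNumber (n k : ℕ) : ℕ :=
  sSup {p | ∃ f σ, IsLabeledPacking n k p f σ}

/-- A surjectively labeled finite set `V` of size `n`, label-preserving permutations `T i` of it and
a cyclic enumeration `c` of `V` whose translates by the `T i` are edge-disjoint give a labeled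
packing. -/
lemma le_labeledPackingNumber_of_perms {n k p : ℕ} (hn : 2 ≤ n) {V : Type} [Fintype V]
    (hV : Fintype.card V = n) (T : Fin k → V ≃ V) (L : V → Fin p) (hL : Function.Surjective L)
    (hLT : ∀ i v, L (T i v) = L v) (c : ZMod n → V) (hc : Function.Injective c)
    (hdisj : ∀ i j, i ≠ j → ∀ u v,
      s(T i (c u), T i (c (u + 1))) ≠ s(T j (c v), T j (c (v + 1)))) :
    p ≤ labeledPackingNumber n k := by
  have : NeZero n := ⟨by omega⟩
  have : Fact (1 < n) := ⟨by omega⟩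
  have hcard : Fintype.card (ZMod n) = Fintype.card V := by rw [ZMod.card, hV]
  let e : ZMod n ≃ V := Equiv.ofBijective c
    ((Fintype.bijective_iff_injective_and_card c).2 ⟨hc, hcard⟩)
  refine le_csSup ⟨n, ?_⟩ ⟨L ∘ e, fun i => (e.trans (T i)).trans e.symm, ?_, ?_, ?_, ?_⟩
  · rintro q ⟨f, -, hf, -⟩
    simpa [ZMod.card] using Fintype.card_le_of_surjective f hf
  · exact hL.comp e.surjective
  · rintro i _ ⟨v, rfl⟩
    simp
  · intro i j hij
    rw [Set.disjoint_left]
    rintro _ ⟨_, ⟨u, rfl⟩, rfl⟩ ⟨_, ⟨v, rfl⟩, h⟩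
    apply hdisj i j hij u v
    have h' := congrArg (Sym2.map e) h.symm
    simp only [Sym2.map_mk, Equiv.trans_apply, Equiv.apply_symm_apply] at h'
    exact h'
  · intro i j v
    simp [hLT]

/-- The vertex of `m` copies of `ZMod K` (indexed by the tags below `m`) together with `x` isolated
points (indexed by the tags from `m` on) with given tag and value. -/
def taggedVertex (m K x : ℕ) [NeZero x] (t : ℕ) (a : ℤ) : (Fin m × ZMod K) ⊕ Fin x :=
  if h : t < m then Sum.inl (⟨t, h⟩, a) else Sum.inr (Fin.ofNat x (t - m))

/-- Translation by `a` in every copy of `ZMod K`, fixing the isolated points. -/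
def translateCopies (m K x : ℕ) (a : ZMod K) :
    (Fin m × ZMod K) ⊕ Fin x ≃ (Fin m × ZMod K) ⊕ Fin x :=
  Equiv.sumCongr (Equiv.prodCongr (Equiv.refl _) (Equiv.addRight a)) (Equiv.refl _)

lemma translateCopies_taggedVertex_eq {m K x : ℕ} [NeZero x] {t t' : ℕ} (ht : t < m + x)
    (ht' : t' < m + x) {a a' i j : ℤ}
    (h : translateCopies m K x i (taggedVertex m K x t a) =
      translateCopies m K x j (taggedVertex m K x t' a')) :
    t = t' ∧ (t < m → (K : ℤ) ∣ a + (i - j) - a') := by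
  unfold taggedVertex at h
  split_ifs at h with h1 h2 h2
  · simp only [translateCopies, Equiv.sumCongr_apply, Sum.map_inl, Equiv.prodCongr_apply,
      Prod.map, Equiv.coe_addRight, Equiv.refl_apply, Sum.inl.injEq, Prod.mk.injEq,
      Fin.mk.injEq] at h
    refine ⟨h.1, fun _ => ?_⟩
    rw [← ZMod.intCast_zmod_eq_zero_iff_dvd]
    push_cast
    linear_combination h.2
  · simp [translateCopies] at h
  · simp [translateCopies] at h
  · simp only [translateCopies, Equiv.sumCongr_apply, Sum.map_inr, Equiv.refl_apply,
      Sum.inr.injEq] at h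
    have h' := congrArg Fin.val h
    simp only [Fin.val_ofNat] at h'
    rw [Nat.mod_eq_of_lt (by omega), Nat.mod_eq_of_lt (by omega)] at h'
    exact ⟨by omega, fun h3 => absurd h3 h1⟩

/-- Rotational packings: a cyclic enumeration of `m` copies of `ZMod K` and `x` fixed points, given
by tags and integer representatives, no two of whose edges are translates of each other by some
`0 < |d| < k`. -/
lemma le_labeledPackingNumber_of_tags {n k m K x : ℕ} [NeZero x] [NeZero K] (hn : 2 ≤ n)
    (hcard : m * K + x = n) (tag : ℕ → ℕ) (val : ℕ → ℤ)
    (htag : ∀ u ≤ n, tag u < m + x) (htn : tag n = tag 0) (hvn : val n = val 0)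
    (hinj : ∀ u < n, ∀ v < n, tag u = tag v → (tag u < m → (K : ℤ) ∣ val u - val v) → u = v)
    (hsame : ∀ u < n, ∀ v < n, ∀ d : ℤ, d ≠ 0 → |d| < k → tag u = tag v →
      tag (u + 1) = tag (v + 1) → (tag u < m → (K : ℤ) ∣ val u + d - val v) →
      (tag (u + 1) < m → (K : ℤ) ∣ val (u + 1) + d - val (v + 1)) → False)
    (hcross : ∀ u < n, ∀ v < n, ∀ d : ℤ, d ≠ 0 → |d| < k → tag u = tag (v + 1) →
      tag (u + 1) = tag v → (tag u < m → (K : ℤ) ∣ val u + d - val (v + 1)) →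
      (tag (u + 1) < m → (K : ℤ) ∣ val (u + 1) + d - val v) → False) :
    m + x ≤ labeledPackingNumber n k := by
  have : NeZero n := ⟨by omega⟩
  have : Fact (1 < n) := ⟨by omega⟩
  let c : ZMod n → (Fin m × ZMod K) ⊕ Fin x := fun u => taggedVertex m K x (tag u.val) (val u.val)
  have hsucc : ∀ u : ZMod n,
      c (u + 1) = taggedVertex m K x (tag (u.val + 1)) (val (u.val + 1)) := by
    intro u
    have hu := ZMod.val_lt u
    simp only [c]
    rw [ZMod.val_add, ZMod.val_one]
    rcases Nat.lt_or_ge (u.val + 1) n with h | h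
    · rw [Nat.mod_eq_of_lt h]
    · have : u.val + 1 = n := by omega
      rw [this, Nat.mod_self, htn, hvn]
  refine le_labeledPackingNumber_of_perms hn (V := (Fin m × ZMod K) ⊕ Fin x) ?_
    (fun i => translateCopies m K x ((i.val : ℤ) : ZMod K))
    (finSumFinEquiv ∘ Sum.map Prod.fst id) ?_ ?_ c ?_ ?_
  · simp [ZMod.card, hcard]
  · exact finSumFinEquiv.surjective.comp
      (Sum.map_surjective.2 ⟨Prod.fst_surjective, Function.surjective_id⟩)
  · rintro i (⟨a, b⟩ | j) <;> simp [translateCopies]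
  · intro u v huv
    have hu := ZMod.val_lt u
    have hv := ZMod.val_lt v
    have := translateCopies_taggedVertex_eq (htag _ hu.le) (htag _ hv.le) (i := 0) (j := 0)
      (congrArg (translateCopies m K x ((0 : ℤ) : ZMod K)) huv)
    simp only [sub_zero, add_zero] at this
    exact ZMod.val_injective n (hinj _ hu _ hv this.1 this.2)
  · intro i j hij u v h
    have hu := ZMod.val_lt u
    have hv := ZMod.val_lt v
    have hd0 : (i.val : ℤ) - j.val ≠ 0 := by
      have := Fin.val_ne_of_ne hij
      omega
    have hdk : |(i.val : ℤ) - j.val| < k := by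
      have := i.isLt
      have := j.isLt
      rw [abs_lt]
      omega
    rw [hsucc, hsucc, Sym2.eq_iff] at h
    rcases h with ⟨h1, h2⟩ | ⟨h1, h2⟩
    · have h1 := translateCopies_taggedVertex_eq (htag _ hu.le) (htag _ hv.le) h1
      have h2 := translateCopies_taggedVertex_eq (htag _ hu) (htag _ hv) h2
      exact hsame _ hu _ hv _ hd0 hdk h1.1 h2.1 h1.2 h2.2
    · have h1 := translateCopies_taggedVertex_eq (htag _ hu.le) (htag _ hv) h1
      have h2 := translateCopies_taggedVertex_eq (htag _ hu) (htag _ hv.le) h2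
      exact hcross _ hu _ hv _ hd0 hdk h1.1 h2.1 h1.2 h2.2

lemma eq_zero_or_eq_or_eq_neg_of_dvd {K X : ℤ} (h : K ∣ X) (h1 : X < 2 * K) (h2 : -(2 * K) < X) :
    X = 0 ∨ X = K ∨ X = -K := by
  obtain ⟨q, rfl⟩ := h
  have hK : 0 < K := by omega
  have hq1 : q < 2 := by nlinarith
  have hq2 : -2 < q := by nlinarith
  have : q = -1 ∨ q = 0 ∨ q = 1 := by omega
  rcases this with rfl | rfl | rfl <;> simp

section Walecki

/-- Tags of the Walecki cycle: position `0` (and `2 * k + 1`) is the fixed point. -/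
def waleckiTag (k u : ℕ) : ℕ := if u = 0 then 1 else if u = 2 * k + 1 then 1 else 0

/-- Values of the Walecki cycle: the zigzag `0, 1, -1, 2, -2, …, k`. -/
def waleckiVal (k u : ℕ) : ℤ :=
  if u = 0 then 0 else if u = 2 * k + 1 then 0 else if u % 2 = 0 then (u / 2 : ℕ) else -(u / 2 : ℕ)

lemma walecki_edge {k u : ℕ} (hk : 2 ≤ k) (hu : u < 2 * k + 1) :
    (u = 0 ∧ waleckiTag k u = 1 ∧ waleckiTag k (u + 1) = 0 ∧ waleckiVal k (u + 1) = 0 ∨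
      u = 2 * k ∧ waleckiTag k u = 0 ∧ waleckiTag k (u + 1) = 1 ∧ waleckiVal k u = k) ∨
    (1 ≤ u ∧ u < 2 * k ∧ waleckiTag k u = 0 ∧ waleckiTag k (u + 1) = 0) ∧
      (u % 2 = 1 ∧ 2 * waleckiVal k u = 1 - u ∧ 2 * waleckiVal k (u + 1) = u + 1 ∨
        u % 2 = 0 ∧ 2 * waleckiVal k u = u ∧ 2 * waleckiVal k (u + 1) = -u) := by
  have h1 := waleckiTag.eq_1 k u
  have h2 := waleckiTag.eq_1 k (u + 1)
  have h3 := waleckiVal.eq_1 k u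
  have h4 := waleckiVal.eq_1 k (u + 1)
  generalize waleckiTag k u = a, waleckiTag k (u + 1) = b, waleckiVal k u = α,
    waleckiVal k (u + 1) = β at *
  split_ifs at h1 h2 h3 h4 <;> first | contradiction | omega

lemma two_le_labeledPackingNumber_two_mul_add_one {k : ℕ} (hk : 2 ≤ k) :
    2 ≤ labeledPackingNumber (2 * k + 1) k := by
  have : NeZero (2 * k) := ⟨by omega⟩
  refine le_labeledPackingNumber_of_tags (m := 1) (K := 2 * k) (x := 1) (by omega) (by omega)
    (waleckiTag k) (waleckiVal k) ?_ ?_ ?_ ?_ ?_ ?_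
  · intro u _
    unfold waleckiTag
    split_ifs <;> omega
  · simp [waleckiTag]
  · simp [waleckiVal]
  · intro u hu v hv h1 h2
    rcases walecki_edge hk hu with (hu' | hu') | ⟨_, hu' | hu'⟩ <;>
    rcases walecki_edge hk hv with (hv' | hv') | ⟨_, hv' | hv'⟩ <;> try omega
    all_goals
      have h3 := eq_zero_or_eq_or_eq_neg_of_dvd (h2 (by omega)) (by omega) (by omega)
      omega
  all_goals
    intro u hu v hv d hd0 hd h1 h2 h3 h4
    rw [abs_lt] at hd
    rcases walecki_edge hk hu with (hu' | hu') | ⟨_, hu' | hu'⟩ <;>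
    rcases walecki_edge hk hv with (hv' | hv') | ⟨_, hv' | hv'⟩ <;> try omega
    all_goals
      first
      | have h5 := eq_zero_or_eq_or_eq_neg_of_dvd (h3 (by omega)) (by omega) (by omega)
        have h6 := eq_zero_or_eq_or_eq_neg_of_dvd (h4 (by omega)) (by omega) (by omega)
        omega
      | have h6 := eq_zero_or_eq_or_eq_neg_of_dvd (h4 (by omega)) (by omega) (by omega)
        omega

end Walecki

section Spliced

/-- The zigzag coordinate of a position of the spliced cycle behind its first path: it decreases
from `2 * k - 2 * h - 1`, by one from each moving vertex to the next. -/
def splicedCoord (k x h u : ℕ) : ℤ :=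
  if u < h + 2 * x - 1 then 2 * k - 2 * h - (u - h : ℕ) / 2 else 2 * k + x - h - 1 - u

/-- The tag at a given zigzag coordinate. -/
def zigzagTag (w : ℤ) : ℕ := if 0 ≤ w then if w % 2 = 0 then 0 else 1 else 1

/-- The value at a given zigzag coordinate. -/
def zigzagVal (k h : ℕ) (w : ℤ) : ℤ :=
  if 0 ≤ w then if w % 2 = 0 then -(w / 2) else (w - 1) / 2
  else if w % 2 = 0 then k - h + (-2 - w) / 2 else k - 1 - (-1 - w) / 2

/-- Tags of the spliced cycle, on two copies of `ZMod k` (tags `0` and `1`) and `x` fixed points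
(tags from `2` on). The cycle consists of a fixed point, a zigzag path of length `h` in the first
copy, a zigzag path between the two copies whose first `x - 1` edges are subdivided by fixed points,
and a zigzag path of length `h` in the second copy. -/
def splicedTag (k x h u : ℕ) : ℕ :=
  if u = 0 then 2
  else if u = 2 * k + x then 2
  else if u ≤ h then 0
  else if u < h + 2 * x - 1 ∧ (u - h) % 2 = 1 then 2 + (u - h + 1) / 2
  else zigzagTag (splicedCoord k x h u)

/-- Integer representatives of the vertices of the spliced cycle. -/
def splicedVal (k x h u : ℕ) : ℤ :=
  if u = 0 then 0
  else if u = 2 * k + x then 0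
  else if u ≤ h then if (h - u) % 2 = 0 then (h + u) / 2 else (h - u + 1) / 2
  else zigzagVal k h (splicedCoord k x h u)

lemma zigzag_of_nonneg (k h : ℕ) {w : ℤ} (hw : -1 ≤ w) :
    w % 2 = 0 ∧ zigzagTag w = 0 ∧ 2 * zigzagVal k h w = -w ∨
      w % 2 = 1 ∧ 1 ≤ w ∧ zigzagTag w = 1 ∧ 2 * zigzagVal k h w = w - 1 ∨
      w = -1 ∧ zigzagTag w = 1 ∧ zigzagVal k h w = k - 1 := by
  have h1 := zigzagTag.eq_1 w
  have h2 := zigzagVal.eq_1 k h w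
  generalize zigzagTag w = a, zigzagVal k h w = α at *
  split_ifs at h1 h2 <;> omega

lemma zigzag_of_neg (k h : ℕ) {w : ℤ} (hw : w < 0) :
    zigzagTag w = 1 ∧ (w % 2 = 0 ∧ 2 * zigzagVal k h w = 2 * k - 2 * h - 2 - w ∨
      w % 2 = 1 ∧ 2 * zigzagVal k h w = 2 * k - 1 + w) := by
  have h1 := zigzagTag.eq_1 w
  have h2 := zigzagVal.eq_1 k h w
  generalize zigzagTag w = a, zigzagVal k h w = α at *
  split_ifs at h1 h2 <;> omega

variable {k x h : ℕ}

lemma spliced_vertex (hh : 1 ≤ h) (hhk : 2 * h ≤ k + 1) (hx : 1 ≤ x)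
    (hx2 : x + 2 * h ≤ 2 * k + 2) {u : ℕ} (hu : u ≤ 2 * k + x) :
    ((u = 0 ∨ u = 2 * k + x) ∧ splicedTag k x h u = 2) ∨
    (1 ≤ u ∧ u ≤ h ∧ splicedTag k x h u = 0 ∧
      ((h - u) % 2 = 0 ∧ 2 * splicedVal k x h u = h + u ∨
        (h - u) % 2 = 1 ∧ 2 * splicedVal k x h u = h - u + 1)) ∨
    (h < u ∧ u < h + 2 * x - 1 ∧ u + 5 = h + 2 * splicedTag k x h u) ∨
    (∃ w : ℤ, -1 ≤ w ∧
      (h + 2 ≤ u ∧ u ≤ h + 2 * x - 2 ∧ 2 * w = 4 * k - 3 * h - u ∨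
        h + 2 * x - 1 ≤ u ∧ u ≤ 2 * k + x - h ∧ w = 2 * k + x - h - 1 - u) ∧
      (w % 2 = 0 ∧ splicedTag k x h u = 0 ∧ 2 * splicedVal k x h u = -w ∨
        w % 2 = 1 ∧ 1 ≤ w ∧ splicedTag k x h u = 1 ∧ 2 * splicedVal k x h u = w - 1 ∨
        w = -1 ∧ splicedTag k x h u = 1 ∧ splicedVal k x h u = k - 1)) ∨
    (2 * k + x - h < u ∧ u < 2 * k + x ∧ splicedTag k x h u = 1 ∧
      ((u + h - x) % 2 = 0 ∧ 2 * splicedVal k x h u = 4 * k - 2 + x - h - u ∨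
        (u + h - x) % 2 = 1 ∧ 2 * splicedVal k x h u = u - h - x - 1)) := by
  rcases Nat.eq_zero_or_pos u with h0 | h0
  · left; simp [splicedTag, h0]
  rcases Nat.eq_or_lt_of_le hu with h1 | h1
  · left; simp [splicedTag, h1]
  right
  have e0 : u ≠ 0 := by omega
  have e1 : u ≠ 2 * k + x := by omega
  rcases Nat.lt_or_ge h u with h2 | h2
  · right
    have e2 : ¬ u ≤ h := by omega
    by_cases h3 : u < h + 2 * x - 1 ∧ (u - h) % 2 = 1
    · left
      have hT : splicedTag k x h u = 2 + (u - h + 1) / 2 := by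
        rw [splicedTag, if_neg e0, if_neg e1, if_neg e2, if_pos h3]
      omega
    right
    have hT : splicedTag k x h u = zigzagTag (splicedCoord k x h u) := by
      rw [splicedTag, if_neg e0, if_neg e1, if_neg e2, if_neg h3]
    have hV : splicedVal k x h u = zigzagVal k h (splicedCoord k x h u) := by
      rw [splicedVal, if_neg e0, if_neg e1, if_neg e2]
    have hW := splicedCoord.eq_1 k x h u
    rw [hT, hV]
    generalize splicedCoord k x h u = w at *
    by_cases h4 : -1 ≤ w
    · left
      exact ⟨w, h4, by split_ifs at hW <;> omega, zigzag_of_nonneg k h h4⟩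
    · right
      have := zigzag_of_neg k h (w := w) (by omega)
      split_ifs at hW <;> omega
  · left
    have hT : splicedTag k x h u = 0 := by
      rw [splicedTag, if_neg e0, if_neg e1, if_pos h2]
    have hV := splicedVal.eq_1 k x h u
    rw [if_neg e0, if_neg e1, if_pos h2] at hV
    split_ifs at hV <;> omega

set_option maxHeartbeats 1000000 in
lemma spliced_edge (hk : 2 ≤ k) (hh : 1 ≤ h) (hhk : 2 * h ≤ k + 1) (hx : 1 ≤ x)
    (hx1 : k + 2 ≤ x + 2 * h) (hx2 : x + 2 * h ≤ 2 * k + 2) {u : ℕ} (hu : u < 2 * k + x) :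
    (splicedTag k x h u = 0 ∧ splicedTag k x h (u + 1) = 0 ∧ 1 ≤ u ∧ u < h ∧
      (splicedVal k x h (u + 1) - splicedVal k x h u = u ∨
        splicedVal k x h (u + 1) - splicedVal k x h u = -u)) ∨
    (splicedTag k x h u = 1 ∧ splicedTag k x h (u + 1) = 1 ∧ 2 * k + x - h ≤ u ∧
      u + 1 < 2 * k + x ∧
      (splicedVal k x h (u + 1) - splicedVal k x h u = 2 * k + x - 1 - u ∨
        splicedVal k x h (u + 1) - splicedVal k x h u = -(2 * k + x - 1 - u))) ∨
    (∃ D : ℤ, D = 2 * k + x - h - 2 - u ∧ -1 ≤ D ∧ D ≤ k - 2 ∧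
      (splicedTag k x h u = 0 ∧ splicedTag k x h (u + 1) = 1 ∧
        (splicedVal k x h (u + 1) - splicedVal k x h u = D ∨
          D = -1 ∧ splicedVal k x h (u + 1) - splicedVal k x h u = D + k ∨
          0 ≤ D ∧ splicedVal k x h (u + 1) - splicedVal k x h u = D - k) ∨
      splicedTag k x h u = 1 ∧ splicedTag k x h (u + 1) = 0 ∧
        splicedVal k x h u - splicedVal k x h (u + 1) = D)) ∨
    (2 ≤ splicedTag k x h u ∧ splicedTag k x h (u + 1) = splicedTag k x h u % 2 ∧
      (splicedTag k x h u = 2 ∧ u = 0 ∨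
        3 ≤ splicedTag k x h u ∧ u + 5 = h + 2 * splicedTag k x h u)) ∨
    (2 ≤ splicedTag k x h (u + 1) ∧ splicedTag k x h u = (splicedTag k x h (u + 1) + 1) % 2 ∧
      (splicedTag k x h (u + 1) = 2 ∧ u + 1 = 2 * k + x ∨
        3 ≤ splicedTag k x h (u + 1) ∧ u + 6 = h + 2 * splicedTag k x h (u + 1))) := by
  have hU := spliced_vertex hh hhk hx hx2 hu.le
  have hV := spliced_vertex hh hhk hx hx2 (Nat.succ_le_of_lt hu)
  rw [Nat.succ_eq_add_one] at hV
  generalize splicedTag k x h u = a, splicedTag k x h (u + 1) = b, splicedVal k x h u = α,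
    splicedVal k x h (u + 1) = β at *
  rcases hU with hU | hU | hU | ⟨w, hw, hU⟩ | hU
  · right; right; right; left
    rcases hV with hV | hV | hV | ⟨w', hw', hV⟩ | hV <;> omega
  · rcases hV with hV | hV | hV | ⟨w', hw', hV⟩ | hV
    · exfalso; omega
    · left; omega
    · right; right; right; right; omega
    · exact Or.inr (Or.inr (Or.inl ⟨_, rfl, by omega, by omega, by omega⟩))
    · exfalso; omega
  · right; right; right; left
    rcases hV with hV | hV | hV | ⟨w', hw', hV⟩ | hV <;> omega
  · rcases hV with hV | hV | hV | ⟨w', hw', hV⟩ | hV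
    · right; right; right; right; omega
    · exfalso; omega
    · right; right; right; right; omega
    · obtain ⟨hp, hz⟩ := hU
      obtain ⟨hp', hz'⟩ := hV
      have hww : w = w' + 1 := by clear hz hz'; omega
      have hD : w' = 2 * k + x - h - 2 - u := by clear hz hz'; omega
      have hD' : w' ≤ k - 2 := by clear hz hz'; omega
      clear hp hp'
      refine Or.inr (Or.inr (Or.inl ⟨w', hD, hw', hD', ?_⟩))
      clear hD
      rcases hz with hz | hz | hz
      · left; omega
      · right; omega
      · exfalso; omega
    · right; left; omega
  · rcases hV with hV | hV | hV | ⟨w', hw', hV⟩ | hV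
    · right; right; right; right; omega
    · exfalso; omega
    · exfalso; omega
    · exfalso; omega
    · right; left; omega

set_option maxHeartbeats 2000000 in
lemma spliced_injective (hh : 1 ≤ h) (hhk : 2 * h ≤ k + 1) (hx : 1 ≤ x)
    (hx2 : x + 2 * h ≤ 2 * k + 2) {u v : ℕ} (hu : u < 2 * k + x) (hv : v < 2 * k + x)
    (ht : splicedTag k x h u = splicedTag k x h v)
    (hd : splicedTag k x h u < 2 → (k : ℤ) ∣ splicedVal k x h u - splicedVal k x h v) :
    u = v := by
  have hU := spliced_vertex hh hhk hx hx2 hu.le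
  have hV := spliced_vertex hh hhk hx hx2 hv.le
  generalize splicedTag k x h u = a, splicedTag k x h v = b, splicedVal k x h u = α,
    splicedVal k x h v = β at *
  subst ht
  rcases Nat.lt_or_ge a 2 with ha | ha
  · have hd := hd ha
    rcases hU with hU | hU | hU | ⟨w, hw, hU⟩ | hU <;>
    rcases hV with hV | hV | hV | ⟨w', hw', hV⟩ | hV <;> try omega
    all_goals
      have h3 := eq_zero_or_eq_or_eq_neg_of_dvd hd (by omega) (by omega)
      omega
  · rcases hU with hU | hU | hU | ⟨w, hw, hU⟩ | hU <;>
    rcases hV with hV | hV | hV | ⟨w', hw', hV⟩ | hV <;> omega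

lemma spliced_edge_same (hk : 2 ≤ k) (hh : 1 ≤ h) (hhk : 2 * h ≤ k + 1) (hx : 1 ≤ x)
    (hx1 : k + 2 ≤ x + 2 * h) (hx2 : x + 2 * h ≤ 2 * k + 2) {u v : ℕ} (hu : u < 2 * k + x)
    (hv : v < 2 * k + x) {d : ℤ} (hd0 : d ≠ 0) (hd : |d| < k)
    (h1 : splicedTag k x h u = splicedTag k x h v)
    (h2 : splicedTag k x h (u + 1) = splicedTag k x h (v + 1))
    (h3 : splicedTag k x h u < 2 → (k : ℤ) ∣ splicedVal k x h u + d - splicedVal k x h v)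
    (h4 : splicedTag k x h (u + 1) < 2 →
      (k : ℤ) ∣ splicedVal k x h (u + 1) + d - splicedVal k x h (v + 1)) : False := by
  have hU := spliced_edge hk hh hhk hx hx1 hx2 hu
  have hV := spliced_edge hk hh hhk hx hx1 hx2 hv
  rw [abs_lt] at hd
  rcases eq_or_ne u v with rfl | huv
  · simp only [add_sub_cancel_left] at h3 h4
    have hlt : splicedTag k x h u < 2 ∨ splicedTag k x h (u + 1) < 2 := by
      clear h3 h4
      rcases hU with hU | hU | ⟨D, hD, hU⟩ | hU | hU <;> omega
    have hkd : (k : ℤ) ∣ d := hlt.elim h3 h4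
    exact hd0 (Int.eq_zero_of_abs_lt_dvd hkd (abs_lt.2 hd))
  · rcases hU with hU | hU | ⟨D, hD, hU⟩ | hU | hU <;>
    rcases hV with hV | hV | ⟨D', hD', hV⟩ | hV | hV <;> try omega
    all_goals
      have h5 := eq_zero_or_eq_or_eq_neg_of_dvd (dvd_sub (h4 (by omega)) (h3 (by omega)))
        (by omega) (by omega)
      omega

lemma spliced_edge_cross (hk : 2 ≤ k) (hh : 1 ≤ h) (hhk : 2 * h ≤ k + 1) (hx : 1 ≤ x)
    (hx1 : k + 2 ≤ x + 2 * h) (hx2 : x + 2 * h ≤ 2 * k + 2) {u v : ℕ} (hu : u < 2 * k + x)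
    (hv : v < 2 * k + x) {d : ℤ}
    (h1 : splicedTag k x h u = splicedTag k x h (v + 1))
    (h2 : splicedTag k x h (u + 1) = splicedTag k x h v)
    (h3 : splicedTag k x h u < 2 → (k : ℤ) ∣ splicedVal k x h u + d - splicedVal k x h (v + 1))
    (h4 : splicedTag k x h (u + 1) < 2 →
      (k : ℤ) ∣ splicedVal k x h (u + 1) + d - splicedVal k x h v) : False := by
  have hU := spliced_edge hk hh hhk hx hx1 hx2 hu
  have hV := spliced_edge hk hh hhk hx hx1 hx2 hv
  rcases eq_or_ne u v with rfl | huv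
  · clear hV
    rcases hU with hU | hU | ⟨D, hD, hU⟩ | hU | hU <;> try omega
    all_goals
      have h5 := eq_zero_or_eq_or_eq_neg_of_dvd (dvd_sub (h4 (by omega)) (h3 (by omega)))
        (by omega) (by omega)
      omega
  · rcases hU with hU | hU | ⟨D, hD, hU⟩ | hU | hU <;>
    rcases hV with hV | hV | ⟨D', hD', hV⟩ | hV | hV <;> try omega
    all_goals
      have h5 := eq_zero_or_eq_or_eq_neg_of_dvd (dvd_sub (h4 (by omega)) (h3 (by omega)))
        (by omega) (by omega)
      omega

lemma add_two_le_labeledPackingNumber (hk : 2 ≤ k) (hh : 1 ≤ h) (hhk : 2 * h ≤ k + 1) (hx : 1 ≤ x)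
    (hx1 : k + 2 ≤ x + 2 * h) (hx2 : x + 2 * h ≤ 2 * k + 2) :
    x + 2 ≤ labeledPackingNumber (2 * k + x) k := by
  have : NeZero k := ⟨by omega⟩
  have : NeZero x := ⟨by omega⟩
  rw [add_comm x 2]
  refine le_labeledPackingNumber_of_tags (m := 2) (K := k) (x := x) (by omega) rfl
    (splicedTag k x h) (splicedVal k x h) ?_ ?_ ?_ ?_ ?_ ?_
  · intro u hu
    rcases spliced_vertex hh hhk hx hx2 hu with h | h | h | ⟨w, -, -, h⟩ | h <;> omega
  · simp [splicedTag]
  · simp [splicedVal]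
  · exact fun u hu v hv => spliced_injective hh hhk hx hx2 hu hv
  · exact fun u hu v hv d => spliced_edge_same hk hh hhk hx hx1 hx2 hu hv
  · exact fun u hu v hv d _ _ => spliced_edge_cross hk hh hhk hx hx1 hx2 hu hv

end Spliced

/-- For every cycle `C_n` of order `n = 2k + x`, with `k ≥ 2` and
`1 ≤ x ≤ 2k − 1`: `λ^k(C_n) ≥ 2` if `x = 1` and `k` is even, and `λ^k(C_n) ≥ x + 2`
otherwise. -/
theorem labeledPackingNumber_cycle_lower_bound (k x : ℕ) (hk : 2 ≤ k)
    (hx1 : 1 ≤ x) (hx2 : x ≤ 2 * k - 1) :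
    (x = 1 ∧ Even k → 2 ≤ labeledPackingNumber (2 * k + x) k) ∧
    (¬(x = 1 ∧ Even k) → x + 2 ≤ labeledPackingNumber (2 * k + x) k) := by
  refine ⟨?_, fun h => ?_⟩
  · rintro ⟨rfl, -⟩
    exact two_le_labeledPackingNumber_two_mul_add_one hk
  · rw [Nat.even_iff] at h
    rcases Nat.lt_or_ge x k with hxk | hxk
    · exact add_two_le_labeledPackingNumber (h := (k + 1) / 2) hk (by omega) (by omega) hx1
        (by omega) (by omega)
    · exact add_two_le_labeledPackingNumber (h := 1) hk le_rfl (by omega) hx1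
        (by omega) (by omega)
end

section
/- The cycle C_21 of order 21 = 2·9 + 3 admits a 7-labeled packing of 9 copies of itself; in particular λ^9(C_21) ≥ 7 > 3 + 2, which disproves the conjecture of Duchêne, Kheddouci, Nowakowski and Tahraoui that λ^k(C_{2k+x}) = x + 2 for k ≥ 2 and 2 ≤ x ≤ 2k − 1. -/
/-- Row `i` lists the successive vertices of the `i`-th copy of `C_21`. Vertices `3 * c`,
`3 * c + 1`, `3 * c + 2` carry the label `c`; the labels along each copy follow one
Eulerian circuit of `K_7`. -/
def packingTable : Fin 9 → Fin 21 → Fin 21 := ![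
  ![0, 6, 15, 18, 7, 3, 16, 9, 4, 1, 19, 5, 12, 10, 8, 13, 20, 11, 2, 17, 14],
  ![0, 7, 15, 19, 6, 3, 17, 9, 5, 1, 18, 4, 12, 11, 8, 14, 20, 10, 2, 16, 13],
  ![0, 8, 15, 20, 6, 4, 16, 10, 3, 2, 18, 5, 13, 9, 7, 14, 19, 11, 1, 17, 12],
  ![1, 6, 16, 19, 8, 4, 17, 10, 5, 2, 20, 3, 13, 11, 7, 12, 18, 9, 0, 15, 14],
  ![1, 8, 16, 18, 6, 5, 17, 11, 3, 0, 20, 4, 14, 10, 7, 13, 19, 9, 2, 15, 12],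
  ![1, 7, 16, 20, 8, 5, 15, 10, 4, 2, 19, 3, 12, 9, 6, 14, 18, 11, 0, 17, 13],
  ![2, 8, 17, 19, 7, 4, 15, 9, 3, 1, 20, 5, 14, 11, 6, 13, 18, 10, 0, 16, 12],
  ![2, 7, 17, 18, 8, 3, 15, 11, 5, 0, 19, 4, 13, 10, 6, 12, 20, 9, 1, 16, 14],
  ![2, 6, 17, 20, 7, 5, 16, 11, 4, 0, 18, 3, 14, 9, 8, 12, 19, 10, 1, 15, 13]]

/-- Row `i` is the inverse permutation of row `i` of `packingTable`. -/
def packingTableInv : Fin 9 → Fin 21 → Fin 21 := ![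
  ![0, 9, 18, 5, 8, 11, 1, 4, 14, 7, 13, 17, 12, 15, 20, 2, 6, 19, 3, 10, 16],
  ![0, 9, 18, 5, 11, 8, 4, 1, 14, 7, 17, 13, 12, 20, 15, 2, 19, 6, 10, 3, 16],
  ![0, 18, 9, 8, 5, 11, 4, 14, 1, 13, 7, 17, 20, 12, 15, 2, 6, 19, 10, 16, 3],
  ![18, 0, 9, 11, 5, 8, 1, 14, 4, 17, 7, 13, 15, 12, 20, 19, 2, 6, 16, 3, 10],
  ![9, 0, 18, 8, 11, 5, 4, 14, 1, 17, 13, 7, 20, 15, 12, 19, 2, 6, 3, 16, 10],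
  ![18, 0, 9, 11, 8, 5, 14, 1, 4, 13, 7, 17, 12, 20, 15, 6, 2, 19, 16, 10, 3],
  ![18, 9, 0, 8, 5, 11, 14, 4, 1, 7, 17, 13, 20, 15, 12, 6, 19, 2, 16, 3, 10],
  ![9, 18, 0, 5, 11, 8, 14, 1, 4, 17, 13, 7, 15, 12, 20, 6, 19, 2, 3, 10, 16],
  ![9, 18, 0, 11, 8, 5, 1, 4, 14, 13, 17, 7, 15, 20, 12, 19, 6, 2, 10, 16, 3]]

/-- The nine bijections from the vertices of `C_21` to those of `K_21`. -/
def packingPerm (i : Fin 9) : ZMod 21 ≃ ZMod 21 where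
  toFun := packingTable i
  invFun := packingTableInv i
  left_inv := by
    have h : ∀ i v, packingTableInv i (packingTable i v) = v := by decide +kernel
    exact h i
  right_inv := by
    have h : ∀ i v, packingTable i (packingTableInv i v) = v := by decide +kernel
    exact h i

/-- The labeling of the vertices of `K_21` by seven classes of three vertices. -/
def packingLabel (v : ZMod 21) : Fin 7 := Fin.divNat (m := 7) (n := 3) v

theorem packingTable_ne_succ (i : Fin 9) (v : Fin 21) :
    packingTable i v ≠ packingTable i (v + 1) := by
  revert i v
  decide +kernel

theorem packingTableInv_not_adjacent (i j : Fin 9) (hij : i ≠ j) (v : Fin 21) :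
    packingTableInv j (packingTable i (v + 1)) ≠ packingTableInv j (packingTable i v) + 1 ∧
      packingTableInv j (packingTable i v) ≠
        packingTableInv j (packingTable i (v + 1)) + 1 := by
  revert i j v
  decide +kernel

theorem isLabeledPacking_packingPerm : IsLabeledPacking 21 9 7 packingLabel packingPerm := by
  refine ⟨?_, ?_, ?_, ?_⟩
  · have h : ∀ c : Fin 7, ∃ v : Fin 21, Fin.divNat (m := 7) (n := 3) v = c := by decide +kernel
    exact h
  · rintro i _ ⟨v, rfl⟩
    rw [Sym2.map_mk, Sym2.mk_isDiag_iff]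
    exact packingTable_ne_succ i v
  · intro i j hij
    rw [Set.disjoint_left]
    rintro _ ⟨_, ⟨v, rfl⟩, rfl⟩ ⟨_, ⟨w, rfl⟩, h⟩
    rw [Sym2.map_mk, Sym2.map_mk, Sym2.eq_iff] at h
    obtain ⟨h₁, h₂⟩ := packingTableInv_not_adjacent j i hij.symm w
    rcases h with ⟨hw, hs⟩ | ⟨hw, hs⟩ <;>
      rw [← Equiv.symm_apply_eq] at hw hs
    · exact h₁ (hs.trans (congrArg (· + 1) hw.symm))
    · exact h₂ (hw.trans (congrArg (· + 1) hs.symm))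
  · have h : ∀ i j v, Fin.divNat (m := 7) (n := 3) (packingTable i v) =
        Fin.divNat (m := 7) (n := 3) (packingTable j v) := by decide +kernel
    exact h

theorem IsLabeledPacking.le_labeledPackingNumber {n k p : ℕ} [NeZero n] {f : ZMod n → Fin p}
    {σ : Fin k → (ZMod n ≃ ZMod n)} (h : IsLabeledPacking n k p f σ) :
    p ≤ labeledPackingNumber n k := by
  refine le_csSup ⟨n, ?_⟩ ⟨f, σ, h⟩
  rintro q ⟨g, τ, hg, -⟩
  simpa [ZMod.card] using Fintype.card_le_of_surjective g hg

/-- The cycle `C_21` (of order `21 = 2·9 + 3`) admits a `7`-labeled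
packing of `9` copies of itself; in particular `λ^9(C_21) ≥ 7 > 3 + 2`, which disproves
the conjecture of Duchêne, Kheddouci, Nowakowski and Tahraoui that
`λ^k(C_{2k+x}) = x + 2` for all `k ≥ 2` and `2 ≤ x ≤ 2k − 1`. -/
theorem exists_seven_labeled_packing_C21 :
    (∃ (f : ZMod 21 → Fin 7) (σ : Fin 9 → (ZMod 21 ≃ ZMod 21)),
        IsLabeledPacking 21 9 7 f σ) ∧
    7 ≤ labeledPackingNumber 21 9 ∧ 3 + 2 < (7 : ℕ) ∧
    ¬ (∀ k x : ℕ, 2 ≤ k → 2 ≤ x → x ≤ 2 * k - 1 →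
        labeledPackingNumber (2 * k + x) k = x + 2) := by
  have h7 : 7 ≤ labeledPackingNumber 21 9 :=
    isLabeledPacking_packingPerm.le_labeledPackingNumber
  refine ⟨⟨packingLabel, packingPerm, isLabeledPacking_packingPerm⟩, h7,
    by norm_num, fun h => ?_⟩
  have h5 : labeledPackingNumber 21 9 = 3 + 2 := h 9 3 (by norm_num) (by norm_num) (by norm_num)
  omega
end

section
/- Let C_n be the cycle of order n = 2k + x with k ≥ 2 and 1 ≤ x ≤ 2k − 1, let f be a p-labeled packing of k copies of C_n, and let q be the minimum, over the p labels, of the number of vertices carrying that label. Then there exists a set of at least 2k vertices of C_n whose vertices carry, in total, at most 2q distinct labels. -/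
/-- In a labeled packing of cycles of order at least `3`, the neighbors of a vertex `u` of `K_n`
in the different copies are pairwise distinct. -/
theorem IsLabeledPacking.neighbor_injective {n k p : ℕ} {f : ZMod n → Fin p}
    {σ : Fin k → (ZMod n ≃ ZMod n)} (h : IsLabeledPacking n k p f σ) (hn : 2 < n) (u : ZMod n) :
    Function.Injective fun a : Fin k × Bool =>
      σ a.1 (if a.2 then (σ a.1).symm u + 1 else (σ a.1).symm u - 1) := by
  have edge_mem (j : Fin k) (b : Bool) :
      s(u, σ j (if b then (σ j).symm u + 1 else (σ j).symm u - 1)) ∈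
        Sym2.map (σ j) '' cycleEdges n := by
    cases b
    · refine ⟨s((σ j).symm u - 1, (σ j).symm u), ⟨(σ j).symm u - 1, by simp⟩, ?_⟩
      simp [Sym2.eq_swap]
    · exact ⟨s((σ j).symm u, (σ j).symm u + 1), ⟨(σ j).symm u, rfl⟩, by simp⟩
  have two_ne : (2 : ZMod n) ≠ 0 := by
    intro h0
    have : n ∣ 2 := (ZMod.natCast_eq_zero_iff 2 n).1 (by exact_mod_cast h0)
    exact absurd (Nat.le_of_dvd two_pos this) (by omega)
  rintro ⟨j, b⟩ ⟨j', b'⟩ hw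
  dsimp only at hw
  obtain rfl | hj := eq_or_ne j j'
  · have hv := (σ j).injective hw
    cases b <;> cases b' <;> simp only [Bool.false_eq_true, if_true, if_false] at hv ⊢
    · exact absurd (by linear_combination -hv) two_ne
    · exact absurd (by linear_combination hv) two_ne
  · have hmem := edge_mem j b
    rw [hw] at hmem
    exact (Set.disjoint_left.1 (h.2.2.1 j j' hj) hmem (edge_mem j' b')).elim

/-- Let `C_n` be the cycle of order `n = 2k + x` with `k ≥ 2` and
`1 ≤ x ≤ 2k − 1`, let `f` (with bijections `σ`) be a `p`-labeled packing of `k` copies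
of `C_n`, and let `q` be the minimum, over the `p` labels, of the number of vertices
carrying that label. Then there is a set of at least `2k` vertices whose vertices
carry, in total, at most `2q` distinct labels. -/
theorem exists_big_set_few_labels (k x p q : ℕ) (hk : 2 ≤ k)
    (hx1 : 1 ≤ x) (hx2 : x ≤ 2 * k - 1)
    (f : ZMod (2 * k + x) → Fin p)
    (σ : Fin k → (ZMod (2 * k + x) ≃ ZMod (2 * k + x)))
    (hpack : IsLabeledPacking (2 * k + x) k p f σ)
    (hqmem : ∃ i : Fin p, {v : ZMod (2 * k + x) | f v = i}.ncard = q)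
    (hqle : ∀ i : Fin p, q ≤ {v : ZMod (2 * k + x) | f v = i}.ncard) :
    ∃ S : Set (ZMod (2 * k + x)), 2 * k ≤ S.ncard ∧ (f '' S).ncard ≤ 2 * q := by
  have : NeZero (2 * k + x) := ⟨by omega⟩
  obtain ⟨i, hi⟩ := hqmem
  obtain ⟨u, hu⟩ := hpack.1 i
  refine ⟨Set.range fun a : Fin k × Bool =>
    σ a.1 (if a.2 then (σ a.1).symm u + 1 else (σ a.1).symm u - 1), ?_, ?_⟩
  · rw [← Set.image_univ, Set.ncard_image_of_injective _
      (hpack.neighbor_injective (by omega) u), Set.ncard_univ]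
    simp [mul_comm]
  · let j₀ : Fin k := ⟨0, by omega⟩
    let A : Set (ZMod (2 * k + x)) := {v | f (σ j₀ v) = i}
    have hA : A.ncard = q := by
      rw [← hi, ← Set.ncard_image_of_injective A (σ j₀).injective]
      congr 1
      ext w
      simp [A, Equiv.image_eq_preimage_symm]
    have hmem (j : Fin k) : (σ j).symm u ∈ A := by
      simp [A, hpack.2.2.2 j₀ j, hu]
    have hsub : (f '' Set.range fun a : Fin k × Bool =>
        σ a.1 (if a.2 then (σ a.1).symm u + 1 else (σ a.1).symm u - 1)) ⊆
        (fun v => f (σ j₀ (v + 1))) '' A ∪ (fun v => f (σ j₀ (v - 1))) '' A := by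
      rintro _ ⟨_, ⟨⟨j, b⟩, rfl⟩, rfl⟩
      cases b
      · exact Or.inr ⟨_, hmem j, hpack.2.2.2 j₀ j _⟩
      · exact Or.inl ⟨_, hmem j, hpack.2.2.2 j₀ j _⟩
    calc _ ≤ _ := Set.ncard_le_ncard hsub
      _ ≤ _ := Set.ncard_union_le _ _
      _ ≤ A.ncard + A.ncard := add_le_add Set.ncard_image_le Set.ncard_image_le
      _ = 2 * q := by rw [hA, two_mul]
end

section
/- Let C_n be the cycle of order n = 2k + x with k ≥ 2 and 1 ≤ x ≤ 2k − 1, let f be a p-labeled packing of k copies of C_n, and let q be the minimum, over the p labels, of the number of vertices carrying that label. If q = 1 or 2q ≤ x, then p ≤ x + 2. -/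
/-- An arc `(v, v + 1)` or `(v, v - 1)` of the cycle projects to an edge of the cycle. -/
lemma mk_add_cond_mem_cycleEdges {n : ℕ} (v : ZMod n) (b : Bool) :
    s(v, v + cond b 1 (-1)) ∈ cycleEdges n := by
  cases b
  · refine ⟨v - 1, ?_⟩
    rw [Sym2.eq_swap]
    simp [sub_eq_add_neg]
  · exact ⟨v, rfl⟩

/-- The arcs of the `k` copies of the cycle are pairwise distinct ordered pairs. -/
lemma IsLabeledPacking.injective_arc {n k p : ℕ} (hn : 3 ≤ n) {f : ZMod n → Fin p}
    {σ : Fin k → (ZMod n ≃ ZMod n)} (h : IsLabeledPacking n k p f σ) :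
    Function.Injective fun a : Fin k × ZMod n × Bool =>
      (σ a.1 a.2.1, σ a.1 (a.2.1 + cond a.2.2 1 (-1))) := by
  rintro ⟨i, v, b⟩ ⟨j, w, c⟩ hab
  obtain ⟨h₁, h₂⟩ := Prod.mk.inj hab
  dsimp only at h₁ h₂
  have hij : i = j := by
    by_contra hij
    refine Set.disjoint_left.mp (h.2.2.1 i j hij)
      ⟨_, mk_add_cond_mem_cycleEdges v b, rfl⟩ ⟨_, mk_add_cond_mem_cycleEdges w c, ?_⟩
    rw [Sym2.map_mk, Sym2.map_mk, h₁, h₂]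
  subst hij
  obtain rfl := (σ i).injective h₁
  have hbc := add_left_cancel ((σ i).injective h₂)
  have : Fact (2 < n) := ⟨hn⟩
  have hne : (-1 : ZMod n) ≠ 1 := ZMod.neg_one_ne_one
  cases b <;> cases c <;> simp_all [eq_comm]

/-- If a label class has `q` vertices, it is contained, together with all label classes
adjacent to it in the cycle, in a union of at most `2 * q + 1` label classes having more
than `2 * k` vertices. -/
lemma IsLabeledPacking.exists_labels {n k p : ℕ} [NeZero n] [NeZero k] (hn : 3 ≤ n)
    {f : ZMod n → Fin p} {σ : Fin k → (ZMod n ≃ ZMod n)} (h : IsLabeledPacking n k p f σ)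
    (l : Fin p) :
    ∃ T : Finset (Fin p), T.card ≤ 2 * (Finset.univ.filter fun v => f v = l).card + 1 ∧
      2 * k + 1 ≤ (Finset.univ.filter fun v => f v ∈ T).card := by
  set A : Finset (ZMod n) := Finset.univ.filter fun v => f v = l with hA
  set Q : Finset (ZMod n) := Finset.univ.filter fun v => f (σ 0 v) = l with hQ
  have hQA : Q.card = A.card :=
    Finset.card_bij (fun v _ => σ 0 v) (by simp [hA, hQ])
      (fun _ _ _ _ e => (σ 0).injective e)
      fun w hw => ⟨(σ 0).symm w, by simpa [hA, hQ] using hw, by simp⟩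
  set T : Finset (Fin p) := insert l
    ((Q ×ˢ (Finset.univ : Finset Bool)).image fun a => f (σ 0 (a.1 + cond a.2 1 (-1))))
    with hT
  set S : Finset (ZMod n) := Finset.univ.filter fun v => f v ∈ T with hS
  have hTcard : T.card ≤ 2 * A.card + 1 := by
    refine (Finset.card_insert_le _ _).trans (Nat.add_le_add_right ?_ 1)
    refine Finset.card_image_le.trans ?_
    simp [hQA, mul_comm]
  have hpos : 0 < A.card := by
    obtain ⟨v, hv⟩ := h.1 l
    exact Finset.card_pos.mpr ⟨v, by simp [hA, hv]⟩
  refine ⟨T, hTcard, ?_⟩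
  have hAS : A ⊆ S := fun v hv => by
    have : f v = l := by simpa [hA] using hv
    simp [hS, hT, this]
  have hcount : k * (A.card * 2) ≤ A.card * (S.card - 1) := by
    calc k * (A.card * 2)
        = ((Finset.univ : Finset (Fin k)) ×ˢ Q ×ˢ (Finset.univ : Finset Bool)).card := by
          simp [hQA]
      _ ≤ (A.sigma fun v => S.erase v).card := by
          refine Finset.card_le_card_of_injOn
            (fun a => ⟨σ a.1 a.2.1, σ a.1 (a.2.1 + cond a.2.2 1 (-1))⟩) ?_ ?_
          · rintro ⟨i, v, b⟩ ha
            have hv : f (σ 0 v) = l := by simpa [hQ] using ha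
            have hne := h.2.1 i _ (mk_add_cond_mem_cycleEdges v b)
            rw [Sym2.map_mk, Sym2.mk_isDiag_iff] at hne
            simp only [Finset.coe_sigma, Set.mem_sigma_iff, Finset.mem_coe, Finset.mem_erase]
            refine ⟨?_, fun e => hne e.symm, ?_⟩
            · simp [hA, h.2.2.2 i 0, hv]
            · refine Finset.mem_filter.mpr ⟨Finset.mem_univ _, ?_⟩
              rw [h.2.2.2 i 0]
              exact Finset.mem_insert_of_mem (Finset.mem_image.mpr
                ⟨(v, b), by simp [hQ, hv], rfl⟩)
          · intro a _ b _ hab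
            obtain ⟨h₁, h₂⟩ := Sigma.mk.inj hab
            exact h.injective_arc hn (Prod.ext h₁ (eq_of_heq h₂))
      _ = A.card * (S.card - 1) := by
          rw [Finset.card_sigma, Finset.sum_congr rfl fun v hv =>
            Finset.card_erase_of_mem (hAS hv), Finset.sum_const, smul_eq_mul]
  have h2k : 2 * k ≤ S.card - 1 := by
    refine Nat.le_of_mul_le_mul_left ?_ hpos
    calc A.card * (2 * k) = k * (A.card * 2) := by ring
      _ ≤ _ := hcount
  have hSpos : 0 < S.card := hpos.trans_le (Finset.card_le_card hAS)
  change 2 * k + 1 ≤ S.card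
  omega

/-- If every fibre of `f` has at least `q` elements, then the labels outside `T` account
for at least `q * (p - #T)` elements. -/
lemma mul_card_sub_add_card_filter_le {α : Type*} [Fintype α] {p q : ℕ} (f : α → Fin p)
    (hq : ∀ i, q ≤ (Finset.univ.filter fun v => f v = i).card) (T : Finset (Fin p)) :
    q * (p - T.card) + (Finset.univ.filter fun v => f v ∈ T).card ≤ Fintype.card α := by
  have h := Finset.mul_card_image_le_card_of_maps_to
    (f := f) (s := Finset.univ.filter fun v => f v ∉ T) (t := Tᶜ) (by simp) q
    fun i hi => by
      refine (hq i).trans (Finset.card_le_card fun v hv => ?_)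
      have hv : f v = i := by simpa using hv
      have hi : i ∉ T := by simpa using hi
      simp [hv, hi]
  rw [Finset.card_compl, Fintype.card_fin] at h
  have := Finset.card_filter_add_card_filter_not (s := (Finset.univ : Finset α)) (fun v => f v ∈ T)
  rw [Finset.card_univ] at this
  linarith

/-- Let `C_n` be the cycle of order `n = 2k + x` with `k ≥ 2` and
`1 ≤ x ≤ 2k − 1`, let `f` (with bijections `σ`) be a `p`-labeled packing of `k` copies
of `C_n`, and let `q` be the minimum, over the `p` labels, of the number of vertices
carrying that label. If `q = 1` or `2q ≤ x`, then `p ≤ x + 2`. -/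
theorem labels_le_of_small_min_label_class (k x p q : ℕ) (hk : 2 ≤ k)
    (hx1 : 1 ≤ x) (hx2 : x ≤ 2 * k - 1)
    (f : ZMod (2 * k + x) → Fin p)
    (σ : Fin k → (ZMod (2 * k + x) ≃ ZMod (2 * k + x)))
    (hpack : IsLabeledPacking (2 * k + x) k p f σ)
    (hqmem : ∃ i : Fin p, {v : ZMod (2 * k + x) | f v = i}.ncard = q)
    (hqle : ∀ i : Fin p, q ≤ {v : ZMod (2 * k + x) | f v = i}.ncard)
    (hq : q = 1 ∨ 2 * q ≤ x) :
    p ≤ x + 2 := by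
  have : NeZero (2 * k + x) := ⟨by omega⟩
  have : NeZero k := ⟨by omega⟩
  have hcard : ∀ i : Fin p, {v : ZMod (2 * k + x) | f v = i}.ncard =
      (Finset.univ.filter fun v => f v = i).card := fun i => by
    rw [← Set.ncard_coe_finset]
    simp
  simp only [hcard] at hqmem hqle
  obtain ⟨l, hl⟩ := hqmem
  have hq1 : 1 ≤ q := by
    obtain ⟨v, hv⟩ := hpack.1 l
    exact hl ▸ Finset.card_pos.mpr ⟨v, by simp [hv]⟩
  obtain ⟨T, hT, hS⟩ := hpack.exists_labels (by omega) l
  rw [hl] at hT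
  have hcount := mul_card_sub_add_card_filter_le f hqle T
  rw [ZMod.card] at hcount
  by_contra! hp
  have hmul : q * (p - T.card) ≤ x - 1 := by omega
  rcases hq with rfl | hq
  · omega
  · obtain ⟨t, rfl⟩ := Nat.exists_eq_add_of_le hq
    have : q * (t + 2) ≤ q * (p - T.card) := Nat.mul_le_mul_left q (by omega)
    have : t ≤ q * t := Nat.le_mul_of_pos_left t hq1
    have : q * (t + 2) = q * t + 2 * q := by ring
    omega
end

section
/- Let C_n be the cycle of order n = 2k + x with k ≥ 2 and 1 ≤ x ≤ 2k − 1. If x ≥ √(4k − 2), then λ^k(C_n) ≤ x + 2. -/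
/-- In a packing of `k` cycles, the labels of the vertices adjacent to a vertex `w` in some copy
are those of the class of `w` and of the classes adjacent to it; the union of these classes has
at least `2 * k + 1` vertices, so if every class has at least as many vertices as that of `w`,
the number of labels is bounded. -/
lemma IsLabeledPacking.card_fiber_mul_le {n k p : ℕ} [NeZero n] (hn : 3 ≤ n) (hk : 0 < k)
    {f : ZMod n → Fin p} {σ : Fin k → (ZMod n ≃ ZMod n)} (h : IsLabeledPacking n k p f σ)
    (a : Fin p) (m : ℕ) (ha : (Finset.univ.filter fun u => f u = a).card = m)
    (hmin : ∀ b, m ≤ (Finset.univ.filter fun u => f u = b).card) :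
    2 * k + 1 + m * p ≤ n + m * (2 * m + 1) := by
  classical
  obtain ⟨hf, -, hdis, hlab⟩ := h
  have : Fact (1 < n) := ⟨by omega⟩
  have two_ne : (2 : ZMod n) ≠ 0 := by
    intro h2
    have h3 : ((2 : ℕ) : ZMod n) = 0 := by exact_mod_cast h2
    rw [ZMod.natCast_eq_zero_iff] at h3
    have := Nat.le_of_dvd (by norm_num) h3
    omega
  obtain ⟨w, hw⟩ := hf a
  let i₀ : Fin k := ⟨0, hk⟩
  let A : Finset (ZMod n) := Finset.univ.filter fun v => f (σ i₀ v) = a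
  have hA : A.card = m := by
    rw [← ha]
    exact Finset.card_bij (fun v _ => σ i₀ v) (by simp [A]) (by simp)
      (fun b hb => ⟨(σ i₀).symm b, by simpa [A] using hb, by simp⟩)
  let step : Bool → ZMod n := fun b => if b then 1 else -1
  have step_inj : Function.Injective step := by
    have h1 : (1 : ZMod n) ≠ -1 := fun h => two_ne (by linear_combination h)
    intro b c hbc
    cases b <;> cases c <;> simp_all [step]
  have step_ne (b : Bool) : step b ≠ 0 := by cases b <;> simp [step]
  let B : Finset (Fin p) := (A ×ˢ (Finset.univ : Finset Bool)).image
    fun q => f (σ i₀ (q.1 + step q.2))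
  let S := insert a B
  have hS : S.card ≤ 2 * m + 1 := by
    have h1 : B.card ≤ (A ×ˢ (Finset.univ : Finset Bool)).card := Finset.card_image_le
    have h2 := Finset.card_insert_le a B
    simp only [Finset.card_product, hA, Finset.card_univ, Fintype.card_bool] at h1
    change S.card ≤ _ at h2
    omega
  let φ : Fin k × Bool → ZMod n := fun q => σ q.1 ((σ q.1).symm w + step q.2)
  have edge_mem (q : Fin k × Bool) : s(w, φ q) ∈ Sym2.map (σ q.1) '' cycleEdges n := by
    obtain ⟨i, b⟩ := q
    refine ⟨s((σ i).symm w, (σ i).symm w + step b), ?_, by simp [φ]⟩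
    cases b
    · exact ⟨(σ i).symm w - 1, by rw [Sym2.eq_swap]; simp [step, sub_eq_add_neg]⟩
    · exact ⟨(σ i).symm w, by simp [step]⟩
  have φ_inj : Function.Injective φ := by
    rintro ⟨i, b⟩ ⟨j, c⟩ h
    obtain rfl : i = j := by
      by_contra hij
      have h2 := edge_mem (j, c)
      rw [← h] at h2
      exact Set.disjoint_left.mp (hdis i j hij) (edge_mem (i, b)) h2
    simp only [φ, EmbeddingLike.apply_eq_iff_eq, add_right_inj] at h
    rw [step_inj h]
  let T : Finset (ZMod n) := Finset.univ.filter fun u => f u ∈ S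
  have hT : 2 * k + 1 ≤ T.card := by
    have hwT : w ∈ T := by simp [T, S, hw]
    have hsub : Finset.univ.image φ ⊆ T.erase w := by
      intro u hu
      obtain ⟨⟨i, b⟩, -, rfl⟩ := Finset.mem_image.mp hu
      rw [Finset.mem_erase]
      refine ⟨?_, ?_⟩
      · intro h
        have h2 := (Equiv.eq_symm_apply (σ i)).mpr h
        exact step_ne b (by simpa using h2)
      · simp only [T, S, Finset.mem_filter, Finset.mem_univ, true_and, Finset.mem_insert]
        right
        refine Finset.mem_image.mpr ⟨((σ i).symm w, b), ?_, hlab _ _ _⟩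
        simp only [A, Finset.mem_product, Finset.mem_filter, Finset.mem_univ, true_and, and_true]
        rw [hlab i₀ i]
        simpa using hw
    have h1 := Finset.card_le_card hsub
    rw [Finset.card_image_of_injective _ φ_inj, Finset.card_erase_of_mem hwT] at h1
    simp only [Finset.card_univ, Fintype.card_prod, Fintype.card_fin, Fintype.card_bool] at h1
    have := Finset.card_pos.mpr ⟨w, hwT⟩
    omega
  have hcompl : m * Sᶜ.card ≤ (Finset.univ.filter fun u => f u ∉ S).card := by
    rw [Finset.card_eq_sum_card_fiberwise (f := f) (t := Sᶜ) (by intro u; simp), mul_comm]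
    refine Finset.card_nsmul_le_sum _ _ _ fun b hb => (hmin b).trans (Finset.card_le_card ?_)
    intro u hu
    simp only [Finset.mem_filter, Finset.mem_univ, true_and] at hu ⊢
    exact ⟨by simpa [hu] using hb, hu⟩
  have hsum := Finset.card_filter_add_card_filter_not (s := (Finset.univ : Finset (ZMod n)))
    (fun u => f u ∈ S)
  rw [Finset.card_univ, ZMod.card] at hsum
  have hSp := Finset.card_add_card_compl S
  rw [Fintype.card_fin] at hSp
  have hmul := Nat.mul_le_mul_left m hS
  have : m * p = m * S.card + m * Sᶜ.card := by rw [← mul_add, hSp]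
  change 2 * k + 1 ≤ (Finset.univ.filter fun u => f u ∈ S).card at hT
  omega

/-- Let `C_n` be the cycle of order `n = 2k + x` with `k ≥ 2` and
`1 ≤ x ≤ 2k − 1`. If `x ≥ √(4k − 2)`, then `λ^k(C_n) ≤ x + 2`. -/
theorem labeledPackingNumber_le_of_sqrt (k x : ℕ) (hk : 2 ≤ k)
    (hx1 : 1 ≤ x) (hx2 : x ≤ 2 * k - 1)
    (hsqrt : Real.sqrt (4 * (k : ℝ) - 2) ≤ (x : ℝ)) :
    labeledPackingNumber (2 * k + x) k ≤ x + 2 := by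
  have hsq : 4 * k ≤ x ^ 2 + 2 := by
    have h := (Real.sqrt_le_left (by positivity)).mp hsqrt
    have h2 : (4 * k : ℝ) ≤ x ^ 2 + 2 := by linarith
    exact_mod_cast h2
  refine csSup_le' ?_
  rintro p ⟨f, σ, h⟩
  by_contra! hp
  have : NeZero (2 * k + x) := ⟨by omega⟩
  have : NeZero p := ⟨by omega⟩
  obtain ⟨a, -, hmin⟩ := Finset.exists_min_image Finset.univ
    (fun b => (Finset.univ.filter fun u => f u = b).card) ⟨(0 : Fin p), Finset.mem_univ _⟩
  obtain ⟨m, hm⟩ : ∃ m, (Finset.univ.filter fun u => f u = a).card = m := ⟨_, rfl⟩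
  rw [hm] at hmin
  have hmin' : ∀ b, m ≤ (Finset.univ.filter fun u => f u = b).card :=
    fun b => hmin b (Finset.mem_univ b)
  have key := h.card_fiber_mul_le (by omega) (by omega) a m hm hmin'
  have hmp : p * m ≤ 2 * k + x := by
    have h1 := Finset.card_eq_sum_card_fiberwise (f := f)
      (s := (Finset.univ : Finset (ZMod (2 * k + x)))) (t := Finset.univ) (by simp)
    rw [Finset.card_univ, ZMod.card] at h1
    have h2 := Finset.card_nsmul_le_sum Finset.univ
      (fun b => (Finset.univ.filter fun u => f u = b).card) m (fun b _ => hmin' b)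
    rw [Finset.card_univ, Fintype.card_fin, smul_eq_mul] at h2
    omega
  have hm0 : 1 ≤ m := by
    obtain ⟨w, hw⟩ := h.1 a
    rw [← hm]
    exact Finset.card_pos.mpr ⟨w, by simp [hw]⟩
  have hp' : x + 3 ≤ p := hp
  have hpm : (x + 3) * m ≤ p * m := Nat.mul_le_mul_right m hp'
  have hxm : x + 1 ≤ 2 * m := by
    by_contra! hlt
    nlinarith
  nlinarith
end

section
/- Let C_n be the cycle of order n = 2k + 1 with k ≥ 2 and k even, let f be a p-labeled packing of k copies of C_n, and let q be the minimum, over the p labels, of the number of vertices carrying that label. If q = 1 (that is, the packing has a fixed point), then p ≤ 2. -/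
/-- In a packing of `k` copies of the cycle of order `2k + 1`, every edge of the complete graph
is the image of exactly one cycle edge under exactly one of the bijections. -/
theorem packing_bijective {k p : ℕ} (hk : 2 ≤ k) {f : ZMod (2 * k + 1) → Fin p}
    {σ : Fin k → (ZMod (2 * k + 1) ≃ ZMod (2 * k + 1))}
    (hpack : IsLabeledPacking (2 * k + 1) k p f σ) :
    Function.Bijective (fun x : Fin k × ZMod (2 * k + 1) =>
      (⟨s(σ x.1 x.2, σ x.1 (x.2 + 1)), hpack.2.1 x.1 _ ⟨x.2, rfl⟩⟩ :
        {e : Sym2 (ZMod (2 * k + 1)) // ¬ e.IsDiag})) := by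
  have htwo : (2 : ZMod (2 * k + 1)) ≠ 0 := by
    intro h
    have h' : ((2 : ℕ) : ZMod (2 * k + 1)) = 0 := by exact_mod_cast h
    rw [ZMod.natCast_eq_zero_iff] at h'
    have := Nat.le_of_dvd (by norm_num) h'
    omega
  rw [Fintype.bijective_iff_injective_and_card]
  constructor
  · rintro ⟨i, v⟩ ⟨j, w⟩ h
    replace h : s(σ i v, σ i (v + 1)) = s(σ j w, σ j (w + 1)) := congrArg Subtype.val h
    have hij : i = j := by
      by_contra hne
      exact Set.disjoint_left.1 (hpack.2.2.1 i j hne) ⟨s(v, v + 1), ⟨v, rfl⟩, rfl⟩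
        ⟨s(w, w + 1), ⟨w, rfl⟩, h.symm⟩
    subst hij
    rw [Sym2.eq_iff] at h
    simp only [EmbeddingLike.apply_eq_iff_eq] at h
    rcases h with ⟨h, -⟩ | ⟨h₁, h₂⟩
    · rw [h]
    · exact absurd (by linear_combination h₂ - h₁) htwo
  · rw [Sym2.card_subtype_not_diag, Fintype.card_prod, Fintype.card_fin, ZMod.card,
      Nat.choose_two_right, Nat.add_sub_cancel]
    rw [show (2 * k + 1) * (2 * k) = 2 * (k * (2 * k + 1)) by ring]
    omega

/-- In a packing of `k` copies of the cycle of order `2k + 1`, the number of edges of the complete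
graph with a given pair of end labels is a multiple of `k`. -/
theorem dvd_card_edges_of_labels {k p : ℕ} (hk : 2 ≤ k) {f : ZMod (2 * k + 1) → Fin p}
    {σ : Fin k → (ZMod (2 * k + 1) ≃ ZMod (2 * k + 1))}
    (hpack : IsLabeledPacking (2 * k + 1) k p f σ) (l : Sym2 (Fin p)) :
    k ∣ Fintype.card {e : {e : Sym2 (ZMod (2 * k + 1)) // ¬ e.IsDiag} // e.1.map f = l} := by
  let i₀ : Fin k := ⟨0, by omega⟩
  have hlabel : ∀ x : Fin k × ZMod (2 * k + 1),
      s(f (σ i₀ x.2), f (σ i₀ (x.2 + 1))) = l ↔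
        Sym2.map f s(σ x.1 x.2, σ x.1 (x.2 + 1)) = l := by
    intro x
    rw [Sym2.map_mk, hpack.2.2.2 x.1 i₀, hpack.2.2.2 x.1 i₀]
  have hcard := Fintype.card_congr
    ((Equiv.ofBijective _ (packing_bijective hk hpack)).subtypeEquiv
      (p := fun x => s(f (σ i₀ x.2), f (σ i₀ (x.2 + 1))) = l)
      (q := fun e => e.1.map f = l) hlabel)
  rw [← hcard, Fintype.card_subtype]
  have hprod : (Finset.univ.filter fun x : Fin k × ZMod (2 * k + 1) =>
      s(f (σ i₀ x.2), f (σ i₀ (x.2 + 1))) = l) = Finset.univ ×ˢ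
      (Finset.univ.filter fun v => s(f (σ i₀ v), f (σ i₀ (v + 1))) = l) := by
    ext
    simp
  rw [hprod, Finset.card_product, Finset.card_univ, Fintype.card_fin]
  exact dvd_mul_right _ _

/-- In a packing of `k` copies of the cycle of order `2k + 1` with a fixed point, the size of
every other label class is a multiple of `k`. -/
theorem dvd_card_label_of_fixed_point {k p : ℕ} (hk : 2 ≤ k) {f : ZMod (2 * k + 1) → Fin p}
    {σ : Fin k → (ZMod (2 * k + 1) ≃ ZMod (2 * k + 1))}
    (hpack : IsLabeledPacking (2 * k + 1) k p f σ) {a b : Fin p} (hab : a ≠ b)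
    {x : ZMod (2 * k + 1)} (hx : ∀ y, f y = a ↔ y = x) :
    k ∣ (Finset.univ.filter fun v => f v = b).card := by
  have h := dvd_card_edges_of_labels hk hpack s(a, b)
  have hfx : f x = a := (hx x).2 rfl
  have hdiag : ∀ v : {v // f v = b}, ¬ s(x, v.1).IsDiag := by
    intro v
    rw [Sym2.mk_isDiag_iff]
    intro h
    exact hab (by rw [← hfx, h, v.2])
  have hlabel : ∀ v : {v // f v = b}, s(x, v.1).map f = s(a, b) := by
    intro v
    rw [Sym2.map_mk, hfx, v.2]
  rw [← Fintype.card_subtype]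
  refine h.trans (dvd_of_eq (Fintype.card_congr (Equiv.ofBijective
    (fun v : {v // f v = b} => ⟨⟨s(x, v.1), hdiag v⟩, hlabel v⟩) ?_)).symm)
  constructor
  · rintro ⟨v, hv⟩ ⟨w, hw⟩ h
    simp only [Subtype.mk.injEq, Sym2.congr_right] at h
    exact Subtype.ext h
  · rintro ⟨⟨e, he⟩, hl⟩
    induction e using Sym2.ind with
    | _ u v =>
      rw [Sym2.map_mk, Sym2.eq_iff] at hl
      rcases hl with ⟨hu, hv⟩ | ⟨hu, hv⟩
      · exact ⟨⟨v, hv⟩, by simp [(hx u).1 hu]⟩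
      · exact ⟨⟨u, hu⟩, by simp [(hx v).1 hv, Sym2.eq_swap]⟩

/-- In a packing of `k` copies of the cycle of order `2k + 1`, the number of pairs of vertices
sharing a given label is a multiple of `k`. -/
theorem dvd_choose_two_card_label {k p : ℕ} (hk : 2 ≤ k) {f : ZMod (2 * k + 1) → Fin p}
    {σ : Fin k → (ZMod (2 * k + 1) ≃ ZMod (2 * k + 1))}
    (hpack : IsLabeledPacking (2 * k + 1) k p f σ) (b : Fin p) :
    k ∣ (Finset.univ.filter fun v => f v = b).card.choose 2 := by
  have h := dvd_card_edges_of_labels hk hpack s(b, b)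
  have hdiag : ∀ e : {e : Sym2 {v // f v = b} // ¬ e.IsDiag},
      ¬ (e.1.map Subtype.val).IsDiag := by
    intro e
    rw [Sym2.isDiag_map Subtype.val_injective]
    exact e.2
  have hlabel : ∀ e : Sym2 {v // f v = b}, (e.map Subtype.val).map f = s(b, b) := by
    intro e
    induction e using Sym2.ind with
    | _ u v => simp [u.2, v.2]
  rw [← Fintype.card_subtype, ← Sym2.card_subtype_not_diag]
  refine h.trans (dvd_of_eq (Fintype.card_congr (Equiv.ofBijective
    (fun e : {e : Sym2 {v // f v = b} // ¬ e.IsDiag} =>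
      ⟨⟨e.1.map Subtype.val, hdiag e⟩, hlabel e.1⟩) ?_)).symm)
  constructor
  · rintro ⟨d, hd⟩ ⟨e, he⟩ h
    simp only [Subtype.mk.injEq] at h
    exact Subtype.ext (Sym2.map.injective Subtype.val_injective h)
  · rintro ⟨⟨e, he⟩, hl⟩
    induction e using Sym2.ind with
    | _ u v =>
      have huv : f u = b ∧ f v = b := by simpa [Sym2.eq_iff] using hl
      refine ⟨⟨s(⟨u, huv.1⟩, ⟨v, huv.2⟩), ?_⟩, rfl⟩
      simpa using he

/-- Let `C_n` be the cycle of order `n = 2k + 1` with `k ≥ 2` and `k`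
even, let `f` (with bijections `σ`) be a `p`-labeled packing of `k` copies of `C_n`,
and let `q` be the minimum, over the `p` labels, of the number of vertices carrying
that label. If `q = 1` (the packing has a fixed point), then `p ≤ 2`. -/
theorem labels_le_two_of_fixed_point (k p q : ℕ) (hk : 2 ≤ k) (hke : Even k)
    (f : ZMod (2 * k + 1) → Fin p)
    (σ : Fin k → (ZMod (2 * k + 1) ≃ ZMod (2 * k + 1)))
    (hpack : IsLabeledPacking (2 * k + 1) k p f σ)
    (hqmem : ∃ i : Fin p, {v : ZMod (2 * k + 1) | f v = i}.ncard = q)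
    (hqle : ∀ i : Fin p, q ≤ {v : ZMod (2 * k + 1) | f v = i}.ncard)
    (hq : q = 1) :
    p ≤ 2 := by
  subst hq
  obtain ⟨a, ha⟩ := hqmem
  obtain ⟨x, hx⟩ := Set.ncard_eq_one.1 ha
  have hx' : ∀ y, f y = a ↔ y = x := fun y => Set.ext_iff.1 hx y
  by_contra! hp
  obtain ⟨b, c, hab, hac, hbc⟩ : ∃ b c : Fin p, a ≠ b ∧ a ≠ c ∧ b ≠ c := by
    obtain ⟨b, hb⟩ := Finset.exists_mem_notMem_of_card_lt_card
      (s := {a}) (t := (Finset.univ : Finset (Fin p))) (by simp; omega)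
    obtain ⟨c, hc⟩ := Finset.exists_mem_notMem_of_card_lt_card
      (s := {a, b}) (t := (Finset.univ : Finset (Fin p)))
      (lt_of_le_of_lt Finset.card_le_two (by simpa using hp))
    simp only [Finset.mem_univ, true_and, Finset.mem_insert, Finset.mem_singleton,
      not_or] at hb hc
    exact ⟨b, c, Ne.symm hb, Ne.symm hc.1, Ne.symm hc.2⟩
  have hge : ∀ d, a ≠ d → k ≤ (Finset.univ.filter fun v => f v = d).card := by
    intro d hd
    obtain ⟨v, hv⟩ := hpack.1 d
    exact Nat.le_of_dvd (Finset.card_pos.2 ⟨v, by simpa using hv⟩)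
      (dvd_card_label_of_fixed_point hk hpack hd hx')
  have hsum : (Finset.univ.filter fun v => f v = a).card +
      (Finset.univ.filter fun v => f v = b).card +
      (Finset.univ.filter fun v => f v = c).card ≤ 2 * k + 1 := by
    rw [← Finset.card_union_of_disjoint, ← Finset.card_union_of_disjoint]
    · exact (Finset.card_le_univ _).trans_eq (ZMod.card _)
    all_goals
      rw [Finset.disjoint_left]
      simp only [Finset.mem_union, Finset.mem_filter, Finset.mem_univ, true_and]
      grind
  have hapos : 0 < (Finset.univ.filter fun v => f v = a).card :=
    Finset.card_pos.2 ⟨x, by simpa using (hx' x).2 rfl⟩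
  have hbk : (Finset.univ.filter fun v => f v = b).card = k := by
    have := hge b hab
    have := hge c hac
    omega
  have hdvd := dvd_choose_two_card_label hk hpack b
  rw [hbk] at hdvd
  obtain ⟨m, hm⟩ := hdvd
  obtain ⟨t, rfl⟩ := hke
  have htwo := Nat.choose_two_right (t + t)
  have heven : 2 * ((t + t).choose 2) = (t + t) * (t + t - 1) := by
    rw [htwo, Nat.mul_div_cancel' (Nat.even_mul_pred_self _).two_dvd]
  have hm' : (t + t) * (2 * m) = (t + t) * (t + t - 1) := by
    rw [← heven, hm]
    ring
  have := Nat.eq_of_mul_eq_mul_left (show 0 < t + t by omega) hm'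
  omega
end

section
/- Let C_n be the cycle of order n = 2k + x. For every positive integer p with p ≤ λ^k(C_n), there exists a partition n_1, n_2, …, n_p of n into p positive parts such that Σ_{i=1}^{p} ⌊n_i(n_i − 1)/(2k)⌋ + Σ_{i=1}^{p} Σ_{j=i+1}^{p} ⌊n_i n_j / k⌋ ≥ n. -/
theorem IsLabeledPacking.comp {n k p q : ℕ} {f : ZMod n → Fin p}
    {σ : Fin k → (ZMod n ≃ ZMod n)} (h : IsLabeledPacking n k p f σ) {g : Fin p → Fin q}
    (hg : Function.Surjective g) : IsLabeledPacking n k q (g ∘ f) σ :=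
  ⟨hg.comp h.1, h.2.1, h.2.2.1, fun i j v => congrArg g (h.2.2.2 i j v)⟩

theorem exists_isLabeledPacking_of_le {n k p : ℕ} [NeZero n] (hp : 0 < p)
    (hple : p ≤ labeledPackingNumber n k) : ∃ f σ, IsLabeledPacking n k p f σ := by
  have hne : {p | ∃ f σ, IsLabeledPacking n k p f σ}.Nonempty := by
    by_contra! h
    simp only [labeledPackingNumber, h, csSup_empty, bot_eq_zero] at hple
    omega
  have hbdd : BddAbove {p | ∃ f σ, IsLabeledPacking n k p f σ} := by
    refine ⟨n, ?_⟩
    rintro q ⟨f, σ, h⟩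
    simpa [ZMod.card] using Fintype.card_le_of_surjective f h.1
  obtain ⟨f, σ, h⟩ := Nat.sSup_mem hne hbdd
  refine ⟨_, σ, h.comp (g := fun i => ⟨min i (p - 1), by omega⟩) fun j => ?_⟩
  refine ⟨⟨j, j.2.trans_le hple⟩, Fin.ext ?_⟩
  have := j.2
  simp only
  omega

theorem cycleEdge_injective {n : ℕ} (hn : 3 ≤ n) :
    Function.Injective fun v : ZMod n => s(v, v + 1) := by
  intro v w h
  rcases Sym2.eq_iff.1 h with h | ⟨h₁, h₂⟩
  · exact h.1
  · have h2 : ((2 : ℕ) : ZMod n) = 0 := by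
      push_cast
      linear_combination h₂ - h₁
    have := Nat.le_of_dvd two_pos ((ZMod.natCast_eq_zero_iff 2 n).1 h2)
    omega

theorem IsLabeledPacking.injective_edge {n k p : ℕ} {f : ZMod n → Fin p}
    {σ : Fin k → (ZMod n ≃ ZMod n)} (h : IsLabeledPacking n k p f σ) (hn : 3 ≤ n) :
    Function.Injective fun x : Fin k × ZMod n => Sym2.map (σ x.1) s(x.2, x.2 + 1) := by
  rintro ⟨i, v⟩ ⟨j, w⟩ hvw
  obtain rfl : i = j := by
    by_contra hij
    exact Set.disjoint_left.1 (h.2.2.1 i j hij) ⟨_, ⟨v, rfl⟩, rfl⟩ ⟨_, ⟨w, rfl⟩, hvw.symm⟩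
  exact Prod.ext rfl (cycleEdge_injective hn (Sym2.map.injective (σ i).injective hvw))

/-- In a labeled packing, the `k` copies of the cycle edges with a given pair of labels are
distinct edges of the complete graph with this pair of labels. -/
theorem IsLabeledPacking.mul_card_le {n k p : ℕ} [NeZero n] {f : ZMod n → Fin p}
    {σ : Fin k → (ZMod n ≃ ZMod n)} (h : IsLabeledPacking n k p f σ) (hn : 3 ≤ n)
    (i₀ : Fin k) (q : Sym2 (Fin p)) :
    k * (Finset.univ.filter fun v => Sym2.map (f ∘ σ i₀) s(v, v + 1) = q).card ≤
      (Finset.univ.filter fun e : Sym2 (ZMod n) => ¬ e.IsDiag ∧ Sym2.map f e = q).card := by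
  rw [← Fintype.card_fin k, ← Finset.card_univ, ← Finset.card_product]
  refine Finset.card_le_card_of_injOn _ ?_ (h.injective_edge hn).injOn
  rintro ⟨i, v⟩ hv
  have hv : Sym2.map (f ∘ σ i₀) s(v, v + 1) = q := by simpa using hv
  refine Finset.mem_coe.2 (Finset.mem_filter.2 ⟨Finset.mem_univ _, h.2.1 i _ ⟨v, rfl⟩, ?_⟩)
  rw [← hv, Sym2.map_map]
  simp only [Sym2.map_mk, Function.comp_apply, h.2.2.2 i i₀]

theorem card_nonDiag_map_eq_diag_le {V ι : Type*} [Fintype V] [DecidableEq V] [DecidableEq ι]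
    (f : V → ι) (a : ι) :
    (Finset.univ.filter fun e : Sym2 V => ¬ e.IsDiag ∧ Sym2.map f e = s(a, a)).card ≤
      (Finset.univ.filter fun v => f v = a).card.choose 2 := by
  rw [← Sym2.card_image_offDiag]
  refine Finset.card_le_card fun e => ?_
  induction e with | _ x y
  intro he
  simp only [Finset.mem_filter, Finset.mem_univ, true_and, Sym2.mk_isDiag_iff, Sym2.map_mk,
    Sym2.eq_iff, or_self] at he
  exact Finset.mem_image.2 ⟨(x, y), by simp [he], rfl⟩

theorem card_nonDiag_map_eq_le {V ι : Type*} [Fintype V] [DecidableEq V] [DecidableEq ι]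
    (f : V → ι) (a b : ι) :
    (Finset.univ.filter fun e : Sym2 V => ¬ e.IsDiag ∧ Sym2.map f e = s(a, b)).card ≤
      (Finset.univ.filter fun v => f v = a).card * (Finset.univ.filter fun v => f v = b).card := by
  rw [← Finset.card_product]
  refine le_trans (Finset.card_le_card fun e => ?_)
    (Finset.card_image_le (f := fun x : V × V => s(x.1, x.2)))
  induction e with | _ x y
  intro he
  simp only [Finset.mem_filter, Finset.mem_univ, true_and, Sym2.mk_isDiag_iff, Sym2.map_mk,
    Sym2.eq_iff] at he
  rcases he.2 with he | he
  · exact Finset.mem_image.2 ⟨(x, y), by simp [he], rfl⟩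
  · exact Finset.mem_image.2 ⟨(y, x), by simp [he], Sym2.eq_swap⟩

theorem card_le_sum_card_sym2 {V ι : Type*} [Fintype V] [DecidableEq V] [Fintype ι] [LinearOrder ι]
    (g : V → Sym2 ι) :
    Fintype.card V ≤ ∑ a, (Finset.univ.filter fun v => g v = s(a, a)).card +
      ∑ a, ∑ b ∈ Finset.univ.filter (fun b => a < b),
        (Finset.univ.filter fun v => g v = s(a, b)).card := by
  have hcover : (Finset.univ : Finset V) ⊆
      (Finset.univ.biUnion fun a => Finset.univ.filter fun v => g v = s(a, a)) ∪
      Finset.univ.biUnion fun a => (Finset.univ.filter fun b => a < b).biUnion fun b =>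
        Finset.univ.filter fun v => g v = s(a, b) := by
    intro v _
    simp only [Finset.mem_union, Finset.mem_biUnion, Finset.mem_univ, Finset.mem_filter, true_and]
    induction hg : g v with | _ a b
    rcases lt_trichotomy a b with hab | rfl | hab
    · exact Or.inr ⟨a, b, hab, rfl⟩
    · exact Or.inl ⟨a, rfl⟩
    · exact Or.inr ⟨b, a, hab, Sym2.eq_swap⟩
  calc Fintype.card V ≤ _ := Finset.card_le_card hcover
    _ ≤ _ := Finset.card_union_le _ _
    _ ≤ _ := add_le_add Finset.card_biUnion_le
      (Finset.card_biUnion_le.trans (Finset.sum_le_sum fun _ _ => Finset.card_biUnion_le))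

/-- Let `C_n` be the cycle of order `n = 2k + x`. For every positive
integer `p` with `p ≤ λ^k(C_n)`, there is a partition `n_1, …, n_p` of `n` into `p`
positive parts such that
`Σ_i ⌊n_i(n_i − 1)/(2k)⌋ + Σ_i Σ_{j>i} ⌊n_i n_j / k⌋ ≥ n`. -/
theorem exists_partition_of_labeledPackingNumber (k x p : ℕ) (hk : 2 ≤ k) (hx : 1 ≤ x)
    (hp : 0 < p) (hple : p ≤ labeledPackingNumber (2 * k + x) k) :
    ∃ parts : Fin p → ℕ, (∀ i, 0 < parts i) ∧ (∑ i, parts i = 2 * k + x) ∧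
      2 * k + x ≤
        (∑ i, parts i * (parts i - 1) / (2 * k)) +
          ∑ i, ∑ j ∈ Finset.univ.filter (fun j => i < j), parts i * parts j / k := by
  have : NeZero (2 * k + x) := ⟨by omega⟩
  obtain ⟨f, σ, h⟩ := exists_isLabeledPacking_of_le hp hple
  have hn : 3 ≤ 2 * k + x := by omega
  have hk0 : 0 < k := by omega
  refine ⟨fun a => (Finset.univ.filter fun v => f v = a).card, fun a => ?_, ?_, ?_⟩
  · obtain ⟨v, hv⟩ := h.1 a
    exact Finset.card_pos.2 ⟨v, by simp [hv]⟩
  · rw [← Finset.card_eq_sum_card_fiberwise fun _ _ => Finset.mem_coe.2 (Finset.mem_univ _),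
      Finset.card_univ, ZMod.card]
  · have hcard := card_le_sum_card_sym2 fun v => Sym2.map (f ∘ σ ⟨0, hk0⟩) s(v, v + 1)
    rw [ZMod.card] at hcard
    refine hcard.trans (add_le_add (Finset.sum_le_sum fun a _ => ?_)
      (Finset.sum_le_sum fun a _ => Finset.sum_le_sum fun b _ => ?_))
    · rw [← Nat.div_div_eq_div_mul, ← Nat.choose_two_right, Nat.le_div_iff_mul_le hk0, mul_comm]
      exact (h.mul_card_le hn _ _).trans (card_nonDiag_map_eq_diag_le f a)
    · rw [Nat.le_div_iff_mul_le hk0, mul_comm]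
      exact (h.mul_card_le hn _ _).trans (card_nonDiag_map_eq_le f a b)
end

section
/- For integers k ≥ 1 and x, the circuit (directed cycle) C⃗_{k+x} of order n = k + x admits a k-placement into the complete digraph on n vertices if and only if x ≥ 1 and (x, n) ∉ {(1,4), (1,6)}. -/
/-- The arc set of the circuit (directed cycle) `C⃗_n`, whose vertex set is `ZMod n`
and whose arcs go from each vertex `v` to `v + 1`. -/
def circuitArcs (n : ℕ) : Set (ZMod n × ZMod n) :=
  {a | ∃ v : ZMod n, a = (v, v + 1)}

/-- The `k` bijections `σ 1, …, σ k` from the vertices of `C⃗_n` to the vertices of the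
complete digraph `↔K_n` form a `k`-placement of `C⃗_n`: the images of the arcs of `C⃗_n`
are arcs of `↔K_n` (they join distinct vertices), and the images of the arc set of
`C⃗_n` under the `σ i` are pairwise disjoint. -/
def IsDirPlacement (n k : ℕ) (σ : Fin k → (ZMod n ≃ ZMod n)) : Prop :=
  (∀ i : Fin k, ∀ a ∈ circuitArcs n, σ i a.1 ≠ σ i a.2) ∧
  (∀ i j : Fin k, i ≠ j →
    Disjoint ((fun a => (σ i a.1, σ i a.2)) '' circuitArcs n)
      ((fun a => (σ j a.1, σ j a.2)) '' circuitArcs n))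

/-- `f`, a labeling of the `n` vertices of `↔K_n` using exactly `p` distinct labels
(i.e. a surjection onto `Fin p`), together with `k` bijections `σ 1, …, σ k`, is a
`p`-labeled packing of `k` copies of `C⃗_n` into `↔K_n`: the `σ i` form a `k`-placement
of `C⃗_n` and, for every vertex `v` of `C⃗_n`, all the images `σ i v` carry the same
label. -/
def IsDirLabeledPacking (n k p : ℕ) (f : ZMod n → Fin p)
    (σ : Fin k → (ZMod n ≃ ZMod n)) : Prop :=
  Function.Surjective f ∧ IsDirPlacement n k σ ∧
  (∀ i j : Fin k, ∀ v : ZMod n, f (σ i v) = f (σ j v))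

/-- The `k`-labeled packing number `λ^k(C⃗_n)`: the largest `p` such that there is a
`p`-labeled packing of `k` copies of `C⃗_n` into `↔K_n`. -/
noncomputable def dirLabeledPackingNumber (n k : ℕ) : ℕ :=
  sSup {p | ∃ f σ, IsDirLabeledPacking n k p f σ}

/-- The map `f` permutes `{0, …, n - 1}` in a single cycle: every vertex is reached from
the successor of some base vertex `b` by iterating `f`. -/
structure IsHamiltonian (n : ℕ) (f : ℕ → ℕ) : Prop where
  lt : ∀ v < n, f v < n
  reach : ∃ b < n, ∀ v < n, Relation.ReflTransGen (fun u w => f u = w) (f b) v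

theorem IsHamiltonian.conj {n : ℕ} {f g T : ℕ → ℕ} (hg : IsHamiltonian n g)
    (lt : ∀ v < n, T v < n) (surj : ∀ v < n, ∃ u < n, T u = v)
    (comm : ∀ u < n, f (T u) = T (g u)) : IsHamiltonian n f := by
  refine ⟨fun v hv => ?_, ?_⟩
  · obtain ⟨u, hu, rfl⟩ := surj v hv
    rw [comm u hu]
    exact lt _ (hg.lt u hu)
  · obtain ⟨b, hb, h⟩ := hg.reach
    refine ⟨T b, lt b hb, fun v hv => ?_⟩
    obtain ⟨u, hu, rfl⟩ := surj v hv
    rw [comm b hb]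
    have key : ∀ w, Relation.ReflTransGen (fun u w => g u = w) (g b) w →
        w < n ∧ Relation.ReflTransGen (fun u w => f u = w) (T (g b)) (T w) := by
      intro w hw
      induction hw with
      | refl => exact ⟨hg.lt b hb, .refl⟩
      | @tail x y _ hxy ih =>
        subst hxy
        exact ⟨hg.lt x ih.1, ih.2.tail (comm x ih.1)⟩
    exact (key u (h u hu)).2

theorem IsHamiltonian.exists_equiv {n : ℕ} [NeZero n] {f : ℕ → ℕ} (hf : IsHamiltonian n f) :
    ∃ σ : ZMod n ≃ ZMod n, ∀ t, (σ (t + 1)).val = f (σ t).val := by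
  obtain ⟨b, hb, reach⟩ := hf.reach
  let g : ZMod n → ZMod n := fun x => (f x.val : ℕ)
  have val_g : ∀ x, (g x).val = f x.val := fun x =>
    ZMod.val_cast_of_lt (hf.lt _ (ZMod.val_lt x))
  have orbit : ∀ w, Relation.ReflTransGen (fun u w => f u = w) (f b) w →
      ∃ j : ℕ, (g^[j + 1] (b : ZMod n)).val = w := by
    intro w hw
    induction hw with
    | refl => exact ⟨0, by simp [val_g, ZMod.val_cast_of_lt hb]⟩
    | tail _ hxy ih =>
      obtain ⟨j, hj⟩ := ih
      exact ⟨j + 1, by rw [Function.iterate_succ_apply', val_g, hj, hxy]⟩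
  have orbit' : ∀ x : ZMod n, ∃ j : ℕ, g^[j + 1] (b : ZMod n) = x := by
    intro x
    obtain ⟨j, hj⟩ := orbit x.val (reach _ (ZMod.val_lt x))
    exact ⟨j, ZMod.val_injective n hj⟩
  have surj : Function.Surjective g := by
    intro x
    obtain ⟨j, hj⟩ := orbit' x
    exact ⟨g^[j] b, by rw [← hj, Function.iterate_succ_apply']⟩
  let γ : Equiv.Perm (ZMod n) :=
    Equiv.ofBijective g ((Fintype.bijective_iff_surjective_and_card g).2 ⟨surj, rfl⟩)
  have pow_γ : ∀ (j : ℕ) x, (γ ^ j) x = g^[j] x := by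
    intro j x
    rw [Equiv.Perm.coe_pow]
    rfl
  have same : ∀ x, γ.SameCycle b x := by
    intro x
    obtain ⟨j, hj⟩ := orbit' x
    exact ⟨(j + 1 : ℕ), by rw [zpow_natCast, pow_γ, hj]⟩
  have cyc : γ.IsCycleOn ((Finset.univ : Finset (ZMod n)) : Set (ZMod n)) :=
    ⟨by simp, fun x _ y _ => (same x).symm.trans (same y)⟩
  have period : (γ ^ n) (b : ZMod n) = b := by
    have := cyc.pow_card_apply (Finset.mem_univ (b : ZMod n))
    rwa [Finset.card_univ, ZMod.card] at this
  have pow_mod : ∀ j : ℕ, (γ ^ (j % n)) (b : ZMod n) = (γ ^ j) b := by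
    intro j
    conv_rhs => rw [← Nat.mod_add_div j n, pow_add, pow_mul, Equiv.Perm.mul_apply]
    congr 1
    symm
    exact Equiv.Perm.pow_apply_eq_self_of_apply_eq_self period _
  let e : ZMod n → ZMod n := fun t => (γ ^ t.val) b
  have e_surj : Function.Surjective e := by
    intro x
    obtain ⟨j, hj⟩ := orbit' x
    refine ⟨((j + 1 : ℕ) : ZMod n), ?_⟩
    change (γ ^ ((j + 1 : ℕ) : ZMod n).val) (b : ZMod n) = x
    rw [ZMod.val_natCast, pow_mod, pow_γ, hj]
  refine ⟨Equiv.ofBijective e ((Fintype.bijective_iff_surjective_and_card e).2 ⟨e_surj, rfl⟩),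
    fun t => ?_⟩
  change ((γ ^ (t + 1).val) (b : ZMod n)).val = f ((γ ^ t.val) (b : ZMod n)).val
  have ht : (t + 1).val = (t.val + 1) % n := by
    conv_lhs => rw [← ZMod.natCast_zmod_val t]
    rw [← Nat.cast_succ, ZMod.val_natCast]
  rw [ht, pow_mod, pow_succ', Equiv.Perm.mul_apply, ← val_g]
  rfl

/-- Cycles of `{0, …, n - 1}` that leave every vertex in distinct directions form a placement. -/
theorem exists_isDirPlacement {n m k : ℕ} (hn : 2 ≤ n) (hk : k ≤ m) (F : ℕ → ℕ → ℕ)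
    (ham : ∀ i < m, IsHamiltonian n (F i))
    (disj : ∀ i < m, ∀ j < m, ∀ v < n, F i v = F j v → i = j) :
    ∃ σ : Fin k → (ZMod n ≃ ZMod n), IsDirPlacement n k σ := by
  have : NeZero n := ⟨by lia⟩
  have : Fact (1 < n) := ⟨hn⟩
  choose σ hσ using fun i : Fin k => (ham i (by lia)).exists_equiv
  refine ⟨σ, ?_, ?_⟩
  · rintro i a ⟨v, rfl⟩ h
    have := (σ i).injective h
    simp at this
  · intro i j hij
    rw [Set.disjoint_left]
    rintro _ ⟨_, ⟨s, rfl⟩, rfl⟩ ⟨_, ⟨t, rfl⟩, h⟩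
    simp only [Prod.mk.injEq] at h
    refine hij (Fin.ext (disj i (by lia) j (by lia) _ (ZMod.val_lt (σ i s)) ?_))
    rw [← hσ, ← h.1, ← hσ, h.2]

/-- Rotation by `i` of the vertices `0, …, N - 1`, fixing the extra vertex `N`. -/
def rotate (N i w : ℕ) : ℕ :=
  if w = N then N else if i + w < N then i + w else i + w - N

/-- The inverse of `rotate N i`. -/
def unrotate (N i v : ℕ) : ℕ :=
  if v = N then N else if i ≤ v then v - i else v + N - i

/-- Successor map of the zigzag cycle `N, 0, 1, -1, 2, -2, …` on `ℤ/N ∪ {N}`. -/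
def zigzag (N w : ℕ) : ℕ :=
  if w = N then 0 else if w = (N + 1) / 2 then N else if w = 0 then 1
  else if w ≤ N / 2 then N - w else N + 1 - w

/-- Successor map of the reversed zigzag cycle, for odd `N`. -/
def zagzig (N w : ℕ) : ℕ :=
  if w = N then (N + 1) / 2 else if w = 0 then N else if w = 1 then 0
  else if w ≤ N / 2 then N + 1 - w else N - w

theorem isHamiltonian_zigzag {N : ℕ} (hN : 1 ≤ N) : IsHamiltonian (N + 1) (zigzag N) := by
  refine ⟨fun v hv => by unfold zigzag; lia, N, by lia, ?_⟩
  set R := Relation.ReflTransGen (fun u w => zigzag N u = w) (zigzag N N) with hR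
  have step : ∀ u w, R u → zigzag N u = w → R w := fun u w h h' => h.tail h'
  have r0 : R 0 := by
    have : zigzag N N = 0 := by unfold zigzag; lia
    rw [hR, this]
  clear_value R
  clear hR
  have up : ∀ q, q + 1 ≤ (N + 1) / 2 → R (q + 1) ∧ (q + 1 < (N + 1) / 2 → R (N - (q + 1))) := by
    intro q
    induction q with
    | zero =>
      intro h
      have r1 : R 1 := step 0 _ r0 (by unfold zigzag; lia)
      exact ⟨r1, fun h => step 1 _ r1 (by unfold zigzag; lia)⟩
    | succ q ih =>
      intro h
      have r0 := (ih (by lia)).2 (by lia)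
      have r1 : R (q + 1 + 1) := by
        by_cases hq : N - (q + 1) = q + 1 + 1
        · rwa [hq] at r0
        · exact step _ _ r0 (by unfold zigzag; lia)
      exact ⟨r1, fun h => step _ _ r1 (by unfold zigzag; lia)⟩
  have top : R ((N + 1) / 2) := by
    have := (up ((N + 1) / 2 - 1) (by lia)).1
    rwa [show (N + 1) / 2 - 1 + 1 = (N + 1) / 2 by lia] at this
  intro v hv
  by_cases h0 : v = 0
  · exact h0 ▸ r0
  by_cases h2 : v ≤ (N + 1) / 2
  · have := (up (v - 1) (by lia)).1
    rwa [show v - 1 + 1 = v by lia] at this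
  by_cases h1 : v = N
  · exact step _ _ top (by unfold zigzag; lia)
  · have := (up (N - v - 1) (by lia)).2 (by lia)
    rwa [show N - (N - v - 1 + 1) = v by lia] at this

theorem isHamiltonian_rotate {N i : ℕ} {g : ℕ → ℕ} (hi : i < N) (hg : IsHamiltonian (N + 1) g) :
    IsHamiltonian (N + 1) (fun v => rotate N i (g (unrotate N i v))) := by
  refine hg.conj (T := rotate N i) (fun v hv => ?_) (fun v hv => ?_) (fun u hu => ?_)
  · unfold rotate; lia
  · exact ⟨unrotate N i v, by unfold unrotate; lia, by unfold rotate unrotate; lia⟩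
  · have : unrotate N i (rotate N i u) = u := by unfold rotate unrotate; lia
    simp only [this]

theorem zigzag_sub_injective {N a b : ℕ} (hN : N % 2 = 0) (ha : a < N) (hb : b < N)
    (ha' : zigzag N a ≠ N) (hb' : zigzag N b ≠ N)
    (h : zigzag N a + b = zigzag N b + a ∨ zigzag N a + b = zigzag N b + a + N ∨
      zigzag N a + b + N = zigzag N b + a) : a = b := by
  obtain ⟨M, rfl⟩ : ∃ M, N = 2 * M := ⟨N / 2, by lia⟩
  have key : ∀ a < 2 * M, zigzag (2 * M) a ≠ 2 * M →
      a = 0 ∧ zigzag (2 * M) a = 1 ∨ 1 ≤ a ∧ a < M ∧ zigzag (2 * M) a = 2 * M - a ∨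
      M < a ∧ zigzag (2 * M) a = 2 * M + 1 - a := by
    intro a ha ha'
    unfold zigzag at *
    lia
  rcases key a ha ha' with h1 | h1 | h1 <;> rcases key b hb hb' with h2 | h2 | h2 <;> omega

theorem rotate_zigzag_injective {N i j v : ℕ} (hN : N % 2 = 0) (hi : i < N) (hj : j < N)
    (hv : v < N + 1)
    (h : rotate N i (zigzag N (unrotate N i v)) = rotate N j (zigzag N (unrotate N j v))) :
    i = j := by
  by_cases hvN : v = N
  · unfold rotate zigzag unrotate at h
    lia
  have key : ∀ i < N, ∃ w < N, unrotate N i v = w ∧ (w + i = v ∨ w + i = v + N) := fun i hi =>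
    ⟨unrotate N i v, by unfold unrotate; lia, rfl, by unfold unrotate; lia⟩
  obtain ⟨a, ha, ha', ha''⟩ := key i hi
  obtain ⟨b, hb, hb', hb''⟩ := key j hj
  rw [ha', hb'] at h
  suffices a = b by lia
  by_cases hza : zigzag N a = N
  · have : zigzag N b = N := by
      have : zigzag N b < N + 1 := by unfold zigzag; lia
      unfold rotate at h
      lia
    unfold zigzag at *
    lia
  · have hzb : zigzag N b ≠ N := by
      have : zigzag N a < N + 1 := by unfold zigzag; lia
      unfold rotate at h
      lia
    have h1 : zigzag N a < N + 1 := by unfold zigzag; lia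
    have h2 : zigzag N b < N + 1 := by unfold zigzag; lia
    refine zigzag_sub_injective hN ha hb hza hzb ?_
    unfold rotate at h
    lia

theorem exists_isDirPlacement_odd {n k : ℕ} (hn : 3 ≤ n) (hodd : n % 2 = 1) (hk : k < n) :
    ∃ σ : Fin k → (ZMod n ≃ ZMod n), IsDirPlacement n k σ := by
  obtain ⟨N, rfl⟩ : ∃ N, n = N + 1 := ⟨n - 1, by lia⟩
  exact exists_isDirPlacement (by lia) (show k ≤ N by lia)
    (fun i v => rotate N i (zigzag N (unrotate N i v)))
    (fun i hi => isHamiltonian_rotate hi (isHamiltonian_zigzag (by lia)))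
    (fun i hi j hj v hv h => rotate_zigzag_injective (by lia) hi hj hv h)

theorem isHamiltonian_zagzig {N : ℕ} (hN : N % 2 = 1) (hN3 : 3 ≤ N) :
    IsHamiltonian (N + 1) (zagzig N) := by
  obtain ⟨M, rfl⟩ : ∃ M, N = 2 * M + 1 := ⟨N / 2, by lia⟩
  clear hN
  let T : ℕ → ℕ := fun w => if w = 2 * M + 1 then 2 * M + 1 else if w ≤ M + 1 then M + 1 - w
      else M + 1 + (2 * M + 1) - w
  have hT : ∀ w, T w = if w = 2 * M + 1 then 2 * M + 1 else if w ≤ M + 1 then M + 1 - w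
      else M + 1 + (2 * M + 1) - w := fun w => rfl
  clear_value T
  refine (isHamiltonian_zigzag (N := 2 * M + 1) (by lia)).conj (T := T)
    (fun v hv => by rw [hT]; lia) (fun v hv => ⟨T v, by rw [hT]; lia, ?_⟩) (fun v hv => ?_)
  · rw [hT, hT]
    lia
  · have h1 : v = 2 * M + 1 ∧ zigzag (2 * M + 1) v = 0 ∨
        v = M + 1 ∧ zigzag (2 * M + 1) v = 2 * M + 1 ∨ v = 0 ∧ zigzag (2 * M + 1) v = 1 ∨
        1 ≤ v ∧ v ≤ M ∧ zigzag (2 * M + 1) v = 2 * M + 1 - v ∨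
        M + 1 < v ∧ v < 2 * M + 1 ∧ zigzag (2 * M + 1) v = 2 * M + 2 - v := by
      have : v = 2 * M + 1 ∨ v = M + 1 ∨ v = 0 ∨ 1 ≤ v ∧ v ≤ M ∨ M + 1 < v ∧ v < 2 * M + 1 := by
        lia
      unfold zigzag
      rcases this with h | h | h | h | h <;> lia
    rcases h1 with ⟨h, e⟩ | ⟨h, e⟩ | ⟨h, e⟩ | ⟨h, h', e⟩ | ⟨h, h', e⟩ <;>
      rw [e, hT, hT] <;> unfold zagzig <;> lia

/-- The `s`-th perfect matching of the near-one-factorization of the complete graph on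
`ℤ/N ∪ {N}`, for odd `N`: it joins `u` and `v` whenever `u + v = s`, and `s / 2` to `N`. -/
def partner (N s v : ℕ) : ℕ :=
  if v = N then (if s % 2 = 0 then s / 2 else (s + N) / 2)
  else if 2 * v = s ∨ 2 * v = s + N then N else if v ≤ s then s - v else s + N - v

theorem partner_injective {N s t v : ℕ} (hN : N % 2 = 1) (hs : s < N) (ht : t < N)
    (hv : v < N + 1) (h : partner N s v = partner N t v) : s = t := by
  unfold partner at h
  lia

theorem rotate_zigzag_eq_partner {N i v : ℕ} (hN : N % 2 = 1) (hi : i % 2 = 1) (hiN : i + 1 < N)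
    (hv : v < N + 1) :
    (rotate N ((i + N) / 2) (zigzag N (unrotate N ((i + N) / 2) v)) = partner N i v ∧
      rotate N ((i + N) / 2) (zagzig N (unrotate N ((i + N) / 2) v)) = partner N (i + 1) v) ∨
    (rotate N ((i + N) / 2) (zigzag N (unrotate N ((i + N) / 2) v)) = partner N (i + 1) v ∧
      rotate N ((i + N) / 2) (zagzig N (unrotate N ((i + N) / 2) v)) = partner N i v) := by
  obtain ⟨M, rfl⟩ : ∃ M, N = 2 * M + 1 := ⟨N / 2, by lia⟩
  obtain ⟨j, rfl⟩ : ∃ j, i = 2 * j + 1 := ⟨i / 2, by lia⟩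
  rw [show (2 * j + 1 + (2 * M + 1)) / 2 = j + M + 1 by lia]
  obtain ⟨w, hw, hw'⟩ : ∃ w, unrotate (2 * M + 1) (j + M + 1) v = w ∧
      (v = 2 * M + 1 ∧ w = 2 * M + 1 ∨
        v < 2 * M + 1 ∧ w < 2 * M + 1 ∧
          (v = w + (j + M + 1) ∨ v + (2 * M + 1) = w + (j + M + 1))) :=
    ⟨_, rfl, by unfold unrotate; lia⟩
  rw [hw]
  clear hw hi hN
  rcases hw' with ⟨rfl, rfl⟩ | ⟨hv, hw, h⟩
  · left
    constructor
    · unfold rotate zigzag partner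
      lia
    · unfold rotate zagzig partner
      lia
  by_cases h1 : 1 ≤ w ∧ w ≤ M
  · left
    constructor
    · have : zigzag (2 * M + 1) w = 2 * M + 1 - w := by unfold zigzag; lia
      rw [this]
      unfold rotate partner
      rcases h with rfl | h <;> lia
    · have : zagzig (2 * M + 1) w = if w = 1 then 0 else 2 * M + 1 + 1 - w := by
        unfold zagzig; lia
      rw [this]
      unfold rotate partner
      rcases h with rfl | h <;> lia
  · right
    constructor
    · have : zigzag (2 * M + 1) w = if w = M + 1 then 2 * M + 1 else if w = 0 then 1 else
          2 * M + 1 + 1 - w := by unfold zigzag; lia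
      rw [this]
      unfold rotate partner
      rcases h with rfl | h <;> lia
    · have : zagzig (2 * M + 1) w = if w = 0 then 2 * M + 1 else 2 * M + 1 - w := by
        unfold zagzig; lia
      rw [this]
      unfold rotate partner
      rcases h with rfl | h <;> lia

/-- The vertices of `ℤ/N ∪ {N}` listed in the order `N, 0, 1, -1, 2, -2, …`. -/
def vertexAt (N p : ℕ) : ℕ :=
  if p = 0 then N else if p = 1 then 0 else if p % 2 = 0 then p / 2 else N - p / 2

/-- The inverse of `vertexAt N`. -/
def position (N v : ℕ) : ℕ :=
  if v = N then 0 else if v = 0 then 1 else if v ≤ N / 2 then 2 * v else 2 * (N - v) + 1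

theorem position_lt {N v : ℕ} (hN : N % 2 = 1) (hv : v < N + 1) : position N v < N + 1 := by
  unfold position
  lia

theorem vertexAt_lt {N p : ℕ} (hp : p < N + 1) : vertexAt N p < N + 1 := by
  unfold vertexAt
  lia

theorem vertexAt_position {N v : ℕ} (hN : N % 2 = 1) (hv : v < N + 1) :
    vertexAt N (position N v) = v := by
  unfold vertexAt position
  lia

theorem position_vertexAt {N p : ℕ} (hN : N % 2 = 1) (hp : p < N + 1) :
    position N (vertexAt N p) = p := by
  unfold vertexAt position
  lia

/-- If the arcs of the matchings `partner N 0, …, partner N 4` decompose into five Hamiltonian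
cycles, then so do all arcs: the remaining matchings pair up into zigzag cycles and their
reversals. -/
theorem exists_isDirPlacement_of_five {N k : ℕ} (hN : N % 2 = 1) (hN5 : 5 ≤ N) (hk : k ≤ N)
    (f : ℕ → ℕ → ℕ) (ham : ∀ c < 5, IsHamiltonian (N + 1) (f c))
    (disj : ∀ d < 5, ∀ c < d, ∀ p < N + 1, f c p ≠ f d p)
    (low : ∀ c < 5, ∀ p < N + 1, ∃ s < 5, vertexAt N (f c p) = partner N s (vertexAt N p)) :
    ∃ σ : Fin k → (ZMod (N + 1) ≃ ZMod (N + 1)), IsDirPlacement (N + 1) k σ := by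
  let F : ℕ → ℕ → ℕ := fun i v =>
    if i < 5 then vertexAt N (f i (position N v))
    else if i % 2 = 1 then rotate N ((i + N) / 2) (zigzag N (unrotate N ((i + N) / 2) v))
    else rotate N ((i - 1 + N) / 2) (zagzig N (unrotate N ((i - 1 + N) / 2) v))
  have colour_low : ∀ i < 5, ∀ v < N + 1, ∃ s < 5, F i v = partner N s v := by
    intro i hi v hv
    obtain ⟨s, hs, h⟩ := low i hi (position N v) (position_lt hN hv)
    exact ⟨s, hs, by simpa [F, hi, vertexAt_position hN hv] using h⟩
  have colour_pair : ∀ i, 5 ≤ i → i % 2 = 1 → i < N → ∀ v < N + 1,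
      i + 1 < N ∧ (F i v = partner N i v ∧ F (i + 1) v = partner N (i + 1) v ∨
        F i v = partner N (i + 1) v ∧ F (i + 1) v = partner N i v) := by
    intro i hi hi' hiN v hv
    have hiN' : i + 1 < N := by lia
    refine ⟨hiN', ?_⟩
    have h₁ : F i v =
        rotate N ((i + N) / 2) (zigzag N (unrotate N ((i + N) / 2) v)) := by
      simp only [F]
      rw [if_neg (by lia), if_pos hi']
    have h₂ : F (i + 1) v =
        rotate N ((i + N) / 2) (zagzig N (unrotate N ((i + N) / 2) v)) := by
      simp only [F]
      rw [if_neg (by lia), if_neg (by lia), Nat.add_sub_cancel]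
    rw [h₁, h₂]
    exact rotate_zigzag_eq_partner hN hi' hiN' hv
  have colour_high : ∀ i, 5 ≤ i → i < N → ∀ v < N + 1,
      ∃ s < N, 5 ≤ s ∧ (s + 1) / 2 = (i + 1) / 2 ∧ F i v = partner N s v := by
    intro i hi hiN v hv
    by_cases hi' : i % 2 = 1
    · obtain ⟨h, h' | h'⟩ := colour_pair i hi hi' hiN v hv
      · exact ⟨i, by lia, by lia, by lia, h'.1⟩
      · exact ⟨i + 1, by lia, by lia, by lia, h'.1⟩
    · obtain ⟨j, rfl⟩ : ∃ j, i = j + 1 := ⟨i - 1, by lia⟩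
      obtain ⟨h, h' | h'⟩ := colour_pair j (by lia) (by lia) (by lia) v hv
      · exact ⟨j + 1, by lia, by lia, by lia, h'.2⟩
      · exact ⟨j, by lia, by lia, by lia, h'.2⟩
  have pair_ne : ∀ i, 5 ≤ i → i % 2 = 1 → i < N → ∀ v < N + 1, F i v ≠ F (i + 1) v := by
    intro i hi hi' hiN v hv h
    obtain ⟨hiN', ⟨h₁, h₂⟩ | ⟨h₁, h₂⟩⟩ := colour_pair i hi hi' hiN v hv <;>
    · rw [h₁, h₂] at h
      have := partner_injective hN (by lia) (by lia) hv h
      lia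
  refine exists_isDirPlacement (by lia) hk F (fun i hi => ?_) (fun i hi j hj v hv h => ?_)
  · by_cases h5 : i < 5
    · refine (ham i h5).conj (T := vertexAt N) (fun v hv => vertexAt_lt hv)
        (fun v hv => ⟨position N v, position_lt hN hv, vertexAt_position hN hv⟩) (fun u hu => ?_)
      simp [F, h5, position_vertexAt hN hu]
    by_cases hi' : i % 2 = 1
    · simp only [F, if_neg h5, if_pos hi']
      exact isHamiltonian_rotate (by lia) (isHamiltonian_zigzag (by lia))
    · simp only [F, if_neg h5, if_neg hi']
      exact isHamiltonian_rotate (by lia) (isHamiltonian_zagzig hN (by lia))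
  · by_cases hi5 : i < 5
    · obtain ⟨s, hs, h₁⟩ := colour_low i hi5 v hv
      by_cases hj5 : j < 5
      · have hp := position_lt hN hv
        have hij : f i (position N v) = f j (position N v) := by
          simp only [F, if_pos hi5, if_pos hj5] at h
          rw [← position_vertexAt hN ((ham i hi5).lt _ hp), h,
            position_vertexAt hN ((ham j hj5).lt _ hp)]
        rcases Nat.lt_trichotomy i j with h' | h' | h'
        · exact absurd hij (disj j hj5 i h' _ hp)
        · exact h'
        · exact absurd hij.symm (disj i hi5 j h' _ hp)
      · obtain ⟨t, ht, ht5, -, h₂⟩ := colour_high j (by lia) hj v hv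
        have := partner_injective hN (by lia) ht hv (h₁.symm.trans (h.trans h₂))
        lia
    · obtain ⟨s, hs, hs5, hsi, h₁⟩ := colour_high i (by lia) hi v hv
      by_cases hj5 : j < 5
      · obtain ⟨t, ht, h₂⟩ := colour_low j hj5 v hv
        have := partner_injective hN hs (by lia) hv (h₁.symm.trans (h.trans h₂))
        lia
      · obtain ⟨t, ht, ht5, htj, h₂⟩ := colour_high j (by lia) hj v hv
        have hst := partner_injective hN hs ht hv (h₁.symm.trans (h.trans h₂))
        rcases Nat.lt_trichotomy i j with hij | hij | hij
        · obtain rfl : j = i + 1 := by lia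
          exact absurd h (pair_ne i (by lia) (by lia) hi v hv)
        · exact hij
        · obtain rfl : i = j + 1 := by lia
          exact absurd h.symm (pair_ne j (by lia) (by lia) hj v hv)

theorem IsHamiltonian.of_closed {n b : ℕ} {f : ℕ → ℕ} (lt : ∀ v < n, f v < n) (hb : b < n)
    (h : ∀ R : ℕ → Prop, R (f b) → (∀ u w, R u → f u = w → R w) → ∀ v < n, R v) :
    IsHamiltonian n f :=
  ⟨lt, b, hb, h _ .refl fun _ _ hu hw => hu.tail hw⟩

theorem chain_up {A P : ℕ → Prop} {K : ℕ} (unit : ∀ q < K, A q → P q) (zero : 0 < K → A 0)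
    (succ : ∀ q, q + 1 < K → P q → A (q + 1)) : ∀ q < K, P q := by
  intro q hq
  refine unit q hq ?_
  induction q with
  | zero => exact zero hq
  | succ q ih => exact succ q hq (unit q (by lia) (ih (by lia)))

theorem chain_down {A P : ℕ → Prop} {K : ℕ} (unit : ∀ q < K, A q → P q)
    (top : ∀ q, q + 1 = K → A q) (pred : ∀ q, q + 1 < K → P (q + 1) → A q) :
    ∀ q < K, P q := by
  suffices ∀ j q, q + (j + 1) = K → A q from
    fun q hq => unit q hq (this (K - q - 1) q (by lia))
  intro j
  induction j with
  | zero => exact top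
  | succ j ih => exact fun q hq => pred q (by lia) (unit _ (by lia) (ih (q + 1) (by lia)))

theorem strand_mem {R : ℕ → Prop} {K o v : ℕ} (h : ∀ q < K, R (4 * q + o))
    (hv : v % 4 = o % 4 ∧ o ≤ v ∧ v < 4 * K + o) : R v := by
  have := h ((v - o) / 4) (by lia)
  rwa [show 4 * ((v - o) / 4) + o = v by lia] at this

theorem exists_eq_four_mul_add (p : ℕ) :
    ∃ q, p = 4 * q ∨ p = 4 * q + 1 ∨ p = 4 * q + 2 ∨ p = 4 * q + 3 :=
  ⟨p / 4, by lia⟩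

/-- The first of five arc-disjoint Hamiltonian cycles on the positions `0, …, n - 1`, where
`n = 4 * m`, that use only the arcs of `IsLowArc (n - 1)`. -/
def cycleA0 (n p : ℕ) : ℕ :=
  if p = 2 then 0 else if p = 6 then 2 else if p = n - 3 then n - 1 else
  if p = n - 1 then n - 5 else if p % 4 = 0 then p + 1 else if p % 4 = 2 then p - 7 else p + 3

/-- The second of five arc-disjoint Hamiltonian cycles on the positions `0, …, n - 1`, where
`n = 4 * m`, that use only the arcs of `IsLowArc (n - 1)`. -/
def cycleA1 (n p : ℕ) : ℕ :=
  if p = 0 then n - 1 else if p = 2 then 6 else if p = 4 then 2 else if p = n - 5 then n - 4 else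
  if p = n - 3 then n - 5 else if p = n - 1 then n - 3 else if p % 4 = 0 then p - 5 else
  if p % 4 = 1 then p - 1 else if p % 4 = 2 then p - 5 else p + 7

/-- The third of five arc-disjoint Hamiltonian cycles on the positions `0, …, n - 1`, where
`n = 4 * m`, that use only the arcs of `IsLowArc (n - 1)`. -/
def cycleA2 (n p : ℕ) : ℕ :=
  if p = 0 then 2 else if p = n - 5 then n - 3 else if p = n - 3 then n - 4 else
  if p = n - 1 then 0 else if p % 4 = 0 then p - 3 else if p % 4 = 1 then p + 5 else
  if p % 4 = 2 then p + 1 else p + 1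

/-- The fourth of five arc-disjoint Hamiltonian cycles on the positions `0, …, n - 1`, where
`n = 4 * m`, that use only the arcs of `IsLowArc (n - 1)`. -/
def cycleA3 (n p : ℕ) : ℕ :=
  if p = 0 then n - 3 else if p = 2 then 4 else if p = 4 then 0 else if p = n - 5 then n - 1 else
  if p = n - 1 then n - 7 else if p % 4 = 0 then p - 7 else if p % 4 = 1 then p + 1 else
  if p % 4 = 2 then p - 3 else p + 5

/-- The fifth of five arc-disjoint Hamiltonian cycles on the positions `0, …, n - 1`, where
`n = 4 * m`, that use only the arcs of `IsLowArc (n - 1)`. -/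
def cycleA4 (n p : ℕ) : ℕ :=
  if p = 0 then 4 else if p = n - 7 then n - 1 else if p = n - 3 then 0 else
  if p % 4 = 1 then p + 7 else p - 1

theorem isHamiltonian_cycleA0 {m : ℕ} (hm : 3 ≤ m) :
    IsHamiltonian (4 * m) (cycleA0 (4 * m)) := by
  refine .of_closed (b := 2) (fun v hv => by unfold cycleA0; lia) (by lia)
    fun R start step v hv => ?_
  have r0 : R 0 := by rwa [show cycleA0 (4 * m) 2 = 0 by unfold cycleA0; lia] at start
  have unit : ∀ q < m, R (4 * q) →
      R (4 * q) ∧ R (4 * q + 1) := by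
    intro q hq h0
    have h1 : R (4 * q + 1) := step _ _ h0 (by unfold cycleA0; lia)
    exact ⟨h0, h1⟩
  have strand := chain_up unit (fun _ => r0) fun q hq h =>
    step _ _ h.2 (by unfold cycleA0; lia)
  have r1 : R (4 * m - 1) := step _ _ (strand (m - 1) (by lia)).2 (by unfold cycleA0; lia)
  have r2 : R (4 * m - 5) := step _ _ r1 (by unfold cycleA0; lia)
  have r3 : R (4 * m - 2) := step _ _ r2 (by unfold cycleA0; lia)
  have unit1 : ∀ q < m - 2, R (4 * q + 3) →
      R (4 * q + 3) ∧ R (4 * q + 6) := by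
    intro q hq h0
    have h1 : R (4 * q + 6) := step _ _ h0 (by unfold cycleA0; lia)
    exact ⟨h0, h1⟩
  have strand1 := chain_down unit1
    (fun q hq => step _ _ r3 (by unfold cycleA0; lia)) fun q hq h =>
    step _ _ h.2 (by unfold cycleA0; lia)
  have r4 : R 2 := step _ _ (strand1 0 (by lia)).2 (by unfold cycleA0; lia)
  have key : v % 4 = 0 ∧ v < 4 * m ∨ v % 4 = 1 ∧ 1 ≤ v ∧ v < 4 * m + 1 ∨ v = 4 * m - 1 ∨
      v = 4 * m - 5 ∨ v = 4 * m - 2 ∨ v % 4 = 3 ∧ 3 ≤ v ∧ v < 4 * (m - 2) + 3 ∨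
      v % 4 = 2 ∧ 6 ≤ v ∧ v < 4 * (m - 2) + 6 ∨ v = 2 := by
    lia
  rcases key with h | h | rfl | rfl | rfl | h | h | rfl
  · exact strand_mem (K := m) (o := 0) (fun q hq => (strand q hq).1)
      ⟨h.1, by lia, h.2⟩
  · exact strand_mem (fun q hq => (strand q hq).2) h
  · exact r1
  · exact r2
  · exact r3
  · exact strand_mem (fun q hq => (strand1 q hq).1) h
  · exact strand_mem (fun q hq => (strand1 q hq).2) h
  · exact r4

theorem isHamiltonian_cycleA1 {m : ℕ} (hm : 3 ≤ m) :
    IsHamiltonian (4 * m) (cycleA1 (4 * m)) := by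
  refine .of_closed (b := 1) (fun v hv => by unfold cycleA1; lia (splits := 30)) (by lia)
    fun R start step v hv => ?_
  have r0 : R 0 := by rwa [show cycleA1 (4 * m) 1 = 0 by unfold cycleA1; lia] at start
  have r1 : R (4 * m - 1) := step _ _ r0 (by unfold cycleA1; lia (splits := 30))
  have r2 : R (4 * m - 3) := step _ _ r1 (by unfold cycleA1; lia (splits := 30))
  have r3 : R (4 * m - 5) := step _ _ r2 (by unfold cycleA1; lia (splits := 30))
  have r4 : R (4 * m - 4) := step _ _ r3 (by unfold cycleA1; lia (splits := 30))
  have unit : ∀ q < m - 2, R (4 * q + 3) →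
      R (4 * q + 3) ∧ R (4 * q + 10) ∧ R (4 * q + 5) ∧ R (4 * q + 4) := by
    intro q hq h0
    have h1 : R (4 * q + 10) := step _ _ h0 (by unfold cycleA1; lia (splits := 30))
    have h2 : R (4 * q + 5) := step _ _ h1 (by unfold cycleA1; lia (splits := 30))
    have h3 : R (4 * q + 4) := step _ _ h2 (by unfold cycleA1; lia (splits := 30))
    exact ⟨h0, h1, h2, h3⟩
  have strand := chain_down unit
    (fun q hq => step _ _ r4 (by unfold cycleA1; lia (splits := 30))) fun q hq h =>
    step _ _ h.2.2.2 (by unfold cycleA1; lia (splits := 30))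
  have r5 : R 2 := step _ _ (strand 0 (by lia)).2.2.2 (by unfold cycleA1; lia (splits := 30))
  have r6 : R 6 := step _ _ r5 (by unfold cycleA1; lia (splits := 30))
  have r7 : R 1 := step _ _ r6 (by unfold cycleA1; lia (splits := 30))
  have key : v = 0 ∨ v = 4 * m - 1 ∨ v = 4 * m - 3 ∨ v = 4 * m - 5 ∨ v = 4 * m - 4 ∨
      v % 4 = 3 ∧ 3 ≤ v ∧ v < 4 * (m - 2) + 3 ∨ v % 4 = 2 ∧ 10 ≤ v ∧ v < 4 * (m - 2) + 10 ∨
      v % 4 = 1 ∧ 5 ≤ v ∧ v < 4 * (m - 2) + 5 ∨ v % 4 = 0 ∧ 4 ≤ v ∧ v < 4 * (m - 2) + 4 ∨ v = 2 ∨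
      v = 6 ∨ v = 1 := by
    lia
  rcases key with rfl | rfl | rfl | rfl | rfl | h | h | h | h | rfl | rfl | rfl
  · exact r0
  · exact r1
  · exact r2
  · exact r3
  · exact r4
  · exact strand_mem (fun q hq => (strand q hq).1) h
  · exact strand_mem (fun q hq => (strand q hq).2.1) h
  · exact strand_mem (fun q hq => (strand q hq).2.2.1) h
  · exact strand_mem (fun q hq => (strand q hq).2.2.2) h
  · exact r5
  · exact r6
  · exact r7

theorem isHamiltonian_cycleA2 {m : ℕ} (hm : 3 ≤ m) :
    IsHamiltonian (4 * m) (cycleA2 (4 * m)) := by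
  refine .of_closed (b := 4 * m - 1) (fun v hv => by unfold cycleA2; lia) (by lia)
    fun R start step v hv => ?_
  have r0 : R 0 := by rwa [show cycleA2 (4 * m) (4 * m - 1) = 0 by unfold cycleA2; lia] at start
  have unit : ∀ q < m - 2, R (4 * q + 2) →
      R (4 * q + 2) ∧ R (4 * q + 3) ∧ R (4 * q + 4) ∧ R (4 * q + 1) := by
    intro q hq h0
    have h1 : R (4 * q + 3) := step _ _ h0 (by unfold cycleA2; lia)
    have h2 : R (4 * q + 4) := step _ _ h1 (by unfold cycleA2; lia)
    have h3 : R (4 * q + 1) := step _ _ h2 (by unfold cycleA2; lia)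
    exact ⟨h0, h1, h2, h3⟩
  have strand := chain_up unit (fun _ => step _ _ r0 (by unfold cycleA2; lia)) fun q hq h =>
    step _ _ h.2.2.2 (by unfold cycleA2; lia)
  have r1 : R (4 * m - 6) := step _ _ (strand (m - 3) (by lia)).2.2.2 (by unfold cycleA2; lia)
  have r2 : R (4 * m - 5) := step _ _ r1 (by unfold cycleA2; lia)
  have r3 : R (4 * m - 3) := step _ _ r2 (by unfold cycleA2; lia)
  have r4 : R (4 * m - 4) := step _ _ r3 (by unfold cycleA2; lia)
  have r5 : R (4 * m - 7) := step _ _ r4 (by unfold cycleA2; lia)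
  have r6 : R (4 * m - 2) := step _ _ r5 (by unfold cycleA2; lia)
  have r7 : R (4 * m - 1) := step _ _ r6 (by unfold cycleA2; lia)
  have key : v = 0 ∨ v % 4 = 2 ∧ 2 ≤ v ∧ v < 4 * (m - 2) + 2 ∨
      v % 4 = 3 ∧ 3 ≤ v ∧ v < 4 * (m - 2) + 3 ∨ v % 4 = 0 ∧ 4 ≤ v ∧ v < 4 * (m - 2) + 4 ∨
      v % 4 = 1 ∧ 1 ≤ v ∧ v < 4 * (m - 2) + 1 ∨ v = 4 * m - 6 ∨ v = 4 * m - 5 ∨ v = 4 * m - 3 ∨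
      v = 4 * m - 4 ∨ v = 4 * m - 7 ∨ v = 4 * m - 2 ∨ v = 4 * m - 1 := by
    lia
  rcases key with rfl | h | h | h | h | rfl | rfl | rfl | rfl | rfl | rfl | rfl
  · exact r0
  · exact strand_mem (fun q hq => (strand q hq).1) h
  · exact strand_mem (fun q hq => (strand q hq).2.1) h
  · exact strand_mem (fun q hq => (strand q hq).2.2.1) h
  · exact strand_mem (fun q hq => (strand q hq).2.2.2) h
  · exact r1
  · exact r2
  · exact r3
  · exact r4
  · exact r5
  · exact r6
  · exact r7

theorem isHamiltonian_cycleA3 {m : ℕ} (hm : 3 ≤ m) :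
    IsHamiltonian (4 * m) (cycleA3 (4 * m)) := by
  refine .of_closed (b := 4) (fun v hv => by unfold cycleA3; lia) (by lia)
    fun R start step v hv => ?_
  have r0 : R 0 := by rwa [show cycleA3 (4 * m) 4 = 0 by unfold cycleA3; lia] at start
  have r1 : R (4 * m - 3) := step _ _ r0 (by unfold cycleA3; lia)
  have r2 : R (4 * m - 2) := step _ _ r1 (by unfold cycleA3; lia)
  have r3 : R (4 * m - 5) := step _ _ r2 (by unfold cycleA3; lia)
  have r4 : R (4 * m - 1) := step _ _ r3 (by unfold cycleA3; lia)
  have unit : ∀ q < m - 2, R (4 * q + 5) →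
      R (4 * q + 5) ∧ R (4 * q + 6) ∧ R (4 * q + 3) ∧ R (4 * q + 8) := by
    intro q hq h0
    have h1 : R (4 * q + 6) := step _ _ h0 (by unfold cycleA3; lia)
    have h2 : R (4 * q + 3) := step _ _ h1 (by unfold cycleA3; lia)
    have h3 : R (4 * q + 8) := step _ _ h2 (by unfold cycleA3; lia)
    exact ⟨h0, h1, h2, h3⟩
  have strand := chain_down unit
    (fun q hq => step _ _ r4 (by unfold cycleA3; lia)) fun q hq h =>
    step _ _ h.2.2.2 (by unfold cycleA3; lia)
  have r5 : R 1 := step _ _ (strand 0 (by lia)).2.2.2 (by unfold cycleA3; lia)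
  have r6 : R 2 := step _ _ r5 (by unfold cycleA3; lia)
  have r7 : R 4 := step _ _ r6 (by unfold cycleA3; lia)
  have key : v = 0 ∨ v = 4 * m - 3 ∨ v = 4 * m - 2 ∨ v = 4 * m - 5 ∨ v = 4 * m - 1 ∨
      v % 4 = 1 ∧ 5 ≤ v ∧ v < 4 * (m - 2) + 5 ∨ v % 4 = 2 ∧ 6 ≤ v ∧ v < 4 * (m - 2) + 6 ∨
      v % 4 = 3 ∧ 3 ≤ v ∧ v < 4 * (m - 2) + 3 ∨ v % 4 = 0 ∧ 8 ≤ v ∧ v < 4 * (m - 2) + 8 ∨ v = 1 ∨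
      v = 2 ∨ v = 4 := by
    lia
  rcases key with rfl | rfl | rfl | rfl | rfl | h | h | h | h | rfl | rfl | rfl
  · exact r0
  · exact r1
  · exact r2
  · exact r3
  · exact r4
  · exact strand_mem (fun q hq => (strand q hq).1) h
  · exact strand_mem (fun q hq => (strand q hq).2.1) h
  · exact strand_mem (fun q hq => (strand q hq).2.2.1) h
  · exact strand_mem (fun q hq => (strand q hq).2.2.2) h
  · exact r5
  · exact r6
  · exact r7

theorem isHamiltonian_cycleA4 {m : ℕ} (hm : 3 ≤ m) :
    IsHamiltonian (4 * m) (cycleA4 (4 * m)) := by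
  refine .of_closed (b := 4 * m - 3) (fun v hv => by unfold cycleA4; lia) (by lia)
    fun R start step v hv => ?_
  have r0 : R 0 := by rwa [show cycleA4 (4 * m) (4 * m - 3) = 0 by unfold cycleA4; lia] at start
  have unit : ∀ q < m - 1, R (4 * q + 4) →
      R (4 * q + 4) ∧ R (4 * q + 3) ∧ R (4 * q + 2) ∧ R (4 * q + 1) := by
    intro q hq h0
    have h1 : R (4 * q + 3) := step _ _ h0 (by unfold cycleA4; lia)
    have h2 : R (4 * q + 2) := step _ _ h1 (by unfold cycleA4; lia)
    have h3 : R (4 * q + 1) := step _ _ h2 (by unfold cycleA4; lia)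
    exact ⟨h0, h1, h2, h3⟩
  have strand := chain_up unit (fun _ => step _ _ r0 (by unfold cycleA4; lia)) fun q hq h =>
    step _ _ h.2.2.2 (by unfold cycleA4; lia)
  have r1 : R (4 * m - 1) := step _ _ (strand (m - 2) (by lia)).2.2.2 (by unfold cycleA4; lia)
  have r2 : R (4 * m - 2) := step _ _ r1 (by unfold cycleA4; lia)
  have r3 : R (4 * m - 3) := step _ _ r2 (by unfold cycleA4; lia)
  have key : v = 0 ∨ v % 4 = 0 ∧ 4 ≤ v ∧ v < 4 * (m - 1) + 4 ∨
      v % 4 = 3 ∧ 3 ≤ v ∧ v < 4 * (m - 1) + 3 ∨ v % 4 = 2 ∧ 2 ≤ v ∧ v < 4 * (m - 1) + 2 ∨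
      v % 4 = 1 ∧ 1 ≤ v ∧ v < 4 * (m - 1) + 1 ∨ v = 4 * m - 1 ∨ v = 4 * m - 2 ∨
      v = 4 * m - 3 := by
    lia
  rcases key with rfl | h | h | h | h | rfl | rfl | rfl
  · exact r0
  · exact strand_mem (fun q hq => (strand q hq).1) h
  · exact strand_mem (fun q hq => (strand q hq).2.1) h
  · exact strand_mem (fun q hq => (strand q hq).2.2.1) h
  · exact strand_mem (fun q hq => (strand q hq).2.2.2) h
  · exact r1
  · exact r2
  · exact r3

/-- The first of five arc-disjoint Hamiltonian cycles on the positions `0, …, n - 1`, where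
`n = 4 * m + 2`, that use only the arcs of `IsLowArc (n - 1)`. -/
def cycleB0 (n p : ℕ) : ℕ :=
  if p = 2 then 0 else if p = 6 then 2 else if p = n - 5 then n - 1 else
  if p = n - 3 then n - 2 else if p = n - 2 then n - 7 else if p = n - 1 then n - 3 else
  if p % 4 = 0 then p + 1 else if p % 4 = 2 then p - 7 else p + 3

/-- The second of five arc-disjoint Hamiltonian cycles on the positions `0, …, n - 1`, where
`n = 4 * m + 2`, that use only the arcs of `IsLowArc (n - 1)`. -/
def cycleB1 (n p : ℕ) : ℕ :=
  if p = 0 then n - 3 else if p = 2 then 6 else if p = 4 then 2 else if p = n - 7 then n - 1 else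
  if p = n - 4 then n - 7 else if p = n - 3 then n - 5 else if p = n - 2 then n - 9 else
  if p % 4 = 0 then p - 5 else if p % 4 = 1 then p - 1 else if p % 4 = 2 then p - 5 else p + 7

/-- The third of five arc-disjoint Hamiltonian cycles on the positions `0, …, n - 1`, where
`n = 4 * m + 2`, that use only the arcs of `IsLowArc (n - 1)`. -/
def cycleB2 (n p : ℕ) : ℕ :=
  if p = 0 then 2 else if p = n - 5 then n - 2 else if p = n - 4 then n - 5 else
  if p = n - 3 then n - 1 else if p = n - 2 then n - 3 else if p = n - 1 then 0 else
  if p % 4 = 0 then p - 3 else if p % 4 = 1 then p + 5 else if p % 4 = 2 then p + 1 else p + 1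

/-- The fourth of five arc-disjoint Hamiltonian cycles on the positions `0, …, n - 1`, where
`n = 4 * m + 2`, that use only the arcs of `IsLowArc (n - 1)`. -/
def cycleB3 (n p : ℕ) : ℕ :=
  if p = 0 then n - 1 else if p = 2 then 4 else if p = 4 then 0 else if p = n - 5 then n - 3 else
  if p = n - 4 then n - 9 else if p = n - 3 then n - 4 else if p = n - 2 then n - 5 else
  if p = n - 1 then n - 7 else if p % 4 = 0 then p - 7 else if p % 4 = 1 then p + 1 else
  if p % 4 = 2 then p - 3 else p + 5

/-- The fifth of five arc-disjoint Hamiltonian cycles on the positions `0, …, n - 1`, where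
`n = 4 * m + 2`, that use only the arcs of `IsLowArc (n - 1)`. -/
def cycleB4 (n p : ℕ) : ℕ :=
  if p = 0 then 4 else if p = n - 5 then n - 4 else if p = n - 4 then n - 3 else
  if p = n - 3 then 0 else if p = n - 2 then n - 1 else if p = n - 1 then n - 5 else
  if p % 4 = 1 then p + 7 else p - 1

theorem isHamiltonian_cycleB0 {m : ℕ} (hm : 3 ≤ m) :
    IsHamiltonian (4 * m + 2) (cycleB0 (4 * m + 2)) := by
  refine .of_closed (b := 2) (fun v hv => by unfold cycleB0; lia) (by lia)
    fun R start step v hv => ?_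
  have r0 : R 0 := by rwa [show cycleB0 (4 * m + 2) 2 = 0 by unfold cycleB0; lia] at start
  have unit : ∀ q < m, R (4 * q) →
      R (4 * q) ∧ R (4 * q + 1) := by
    intro q hq h0
    have h1 : R (4 * q + 1) := step _ _ h0 (by unfold cycleB0; lia)
    exact ⟨h0, h1⟩
  have strand := chain_up unit (fun _ => r0) fun q hq h =>
    step _ _ h.2 (by unfold cycleB0; lia)
  have r1 : R (4 * m + 1) := step _ _ (strand (m - 1) (by lia)).2 (by unfold cycleB0; lia)
  have r2 : R (4 * m - 1) := step _ _ r1 (by unfold cycleB0; lia)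
  have r3 : R (4 * m) := step _ _ r2 (by unfold cycleB0; lia)
  have unit1 : ∀ q < m - 1, R (4 * q + 3) →
      R (4 * q + 3) ∧ R (4 * q + 6) := by
    intro q hq h0
    have h1 : R (4 * q + 6) := step _ _ h0 (by unfold cycleB0; lia)
    exact ⟨h0, h1⟩
  have strand1 := chain_down unit1
    (fun q hq => step _ _ r3 (by unfold cycleB0; lia)) fun q hq h =>
    step _ _ h.2 (by unfold cycleB0; lia)
  have r4 : R 2 := step _ _ (strand1 0 (by lia)).2 (by unfold cycleB0; lia)
  have key : v % 4 = 0 ∧ v < 4 * m ∨ v % 4 = 1 ∧ 1 ≤ v ∧ v < 4 * m + 1 ∨ v = 4 * m + 1 ∨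
      v = 4 * m - 1 ∨ v = 4 * m ∨ v % 4 = 3 ∧ 3 ≤ v ∧ v < 4 * (m - 1) + 3 ∨
      v % 4 = 2 ∧ 6 ≤ v ∧ v < 4 * (m - 1) + 6 ∨ v = 2 := by
    lia
  rcases key with h | h | rfl | rfl | rfl | h | h | rfl
  · exact strand_mem (K := m) (o := 0) (fun q hq => (strand q hq).1)
      ⟨h.1, by lia, h.2⟩
  · exact strand_mem (fun q hq => (strand q hq).2) h
  · exact r1
  · exact r2
  · exact r3
  · exact strand_mem (fun q hq => (strand1 q hq).1) h
  · exact strand_mem (fun q hq => (strand1 q hq).2) h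
  · exact r4

theorem isHamiltonian_cycleB1 {m : ℕ} (hm : 3 ≤ m) :
    IsHamiltonian (4 * m + 2) (cycleB1 (4 * m + 2)) := by
  refine .of_closed (b := 1) (fun v hv => ?_) (by lia)
    fun R start step v hv => ?_
  · unfold cycleB1
    obtain ⟨q, rfl | rfl | rfl | rfl⟩ := exists_eq_four_mul_add v <;> lia (splits := 30)
  have r0 : R 0 := by rwa [show cycleB1 (4 * m + 2) 1 = 0 by unfold cycleB1; lia] at start
  have r1 : R (4 * m - 1) := step _ _ r0 (by unfold cycleB1; lia (splits := 30))
  have r2 : R (4 * m - 3) := step _ _ r1 (by unfold cycleB1; lia (splits := 30))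
  have r3 : R (4 * m - 4) := step _ _ r2 (by unfold cycleB1; lia (splits := 30))
  have r4 : R (4 * m - 9) := step _ _ r3 (by unfold cycleB1; lia (splits := 30))
  have r5 : R (4 * m - 2) := step _ _ r4 (by unfold cycleB1; lia (splits := 30))
  have r6 : R (4 * m - 5) := step _ _ r5 (by unfold cycleB1; lia (splits := 30))
  have r7 : R (4 * m + 1) := step _ _ r6 (by unfold cycleB1; lia (splits := 30))
  have r8 : R (4 * m) := step _ _ r7 (by unfold cycleB1; lia (splits := 30))
  have r9 : R (4 * m - 7) := step _ _ r8 (by unfold cycleB1; lia (splits := 30))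
  have r10 : R (4 * m - 8) := step _ _ r9 (by unfold cycleB1; lia (splits := 30))
  have unit : ∀ q < m - 3, R (4 * q + 3) →
      R (4 * q + 3) ∧ R (4 * q + 10) ∧ R (4 * q + 5) ∧ R (4 * q + 4) := by
    intro q hq h0
    have h1 : R (4 * q + 10) := step _ _ h0 (by unfold cycleB1; lia (splits := 30))
    have h2 : R (4 * q + 5) := step _ _ h1 (by unfold cycleB1; lia (splits := 30))
    have h3 : R (4 * q + 4) := step _ _ h2 (by unfold cycleB1; lia (splits := 30))
    exact ⟨h0, h1, h2, h3⟩
  have strand := chain_down unit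
    (fun q hq => step _ _ r10 (by unfold cycleB1; lia (splits := 30))) fun q hq h =>
    step _ _ h.2.2.2 (by unfold cycleB1; lia (splits := 30))
  have r11 : R 4 := by
    rcases Nat.eq_or_lt_of_le hm with rfl | h
    · exact r10
    · exact (strand 0 (by lia)).2.2.2
  have r12 : R 2 := step _ _ r11 (by unfold cycleB1; lia (splits := 30))
  have r13 : R 6 := step _ _ r12 (by unfold cycleB1; lia (splits := 30))
  have r14 : R 1 := step _ _ r13 (by unfold cycleB1; lia (splits := 30))
  have key : v = 0 ∨ v = 4 * m - 1 ∨ v = 4 * m - 3 ∨ v = 4 * m - 4 ∨ v = 4 * m - 9 ∨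
      v = 4 * m - 2 ∨ v = 4 * m - 5 ∨ v = 4 * m + 1 ∨ v = 4 * m ∨ v = 4 * m - 7 ∨ v = 4 * m - 8 ∨
      v % 4 = 3 ∧ 3 ≤ v ∧ v < 4 * (m - 3) + 3 ∨ v % 4 = 2 ∧ 10 ≤ v ∧ v < 4 * (m - 3) + 10 ∨
      v % 4 = 1 ∧ 5 ≤ v ∧ v < 4 * (m - 3) + 5 ∨ v % 4 = 0 ∧ 4 ≤ v ∧ v < 4 * (m - 3) + 4 ∨ v = 2 ∨
      v = 6 ∨ v = 1 := by
    lia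
  rcases key with rfl | rfl | rfl | rfl | rfl | rfl | rfl | rfl | rfl | rfl | rfl | h | h | h | h
    | rfl | rfl | rfl
  · exact r0
  · exact r1
  · exact r2
  · exact r3
  · exact r4
  · exact r5
  · exact r6
  · exact r7
  · exact r8
  · exact r9
  · exact r10
  · exact strand_mem (fun q hq => (strand q hq).1) h
  · exact strand_mem (fun q hq => (strand q hq).2.1) h
  · exact strand_mem (fun q hq => (strand q hq).2.2.1) h
  · exact strand_mem (fun q hq => (strand q hq).2.2.2) h
  · exact r12
  · exact r13
  · exact r14

theorem isHamiltonian_cycleB2 {m : ℕ} (hm : 3 ≤ m) :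
    IsHamiltonian (4 * m + 2) (cycleB2 (4 * m + 2)) := by
  refine .of_closed (b := 4 * m + 1) (fun v hv => by unfold cycleB2; lia) (by lia)
    fun R start step v hv => ?_
  have r0 : R 0 := by rwa [show cycleB2 (4 * m + 2) (4 * m + 1) = 0 by unfold cycleB2; lia] at start
  have unit : ∀ q < m - 1, R (4 * q + 2) →
      R (4 * q + 2) ∧ R (4 * q + 3) ∧ R (4 * q + 4) ∧ R (4 * q + 1) := by
    intro q hq h0
    have h1 : R (4 * q + 3) := step _ _ h0 (by unfold cycleB2; lia)
    have h2 : R (4 * q + 4) := step _ _ h1 (by unfold cycleB2; lia)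
    have h3 : R (4 * q + 1) := step _ _ h2 (by unfold cycleB2; lia)
    exact ⟨h0, h1, h2, h3⟩
  have strand := chain_up unit (fun _ => step _ _ r0 (by unfold cycleB2; lia)) fun q hq h =>
    step _ _ h.2.2.2 (by unfold cycleB2; lia)
  have r1 : R (4 * m - 2) := step _ _ (strand (m - 2) (by lia)).2.2.2 (by unfold cycleB2; lia)
  have r2 : R (4 * m - 3) := step _ _ r1 (by unfold cycleB2; lia)
  have r3 : R (4 * m) := step _ _ r2 (by unfold cycleB2; lia)
  have r4 : R (4 * m - 1) := step _ _ r3 (by unfold cycleB2; lia)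
  have r5 : R (4 * m + 1) := step _ _ r4 (by unfold cycleB2; lia)
  have key : v = 0 ∨ v % 4 = 2 ∧ 2 ≤ v ∧ v < 4 * (m - 1) + 2 ∨
      v % 4 = 3 ∧ 3 ≤ v ∧ v < 4 * (m - 1) + 3 ∨ v % 4 = 0 ∧ 4 ≤ v ∧ v < 4 * (m - 1) + 4 ∨
      v % 4 = 1 ∧ 1 ≤ v ∧ v < 4 * (m - 1) + 1 ∨ v = 4 * m - 2 ∨ v = 4 * m - 3 ∨ v = 4 * m ∨
      v = 4 * m - 1 ∨ v = 4 * m + 1 := by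
    lia
  rcases key with rfl | h | h | h | h | rfl | rfl | rfl | rfl | rfl
  · exact r0
  · exact strand_mem (fun q hq => (strand q hq).1) h
  · exact strand_mem (fun q hq => (strand q hq).2.1) h
  · exact strand_mem (fun q hq => (strand q hq).2.2.1) h
  · exact strand_mem (fun q hq => (strand q hq).2.2.2) h
  · exact r1
  · exact r2
  · exact r3
  · exact r4
  · exact r5

theorem isHamiltonian_cycleB3 {m : ℕ} (hm : 3 ≤ m) :
    IsHamiltonian (4 * m + 2) (cycleB3 (4 * m + 2)) := by
  refine .of_closed (b := 4) (fun v hv => ?_) (by lia)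
    fun R start step v hv => ?_
  · unfold cycleB3
    obtain ⟨q, rfl | rfl | rfl | rfl⟩ := exists_eq_four_mul_add v <;> lia (splits := 30)
  have r0 : R 0 := by rwa [show cycleB3 (4 * m + 2) 4 = 0 by unfold cycleB3; lia] at start
  have r1 : R (4 * m + 1) := step _ _ r0 (by unfold cycleB3; lia (splits := 30))
  have r2 : R (4 * m - 5) := step _ _ r1 (by unfold cycleB3; lia (splits := 30))
  have r3 : R (4 * m) := step _ _ r2 (by unfold cycleB3; lia (splits := 30))
  have r4 : R (4 * m - 3) := step _ _ r3 (by unfold cycleB3; lia (splits := 30))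
  have r5 : R (4 * m - 1) := step _ _ r4 (by unfold cycleB3; lia (splits := 30))
  have r6 : R (4 * m - 2) := step _ _ r5 (by unfold cycleB3; lia (splits := 30))
  have unit : ∀ q < m - 2, R (4 * q + 5) →
      R (4 * q + 5) ∧ R (4 * q + 6) ∧ R (4 * q + 3) ∧ R (4 * q + 8) := by
    intro q hq h0
    have h1 : R (4 * q + 6) := step _ _ h0 (by unfold cycleB3; lia (splits := 30))
    have h2 : R (4 * q + 3) := step _ _ h1 (by unfold cycleB3; lia (splits := 30))
    have h3 : R (4 * q + 8) := step _ _ h2 (by unfold cycleB3; lia (splits := 30))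
    exact ⟨h0, h1, h2, h3⟩
  have strand := chain_down unit
    (fun q hq => step _ _ r6 (by unfold cycleB3; lia (splits := 30))) fun q hq h =>
    step _ _ h.2.2.2 (by unfold cycleB3; lia (splits := 30))
  have r7 : R 1 := step _ _ (strand 0 (by lia)).2.2.2 (by unfold cycleB3; lia (splits := 30))
  have r8 : R 2 := step _ _ r7 (by unfold cycleB3; lia (splits := 30))
  have r9 : R 4 := step _ _ r8 (by unfold cycleB3; lia (splits := 30))
  have key : v = 0 ∨ v = 4 * m + 1 ∨ v = 4 * m - 5 ∨ v = 4 * m ∨ v = 4 * m - 3 ∨ v = 4 * m - 1 ∨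
      v = 4 * m - 2 ∨ v % 4 = 1 ∧ 5 ≤ v ∧ v < 4 * (m - 2) + 5 ∨
      v % 4 = 2 ∧ 6 ≤ v ∧ v < 4 * (m - 2) + 6 ∨ v % 4 = 3 ∧ 3 ≤ v ∧ v < 4 * (m - 2) + 3 ∨
      v % 4 = 0 ∧ 8 ≤ v ∧ v < 4 * (m - 2) + 8 ∨ v = 1 ∨ v = 2 ∨ v = 4 := by
    lia
  rcases key with rfl | rfl | rfl | rfl | rfl | rfl | rfl | h | h | h | h | rfl | rfl | rfl
  · exact r0
  · exact r1
  · exact r2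
  · exact r3
  · exact r4
  · exact r5
  · exact r6
  · exact strand_mem (fun q hq => (strand q hq).1) h
  · exact strand_mem (fun q hq => (strand q hq).2.1) h
  · exact strand_mem (fun q hq => (strand q hq).2.2.1) h
  · exact strand_mem (fun q hq => (strand q hq).2.2.2) h
  · exact r7
  · exact r8
  · exact r9

theorem isHamiltonian_cycleB4 {m : ℕ} (hm : 3 ≤ m) :
    IsHamiltonian (4 * m + 2) (cycleB4 (4 * m + 2)) := by
  refine .of_closed (b := 4 * m - 1) (fun v hv => by unfold cycleB4; lia) (by lia)
    fun R start step v hv => ?_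
  have r0 : R 0 := by rwa [show cycleB4 (4 * m + 2) (4 * m - 1) = 0 by unfold cycleB4; lia] at start
  have unit : ∀ q < m - 1, R (4 * q + 4) →
      R (4 * q + 4) ∧ R (4 * q + 3) ∧ R (4 * q + 2) ∧ R (4 * q + 1) := by
    intro q hq h0
    have h1 : R (4 * q + 3) := step _ _ h0 (by unfold cycleB4; lia)
    have h2 : R (4 * q + 2) := step _ _ h1 (by unfold cycleB4; lia)
    have h3 : R (4 * q + 1) := step _ _ h2 (by unfold cycleB4; lia)
    exact ⟨h0, h1, h2, h3⟩
  have strand := chain_up unit (fun _ => step _ _ r0 (by unfold cycleB4; lia)) fun q hq h =>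
    step _ _ h.2.2.2 (by unfold cycleB4; lia)
  have r1 : R (4 * m) := step _ _ (strand (m - 2) (by lia)).2.2.2 (by unfold cycleB4; lia)
  have r2 : R (4 * m + 1) := step _ _ r1 (by unfold cycleB4; lia)
  have r3 : R (4 * m - 3) := step _ _ r2 (by unfold cycleB4; lia)
  have r4 : R (4 * m - 2) := step _ _ r3 (by unfold cycleB4; lia)
  have r5 : R (4 * m - 1) := step _ _ r4 (by unfold cycleB4; lia)
  have key : v = 0 ∨ v % 4 = 0 ∧ 4 ≤ v ∧ v < 4 * (m - 1) + 4 ∨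
      v % 4 = 3 ∧ 3 ≤ v ∧ v < 4 * (m - 1) + 3 ∨ v % 4 = 2 ∧ 2 ≤ v ∧ v < 4 * (m - 1) + 2 ∨
      v % 4 = 1 ∧ 1 ≤ v ∧ v < 4 * (m - 1) + 1 ∨ v = 4 * m ∨ v = 4 * m + 1 ∨ v = 4 * m - 3 ∨
      v = 4 * m - 2 ∨ v = 4 * m - 1 := by
    lia
  rcases key with rfl | h | h | h | h | rfl | rfl | rfl | rfl | rfl
  · exact r0
  · exact strand_mem (fun q hq => (strand q hq).1) h
  · exact strand_mem (fun q hq => (strand q hq).2.1) h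
  · exact strand_mem (fun q hq => (strand q hq).2.2.1) h
  · exact strand_mem (fun q hq => (strand q hq).2.2.2) h
  · exact r1
  · exact r2
  · exact r3
  · exact r4
  · exact r5

theorem partner_vertexAt_of_even_odd {N p q : ℕ} (hN : N % 2 = 1) (hp : p < N + 1) (hq : q < N + 1)
    (hp2 : p % 2 = 0) (hq2 : q % 2 = 1) (h0 : 1 ≤ p) (hpq : q ≤ p + 1) (hqp : p ≤ q + 7) :
    ∃ s < 5, vertexAt N q = partner N s (vertexAt N p) ∧
      vertexAt N p = partner N s (vertexAt N q) := by
  obtain ⟨a, rfl⟩ : ∃ a, p = 2 * a := ⟨p / 2, by lia⟩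
  obtain ⟨b, rfl⟩ : ∃ b, q = 2 * b + 1 := ⟨q / 2, by lia⟩
  have h₁ : vertexAt N (2 * a) = a := by unfold vertexAt; lia
  have h₂ : vertexAt N (2 * b + 1) = if b = 0 then 0 else N - b := by unfold vertexAt; lia
  refine ⟨a - b, by lia, ?_⟩
  rw [h₁, h₂]
  unfold partner
  constructor <;> lia

/-- The arcs, between positions, of the matchings `partner N 0, …, partner N 4`. -/
def IsLowArc (N p q : ℕ) : Prop :=
  p = 0 ∧ (q = 1 ∨ q = 2 ∨ q = 4 ∨ q = N - 2 ∨ q = N) ∨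
  q = 0 ∧ (p = 1 ∨ p = 2 ∨ p = 4 ∨ p = N - 2 ∨ p = N) ∨
  1 ≤ p ∧ p % 2 = 0 ∧ q % 2 = 1 ∧ q ≤ p + 1 ∧ p ≤ q + 7 ∨
  1 ≤ q ∧ q % 2 = 0 ∧ p % 2 = 1 ∧ p ≤ q + 1 ∧ q ≤ p + 7 ∨
  p % 2 = 0 ∧ q % 2 = 0 ∧ 1 ≤ p ∧ 1 ≤ q ∧ p ≠ q ∧ p + q < 10 ∨
  p % 2 = 1 ∧ q % 2 = 1 ∧ p ≠ q ∧ 2 * N ≤ p + q + 6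

theorem IsLowArc.exists_partner {N p q : ℕ} (hN : N % 2 = 1) (hN9 : 9 ≤ N) (hp : p < N + 1)
    (hq : q < N + 1) (h : IsLowArc N p q) :
    ∃ s < 5, vertexAt N q = partner N s (vertexAt N p) := by
  rcases h with ⟨rfl, h⟩ | ⟨rfl, h⟩ | ⟨h0, hp2, hq2, hpq, hqp⟩ | ⟨h0, hp2, hq2, hpq, hqp⟩ |
    ⟨hp2, hq2, hp0, hq0, hne, h⟩ | ⟨hp2, hq2, hne, h⟩
  · have h₀ : vertexAt N 0 = N := rfl
    rw [h₀]
    rcases h with rfl | rfl | rfl | rfl | rfl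
    · exact ⟨0, by lia, by unfold vertexAt partner; lia⟩
    · exact ⟨2, by lia, by unfold vertexAt partner; lia⟩
    · exact ⟨4, by lia, by unfold vertexAt partner; lia⟩
    · exact ⟨3, by lia, by unfold vertexAt partner; lia⟩
    · exact ⟨1, by lia, by unfold vertexAt partner; lia⟩
  · have h₀ : vertexAt N 0 = N := rfl
    rw [h₀]
    rcases h with rfl | rfl | rfl | rfl | rfl
    · exact ⟨0, by lia, by unfold vertexAt partner; lia⟩
    · exact ⟨2, by lia, by unfold vertexAt partner; lia⟩
    · exact ⟨4, by lia, by unfold vertexAt partner; lia⟩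
    · exact ⟨3, by lia, by unfold vertexAt partner; lia⟩
    · exact ⟨1, by lia, by unfold vertexAt partner; lia⟩
  · obtain ⟨s, hs, h, -⟩ := partner_vertexAt_of_even_odd hN hp hq hp2 hq2 h0 hpq hqp
    exact ⟨s, hs, h⟩
  · obtain ⟨s, hs, -, h⟩ := partner_vertexAt_of_even_odd hN hq hp hp2 hq2 h0 hpq hqp
    exact ⟨s, hs, h⟩
  · obtain ⟨a, rfl⟩ : ∃ a, p = 2 * a := ⟨p / 2, by lia⟩
    obtain ⟨b, rfl⟩ : ∃ b, q = 2 * b := ⟨q / 2, by lia⟩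
    have h₁ : vertexAt N (2 * a) = a := by unfold vertexAt; lia
    have h₂ : vertexAt N (2 * b) = b := by unfold vertexAt; lia
    refine ⟨a + b, by lia, ?_⟩
    rw [h₁, h₂]
    unfold partner
    lia
  · obtain ⟨a, rfl⟩ : ∃ a, p = 2 * a + 1 := ⟨p / 2, by lia⟩
    obtain ⟨b, rfl⟩ : ∃ b, q = 2 * b + 1 := ⟨q / 2, by lia⟩
    have h₁ : vertexAt N (2 * a + 1) = N - a := by unfold vertexAt; lia
    have h₂ : vertexAt N (2 * b + 1) = N - b := by unfold vertexAt; lia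
    refine ⟨N - (a + b), by lia, ?_⟩
    rw [h₁, h₂]
    unfold partner
    lia

theorem isLowArc_cycleA0 {m p : ℕ} (hm : 3 ≤ m) :
    IsLowArc (4 * m - 1) p (cycleA0 (4 * m) p) := by
  unfold IsLowArc cycleA0
  obtain ⟨q, rfl | rfl | rfl | rfl⟩ := exists_eq_four_mul_add p <;> lia (splits := 40)

theorem isLowArc_cycleA1 {m p : ℕ} (hm : 3 ≤ m) :
    IsLowArc (4 * m - 1) p (cycleA1 (4 * m) p) := by
  unfold IsLowArc cycleA1
  obtain ⟨q, rfl | rfl | rfl | rfl⟩ := exists_eq_four_mul_add p <;> lia (splits := 40)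

theorem isLowArc_cycleA2 {m p : ℕ} (hm : 3 ≤ m) :
    IsLowArc (4 * m - 1) p (cycleA2 (4 * m) p) := by
  unfold IsLowArc cycleA2
  obtain ⟨q, rfl | rfl | rfl | rfl⟩ := exists_eq_four_mul_add p <;> lia (splits := 40)

theorem isLowArc_cycleA3 {m p : ℕ} (hm : 3 ≤ m) :
    IsLowArc (4 * m - 1) p (cycleA3 (4 * m) p) := by
  unfold IsLowArc cycleA3
  obtain ⟨q, rfl | rfl | rfl | rfl⟩ := exists_eq_four_mul_add p <;> lia (splits := 40)

theorem isLowArc_cycleA4 {m p : ℕ} (hm : 3 ≤ m) :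
    IsLowArc (4 * m - 1) p (cycleA4 (4 * m) p) := by
  unfold IsLowArc cycleA4
  obtain ⟨q, rfl | rfl | rfl | rfl⟩ := exists_eq_four_mul_add p <;> lia (splits := 40)

theorem cycleA0_ne_cycleA1 {m p : ℕ} (hm : 3 ≤ m) :
    cycleA0 (4 * m) p ≠ cycleA1 (4 * m) p := by
  unfold cycleA0 cycleA1
  obtain ⟨q, rfl | rfl | rfl | rfl⟩ := exists_eq_four_mul_add p <;> lia (splits := 40)

theorem cycleA0_ne_cycleA2 {m p : ℕ} (hm : 3 ≤ m) :
    cycleA0 (4 * m) p ≠ cycleA2 (4 * m) p := by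
  unfold cycleA0 cycleA2
  obtain ⟨q, rfl | rfl | rfl | rfl⟩ := exists_eq_four_mul_add p <;> lia (splits := 40)

theorem cycleA1_ne_cycleA2 {m p : ℕ} (hm : 3 ≤ m) :
    cycleA1 (4 * m) p ≠ cycleA2 (4 * m) p := by
  unfold cycleA1 cycleA2
  obtain ⟨q, rfl | rfl | rfl | rfl⟩ := exists_eq_four_mul_add p <;> lia (splits := 40)

theorem cycleA0_ne_cycleA3 {m p : ℕ} (hm : 3 ≤ m) :
    cycleA0 (4 * m) p ≠ cycleA3 (4 * m) p := by
  unfold cycleA0 cycleA3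
  obtain ⟨q, rfl | rfl | rfl | rfl⟩ := exists_eq_four_mul_add p <;> lia (splits := 40)

theorem cycleA1_ne_cycleA3 {m p : ℕ} (hm : 3 ≤ m) :
    cycleA1 (4 * m) p ≠ cycleA3 (4 * m) p := by
  unfold cycleA1 cycleA3
  obtain ⟨q, rfl | rfl | rfl | rfl⟩ := exists_eq_four_mul_add p <;> lia (splits := 40)

theorem cycleA2_ne_cycleA3 {m p : ℕ} (hm : 3 ≤ m) :
    cycleA2 (4 * m) p ≠ cycleA3 (4 * m) p := by
  unfold cycleA2 cycleA3
  obtain ⟨q, rfl | rfl | rfl | rfl⟩ := exists_eq_four_mul_add p <;> lia (splits := 40)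

theorem cycleA0_ne_cycleA4 {m p : ℕ} (hm : 3 ≤ m) :
    cycleA0 (4 * m) p ≠ cycleA4 (4 * m) p := by
  unfold cycleA0 cycleA4
  obtain ⟨q, rfl | rfl | rfl | rfl⟩ := exists_eq_four_mul_add p <;> lia (splits := 40)

theorem cycleA1_ne_cycleA4 {m p : ℕ} (hm : 3 ≤ m) :
    cycleA1 (4 * m) p ≠ cycleA4 (4 * m) p := by
  unfold cycleA1 cycleA4
  obtain ⟨q, rfl | rfl | rfl | rfl⟩ := exists_eq_four_mul_add p <;> lia (splits := 40)

theorem cycleA2_ne_cycleA4 {m p : ℕ} (hm : 3 ≤ m) :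
    cycleA2 (4 * m) p ≠ cycleA4 (4 * m) p := by
  unfold cycleA2 cycleA4
  obtain ⟨q, rfl | rfl | rfl | rfl⟩ := exists_eq_four_mul_add p <;> lia (splits := 40)

theorem cycleA3_ne_cycleA4 {m p : ℕ} (hm : 3 ≤ m) :
    cycleA3 (4 * m) p ≠ cycleA4 (4 * m) p := by
  unfold cycleA3 cycleA4
  obtain ⟨q, rfl | rfl | rfl | rfl⟩ := exists_eq_four_mul_add p <;> lia (splits := 40)

theorem exists_isDirPlacement_four_mul {m k : ℕ} (hm : 3 ≤ m) (hk : k < 4 * m) :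
    ∃ σ : Fin k → (ZMod (4 * m) ≃ ZMod (4 * m)), IsDirPlacement (4 * m) k σ := by
  let f : ℕ → ℕ → ℕ := fun c =>
    if c = 0 then cycleA0 (4 * m) else if c = 1 then cycleA1 (4 * m)
    else if c = 2 then cycleA2 (4 * m) else if c = 3 then cycleA3 (4 * m)
    else cycleA4 (4 * m)
  have ham : ∀ c < 5, IsHamiltonian (4 * m) (f c) := by
    intro c hc
    interval_cases c
    · exact isHamiltonian_cycleA0 hm
    · exact isHamiltonian_cycleA1 hm
    · exact isHamiltonian_cycleA2 hm
    · exact isHamiltonian_cycleA3 hm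
    · exact isHamiltonian_cycleA4 hm
  have disj : ∀ d < 5, ∀ c < d, ∀ p < 4 * m, f c p ≠ f d p := by
    intro d hd c hc p hp
    interval_cases d <;> interval_cases c
    · exact cycleA0_ne_cycleA1 hm
    · exact cycleA0_ne_cycleA2 hm
    · exact cycleA1_ne_cycleA2 hm
    · exact cycleA0_ne_cycleA3 hm
    · exact cycleA1_ne_cycleA3 hm
    · exact cycleA2_ne_cycleA3 hm
    · exact cycleA0_ne_cycleA4 hm
    · exact cycleA1_ne_cycleA4 hm
    · exact cycleA2_ne_cycleA4 hm
    · exact cycleA3_ne_cycleA4 hm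
  have low : ∀ c < 5, ∀ p < 4 * m, IsLowArc (4 * m - 1) p (f c p) := by
    intro c hc p hp
    interval_cases c
    · exact isLowArc_cycleA0 hm
    · exact isLowArc_cycleA1 hm
    · exact isLowArc_cycleA2 hm
    · exact isLowArc_cycleA3 hm
    · exact isLowArc_cycleA4 hm
  obtain ⟨N, hN⟩ : ∃ N, 4 * m = N + 1 := ⟨4 * m - 1, by lia⟩
  rw [hN] at hk ham disj low ⊢
  exact exists_isDirPlacement_of_five (by lia) (by lia) (by lia) f ham disj fun c hc p hp =>
    (low c hc p hp).exists_partner (by lia) (by lia) hp ((ham c hc).lt p hp)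

theorem isLowArc_cycleB0 {m p : ℕ} (hm : 3 ≤ m) :
    IsLowArc (4 * m + 2 - 1) p (cycleB0 (4 * m + 2) p) := by
  unfold IsLowArc cycleB0
  obtain ⟨q, rfl | rfl | rfl | rfl⟩ := exists_eq_four_mul_add p <;> lia (splits := 40)

theorem isLowArc_cycleB1 {m p : ℕ} (hm : 3 ≤ m) :
    IsLowArc (4 * m + 2 - 1) p (cycleB1 (4 * m + 2) p) := by
  unfold IsLowArc cycleB1
  obtain ⟨q, rfl | rfl | rfl | rfl⟩ := exists_eq_four_mul_add p <;> lia (splits := 40)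

theorem isLowArc_cycleB2 {m p : ℕ} (hm : 3 ≤ m) :
    IsLowArc (4 * m + 2 - 1) p (cycleB2 (4 * m + 2) p) := by
  unfold IsLowArc cycleB2
  obtain ⟨q, rfl | rfl | rfl | rfl⟩ := exists_eq_four_mul_add p <;> lia (splits := 40)

theorem isLowArc_cycleB3 {m p : ℕ} (hm : 3 ≤ m) :
    IsLowArc (4 * m + 2 - 1) p (cycleB3 (4 * m + 2) p) := by
  unfold IsLowArc cycleB3
  obtain ⟨q, rfl | rfl | rfl | rfl⟩ := exists_eq_four_mul_add p <;> lia (splits := 40)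

theorem isLowArc_cycleB4 {m p : ℕ} (hm : 3 ≤ m) :
    IsLowArc (4 * m + 2 - 1) p (cycleB4 (4 * m + 2) p) := by
  unfold IsLowArc cycleB4
  obtain ⟨q, rfl | rfl | rfl | rfl⟩ := exists_eq_four_mul_add p <;> lia (splits := 40)

theorem cycleB0_ne_cycleB1 {m p : ℕ} (hm : 3 ≤ m) :
    cycleB0 (4 * m + 2) p ≠ cycleB1 (4 * m + 2) p := by
  unfold cycleB0 cycleB1
  obtain ⟨q, rfl | rfl | rfl | rfl⟩ := exists_eq_four_mul_add p <;> lia (splits := 40)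

theorem cycleB0_ne_cycleB2 {m p : ℕ} (hm : 3 ≤ m) :
    cycleB0 (4 * m + 2) p ≠ cycleB2 (4 * m + 2) p := by
  unfold cycleB0 cycleB2
  obtain ⟨q, rfl | rfl | rfl | rfl⟩ := exists_eq_four_mul_add p <;> lia (splits := 40)

theorem cycleB1_ne_cycleB2 {m p : ℕ} (hm : 3 ≤ m) :
    cycleB1 (4 * m + 2) p ≠ cycleB2 (4 * m + 2) p := by
  unfold cycleB1 cycleB2
  obtain ⟨q, rfl | rfl | rfl | rfl⟩ := exists_eq_four_mul_add p <;> lia (splits := 40)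

theorem cycleB0_ne_cycleB3 {m p : ℕ} (hm : 3 ≤ m) :
    cycleB0 (4 * m + 2) p ≠ cycleB3 (4 * m + 2) p := by
  unfold cycleB0 cycleB3
  obtain ⟨q, rfl | rfl | rfl | rfl⟩ := exists_eq_four_mul_add p <;> lia (splits := 40)

theorem cycleB1_ne_cycleB3 {m p : ℕ} (hm : 3 ≤ m) :
    cycleB1 (4 * m + 2) p ≠ cycleB3 (4 * m + 2) p := by
  unfold cycleB1 cycleB3
  obtain ⟨q, rfl | rfl | rfl | rfl⟩ := exists_eq_four_mul_add p <;> lia (splits := 40)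

theorem cycleB2_ne_cycleB3 {m p : ℕ} (hm : 3 ≤ m) :
    cycleB2 (4 * m + 2) p ≠ cycleB3 (4 * m + 2) p := by
  unfold cycleB2 cycleB3
  obtain ⟨q, rfl | rfl | rfl | rfl⟩ := exists_eq_four_mul_add p <;> lia (splits := 40)

theorem cycleB0_ne_cycleB4 {m p : ℕ} (hm : 3 ≤ m) :
    cycleB0 (4 * m + 2) p ≠ cycleB4 (4 * m + 2) p := by
  unfold cycleB0 cycleB4
  obtain ⟨q, rfl | rfl | rfl | rfl⟩ := exists_eq_four_mul_add p <;> lia (splits := 40)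

theorem cycleB1_ne_cycleB4 {m p : ℕ} (hm : 3 ≤ m) :
    cycleB1 (4 * m + 2) p ≠ cycleB4 (4 * m + 2) p := by
  unfold cycleB1 cycleB4
  obtain ⟨q, rfl | rfl | rfl | rfl⟩ := exists_eq_four_mul_add p <;> lia (splits := 40)

theorem cycleB2_ne_cycleB4 {m p : ℕ} (hm : 3 ≤ m) :
    cycleB2 (4 * m + 2) p ≠ cycleB4 (4 * m + 2) p := by
  unfold cycleB2 cycleB4
  obtain ⟨q, rfl | rfl | rfl | rfl⟩ := exists_eq_four_mul_add p <;> lia (splits := 40)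

theorem cycleB3_ne_cycleB4 {m p : ℕ} (hm : 3 ≤ m) :
    cycleB3 (4 * m + 2) p ≠ cycleB4 (4 * m + 2) p := by
  unfold cycleB3 cycleB4
  obtain ⟨q, rfl | rfl | rfl | rfl⟩ := exists_eq_four_mul_add p <;> lia (splits := 40)

theorem exists_isDirPlacement_four_mul_add_two {m k : ℕ} (hm : 3 ≤ m) (hk : k < 4 * m + 2) :
    ∃ σ : Fin k → (ZMod (4 * m + 2) ≃ ZMod (4 * m + 2)), IsDirPlacement (4 * m + 2) k σ := by
  let f : ℕ → ℕ → ℕ := fun c =>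
    if c = 0 then cycleB0 (4 * m + 2) else if c = 1 then cycleB1 (4 * m + 2)
    else if c = 2 then cycleB2 (4 * m + 2) else if c = 3 then cycleB3 (4 * m + 2)
    else cycleB4 (4 * m + 2)
  have ham : ∀ c < 5, IsHamiltonian (4 * m + 2) (f c) := by
    intro c hc
    interval_cases c
    · exact isHamiltonian_cycleB0 hm
    · exact isHamiltonian_cycleB1 hm
    · exact isHamiltonian_cycleB2 hm
    · exact isHamiltonian_cycleB3 hm
    · exact isHamiltonian_cycleB4 hm
  have disj : ∀ d < 5, ∀ c < d, ∀ p < 4 * m + 2, f c p ≠ f d p := by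
    intro d hd c hc p hp
    interval_cases d <;> interval_cases c
    · exact cycleB0_ne_cycleB1 hm
    · exact cycleB0_ne_cycleB2 hm
    · exact cycleB1_ne_cycleB2 hm
    · exact cycleB0_ne_cycleB3 hm
    · exact cycleB1_ne_cycleB3 hm
    · exact cycleB2_ne_cycleB3 hm
    · exact cycleB0_ne_cycleB4 hm
    · exact cycleB1_ne_cycleB4 hm
    · exact cycleB2_ne_cycleB4 hm
    · exact cycleB3_ne_cycleB4 hm
  have low : ∀ c < 5, ∀ p < 4 * m + 2, IsLowArc (4 * m + 2 - 1) p (f c p) := by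
    intro c hc p hp
    interval_cases c
    · exact isLowArc_cycleB0 hm
    · exact isLowArc_cycleB1 hm
    · exact isLowArc_cycleB2 hm
    · exact isLowArc_cycleB3 hm
    · exact isLowArc_cycleB4 hm
  obtain ⟨N, hN⟩ : ∃ N, 4 * m + 2 = N + 1 := ⟨4 * m + 2 - 1, by lia⟩
  rw [hN] at hk ham disj low ⊢
  exact exists_isDirPlacement_of_five (by lia) (by lia) (by lia) f ham disj fun c hc p hp =>
    (low c hc p hp).exists_partner (by lia) (by lia) hp ((ham c hc).lt p hp)

theorem IsHamiltonian.of_iterate {n : ℕ} {f : ℕ → ℕ} (lt : ∀ v < n, f v < n) (hn : 0 < n)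
    (h : ∀ v < n, ∃ j < n, f^[j + 1] 0 = v) : IsHamiltonian n f := by
  refine ⟨lt, 0, hn, fun v hv => ?_⟩
  obtain ⟨j, -, rfl⟩ := h v hv
  clear hv
  induction j with
  | zero => exact .refl
  | succ j ih => exact ih.tail (Function.iterate_succ_apply' f (j + 1) 0).symm

/-- The family of maps tabulated by the rows of `T`. -/
def tableMap (T : List (List ℕ)) (i v : ℕ) : ℕ :=
  (T.getD i []).getD v 0

theorem exists_isDirPlacement_two {k : ℕ} (hk : k < 2) :
    ∃ σ : Fin k → (ZMod 2 ≃ ZMod 2), IsDirPlacement 2 k σ :=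
  exists_isDirPlacement (m := 1) (by lia) (by lia) (tableMap [[1, 0]])
    (fun i hi => .of_iterate (by revert i; decide) (by lia) (by revert i; decide)) (by decide)

theorem exists_isDirPlacement_four {k : ℕ} (hk : k < 3) :
    ∃ σ : Fin k → (ZMod 4 ≃ ZMod 4), IsDirPlacement 4 k σ :=
  exists_isDirPlacement (m := 2) (by lia) (by lia) (tableMap [[1, 2, 3, 0], [3, 0, 1, 2]])
    (fun i hi => .of_iterate (by revert i; decide) (by lia) (by revert i; decide)) (by decide)

theorem exists_isDirPlacement_six {k : ℕ} (hk : k < 5) :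
    ∃ σ : Fin k → (ZMod 6 ≃ ZMod 6), IsDirPlacement 6 k σ :=
  exists_isDirPlacement (m := 4) (by lia) (by lia)
    (tableMap [[1, 2, 3, 4, 5, 0], [2, 3, 1, 5, 0, 4], [4, 5, 0, 2, 1, 3], [5, 0, 4, 1, 3, 2]])
    (fun i hi => .of_iterate (by revert i; decide) (by lia) (by revert i; decide)) (by decide)

theorem exists_isDirPlacement_eight {k : ℕ} (hk : k < 8) :
    ∃ σ : Fin k → (ZMod 8 ≃ ZMod 8), IsDirPlacement 8 k σ :=
  exists_isDirPlacement_of_five (N := 7) (by lia) (by lia) (by lia)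
    (tableMap [[1, 6, 4, 7, 5, 3, 2, 0], [7, 0, 3, 6, 2, 4, 1, 5], [2, 4, 6, 5, 0, 7, 3, 1],
      [5, 2, 0, 4, 1, 6, 7, 3], [4, 7, 1, 2, 3, 0, 5, 6]])
    (fun i hi => .of_iterate (by revert i; decide) (by lia) (by revert i; decide))
    (by decide) (by decide)

theorem exists_isDirPlacement_ten {k : ℕ} (hk : k < 10) :
    ∃ σ : Fin k → (ZMod 10 ≃ ZMod 10), IsDirPlacement 10 k σ :=
  exists_isDirPlacement_of_five (N := 9) (by lia) (by lia) (by lia)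
    (tableMap [[1, 2, 4, 6, 5, 8, 7, 9, 3, 0], [9, 0, 3, 8, 1, 4, 2, 6, 5, 7],
      [2, 4, 6, 9, 0, 7, 3, 8, 1, 5], [7, 8, 0, 4, 2, 6, 1, 5, 9, 3],
      [4, 6, 1, 2, 3, 9, 5, 0, 7, 8]])
    (fun i hi => .of_iterate (by revert i; decide) (by lia) (by revert i; decide))
    (by decide) (by decide)

theorem IsDirPlacement.eq_of_common_arc {n k : ℕ} {σ : Fin k → (ZMod n ≃ ZMod n)}
    (h : IsDirPlacement n k σ) {i j : Fin k} {s t : ZMod n} (h₁ : σ i s = σ j t)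
    (h₂ : σ i (s + 1) = σ j (t + 1)) : i = j := by
  by_contra hij
  refine Set.disjoint_left.1 (h.2 i j hij) ⟨(s, s + 1), ⟨s, rfl⟩, rfl⟩
    ⟨(t, t + 1), ⟨t, rfl⟩, ?_⟩
  simp [h₁, h₂]

theorem IsDirPlacement.lt {n k : ℕ} [NeZero n] {σ : Fin k → (ZMod n ≃ ZMod n)}
    (h : IsDirPlacement n k σ) : k < n := by
  let g : Fin k → {a : ZMod n // a ≠ 0} := fun i => ⟨σ i ((σ i).symm 0 + 1), fun h0 =>
    h.1 i ((σ i).symm 0, (σ i).symm 0 + 1) ⟨_, rfl⟩ (by simp [h0])⟩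
  have hg : Function.Injective g := fun i j hij =>
    h.eq_of_common_arc (s := (σ i).symm 0) (t := (σ j).symm 0) (by simp) (Subtype.ext_iff.1 hij)
  have := Fintype.card_le_of_injective g hg
  rw [Fintype.card_fin, Fintype.card_subtype_compl, ZMod.card, Fintype.card_subtype_eq] at this
  have := NeZero.pos n
  lia

/-- A placement of `k` circuits of order `k + 1` may be rooted at a vertex, with one circuit in
standard position and exactly one circuit through each arc leaving the root. -/
theorem IsDirPlacement.exists_rooted {k : ℕ} (hk : 1 ≤ k)
    {σ : Fin k → (ZMod (k + 1) ≃ ZMod (k + 1))} (h : IsDirPlacement (k + 1) k σ) :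
    ∃ ρ : ZMod (k + 1) → (ZMod (k + 1) ≃ ZMod (k + 1)), ρ 1 = Equiv.refl _ ∧
      (∀ a ≠ 0, ρ a 0 = 0 ∧ ρ a 1 = a) ∧
      ∀ a ≠ 0, ∀ b ≠ 0, ∀ s t, ρ a s = ρ b t → ρ a (s + 1) = ρ b (t + 1) → a = b := by
  have : Fact (1 < k + 1) := ⟨by lia⟩
  let z : Fin k := ⟨0, hk⟩
  let τ : Fin k → (ZMod (k + 1) ≃ ZMod (k + 1)) := fun i =>
    ((Equiv.addRight ((σ i).symm (σ z 0))).trans (σ i)).trans (σ z).symm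
  have τ_apply : ∀ i t, τ i t = (σ z).symm (σ i (t + (σ i).symm (σ z 0))) := fun _ _ => rfl
  have τ_zero : ∀ i, τ i 0 = 0 := fun i => by simp [τ_apply]
  have τ_z : τ z = Equiv.refl _ := by
    ext t
    simp [τ_apply]
  have τ_arc : ∀ i j s t, τ i s = τ j t → τ i (s + 1) = τ j (t + 1) → i = j := by
    intro i j s t h₁ h₂
    refine h.eq_of_common_arc (s := s + (σ i).symm (σ z 0)) (t := t + (σ j).symm (σ z 0))
      ((σ z).symm.injective h₁) ((σ z).symm.injective ?_)
    simpa only [τ_apply, add_right_comm] using h₂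
  let g : Fin k → {a : ZMod (k + 1) // a ≠ 0} := fun i =>
    ⟨τ i 1, fun h0 => one_ne_zero ((τ i).injective (h0.trans (τ_zero i).symm))⟩
  have hg : Function.Injective g := fun i j hij =>
    τ_arc i j 0 0 (by rw [τ_zero, τ_zero]) (by simpa using Subtype.ext_iff.1 hij)
  have g_surj : Function.Surjective g := by
    refine ((Fintype.bijective_iff_injective_and_card g).2 ⟨hg, ?_⟩).2
    rw [Fintype.card_fin, Fintype.card_subtype_compl, ZMod.card, Fintype.card_subtype_eq]
    lia
  have key : ∀ a : ZMod (k + 1), ∃ i, a ≠ 0 → τ i 1 = a := by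
    intro a
    by_cases ha : a = 0
    · exact ⟨z, fun h => absurd ha h⟩
    · obtain ⟨i, hi⟩ := g_surj ⟨a, ha⟩
      exact ⟨i, fun _ => Subtype.ext_iff.1 hi⟩
  choose idx hidx using key
  refine ⟨fun a => τ (idx a), ?_, fun a ha => ⟨τ_zero _, hidx a ha⟩, fun a ha b hb s t h₁ h₂ => ?_⟩
  · have : idx 1 = z := hg (Subtype.ext (by simp [g, hidx 1 one_ne_zero, τ_z]))
    simp only [this, τ_z]
  · rw [← hidx a ha, ← hidx b hb, τ_arc _ _ s t h₁ h₂]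

/-- The arcs `(u, v)` of the circuit through the vertices listed by `l`, encoded as `n * u + v`. -/
def arcCodes (n : ℕ) (l : List ℕ) : List ℕ :=
  List.zipWith (fun u v => n * u + v) l (l.rotate 1)

/-- The arc codes of all circuits on `0, …, n - 1` using the arc `(0, a)`. -/
def rootedCodes (n a : ℕ) : List (List ℕ) :=
  (((List.range n).erase 0).erase a).permutations'.map fun l => arcCodes n (0 :: a :: l)

/-- Search for pairwise arc-disjoint circuits, one through each arc `(0, a)` with `a` in the given
list, that avoid the arcs in `used`. -/
def searchCircuits (n : ℕ) : List ℕ → List ℕ → Bool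
  | [], _ => true
  | a :: as, used => (rootedCodes n a).any fun c =>
      c.all (fun e => !used.contains e) && searchCircuits n as (c ++ used)

/-- The arc codes of the circuit with vertices `f 0, f 1, …`. -/
def circuitCodes {n : ℕ} (f : ZMod n → ZMod n) : List ℕ :=
  (List.range n).map fun t : ℕ => n * (f t).val + (f (t + 1)).val

theorem arcCodes_map_range {n : ℕ} (f : ZMod n → ZMod n) :
    arcCodes n ((List.range n).map fun t : ℕ => (f t).val) = circuitCodes f := by
  refine List.ext_getElem (by simp [arcCodes, circuitCodes]) fun i h₁ h₂ => ?_
  simp [arcCodes, circuitCodes, List.getElem_rotate]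

theorem circuitCodes_mem_rootedCodes {n a : ℕ} (hn : 1 < n) (ha : a < n)
    (f : ZMod n ≃ ZMod n) (f0 : f 0 = 0) (f1 : f 1 = a) :
    circuitCodes f ∈ rootedCodes n a := by
  have : NeZero n := ⟨by lia⟩
  obtain ⟨m, rfl⟩ : ∃ m, n = m + 2 := ⟨n - 2, by lia⟩
  obtain ⟨l, hl⟩ : ∃ l, ((List.range (m + 2)).map fun t : ℕ => (f t).val) = 0 :: a :: l := by
    simp [List.range_succ_eq_map, f0, f1, ZMod.val_natCast_of_lt ha]
  have perm : (0 :: a :: l).Perm (List.range (m + 2)) := by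
    rw [← hl]
    refine (List.perm_ext_iff_of_nodup (List.nodup_range.map_on ?_) List.nodup_range).2 fun v => ?_
    · intro x hx y hy hxy
      have h := congrArg ZMod.val (f.injective (ZMod.val_injective _ hxy))
      rwa [ZMod.val_natCast_of_lt (List.mem_range.1 hx),
        ZMod.val_natCast_of_lt (List.mem_range.1 hy)] at h
    · simp only [List.mem_map, List.mem_range]
      refine ⟨fun ⟨t, _, ht⟩ => ht ▸ ZMod.val_lt _, fun hv => ⟨(f.symm v).val, ZMod.val_lt _, ?_⟩⟩
      simp [ZMod.val_natCast_of_lt hv]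
  rw [← arcCodes_map_range, hl]
  refine List.mem_map.2 ⟨l, List.mem_permutations'.2 ?_, rfl⟩
  exact (List.cons_perm_iff_perm_erase.1 (List.cons_perm_iff_perm_erase.1 perm).2).2

theorem eq_of_mem_circuitCodes {n e : ℕ} {f g : ZMod n → ZMod n} [NeZero n]
    (hf : e ∈ circuitCodes f) (hg : e ∈ circuitCodes g) :
    ∃ s t, f s = g t ∧ f (s + 1) = g (t + 1) := by
  obtain ⟨s, -, rfl⟩ := List.mem_map.1 hf
  obtain ⟨t, -, h⟩ := List.mem_map.1 hg
  have hdiv := congrArg (· / n) h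
  have hmod := congrArg (· % n) h
  simp only [Nat.mul_add_div (NeZero.pos n), Nat.mul_add_mod, Nat.div_eq_of_lt (ZMod.val_lt _),
    Nat.mod_eq_of_lt (ZMod.val_lt _), add_zero] at hdiv hmod
  exact ⟨s, t, ZMod.val_injective _ hdiv.symm, ZMod.val_injective _ hmod.symm⟩

theorem searchCircuits_eq_true {n : ℕ} (hn : 1 < n) {ρ : ZMod n → (ZMod n ≃ ZMod n)}
    (root : ∀ a ≠ 0, ρ a 0 = 0 ∧ ρ a 1 = a)
    (arc : ∀ a ≠ 0, ∀ b ≠ 0, ∀ s t, ρ a s = ρ b t → ρ a (s + 1) = ρ b (t + 1) → a = b)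
    (as used : List ℕ) (nodup : as.Nodup) (range : ∀ a ∈ as, a ≠ 0 ∧ a < n)
    (h : ∀ e ∈ used, ∃ b, b ≠ 0 ∧ b < n ∧ b ∉ as ∧ e ∈ circuitCodes (ρ b)) :
    searchCircuits n as used = true := by
  have : NeZero n := ⟨by lia⟩
  have ne_zero : ∀ {b : ℕ}, b ≠ 0 → b < n → (b : ZMod n) ≠ 0 := fun h0 hb h => h0 <| by
    simpa [ZMod.val_natCast_of_lt hb] using congrArg ZMod.val h
  induction as generalizing used with
  | nil => rfl
  | cons a as ih =>
    obtain ⟨h0, ha⟩ := range a List.mem_cons_self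
    obtain ⟨r0, r1⟩ := root a (ne_zero h0 ha)
    refine List.any_eq_true.2
      ⟨circuitCodes (ρ a), circuitCodes_mem_rootedCodes hn ha _ r0 r1, ?_⟩
    rw [Bool.and_eq_true, List.all_eq_true]
    refine ⟨fun e he => ?_, ih _ nodup.of_cons (fun b hb => range b (List.mem_cons_of_mem _ hb))
      fun e he => ?_⟩
    · simp only [List.contains_eq_mem, Bool.not_eq_true', decide_eq_false_iff_not]
      intro hu
      obtain ⟨b, hb0, hb, hba, heb⟩ := h e hu
      obtain ⟨s, t, h₁, h₂⟩ := eq_of_mem_circuitCodes he heb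
      have hab := congrArg ZMod.val (arc a (ne_zero h0 ha) b (ne_zero hb0 hb) s t h₁ h₂)
      rw [ZMod.val_natCast_of_lt ha, ZMod.val_natCast_of_lt hb] at hab
      simp [hab] at hba
    · rcases List.mem_append.1 he with he | he
      · exact ⟨a, h0, ha, (List.nodup_cons.1 nodup).1, he⟩
      · obtain ⟨b, hb0, hb, hba, heb⟩ := h e he
        exact ⟨b, hb0, hb, fun hb => hba (List.mem_cons_of_mem _ hb), heb⟩

theorem IsDirPlacement.searchCircuits_eq_true {k : ℕ} (hk : 1 ≤ k)
    {σ : Fin k → (ZMod (k + 1) ≃ ZMod (k + 1))} (h : IsDirPlacement (k + 1) k σ) :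
    searchCircuits (k + 1) (List.range' 2 (k - 1)) (arcCodes (k + 1) (List.range (k + 1))) =
      true := by
  obtain ⟨ρ, ρ_one, root, arc⟩ := h.exists_rooted hk
  refine _root_.searchCircuits_eq_true (by lia) root arc _ _ List.nodup_range' (fun a ha => ?_)
    fun e he => ⟨1, by lia, by lia, ?_, ?_⟩
  · rw [List.mem_range'_1] at ha
    lia
  · simp [List.mem_range'_1]
  · have hr : ((List.range (k + 1)).map fun t : ℕ => (t : ZMod (k + 1)).val) =
        List.range (k + 1) := by
      conv_rhs => rw [← List.map_id (List.range (k + 1))]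
      exact List.map_congr_left fun t ht => ZMod.val_natCast_of_lt (List.mem_range.1 ht)
    rw [Nat.cast_one, ρ_one, Equiv.coe_refl, ← arcCodes_map_range]
    simpa only [id, hr] using he

theorem not_isDirPlacement_four_three (σ : Fin 3 → (ZMod 4 ≃ ZMod 4)) :
    ¬ IsDirPlacement 4 3 σ := fun h =>
  absurd (IsDirPlacement.searchCircuits_eq_true (by lia) h) (by decide +kernel)

theorem not_isDirPlacement_six_five (σ : Fin 5 → (ZMod 6 ≃ ZMod 6)) :
    ¬ IsDirPlacement 6 5 σ := fun h =>
  absurd (IsDirPlacement.searchCircuits_eq_true (by lia) h) (by decide +kernel)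

/-- For `k ≥ 1`, the circuit `C⃗_{k+x}` of order `n = k + x` admits a
`k`-placement into the complete digraph on `n` vertices if and only if `x ≥ 1` and
`(x, n) ∉ {(1,4), (1,6)}`. -/
theorem dirPlacement_iff (k x : ℕ) (hk : 1 ≤ k) :
    (∃ σ : Fin k → (ZMod (k + x) ≃ ZMod (k + x)), IsDirPlacement (k + x) k σ) ↔
      (1 ≤ x ∧ ¬(x = 1 ∧ k + x = 4) ∧ ¬(x = 1 ∧ k + x = 6)) := by
  constructor
  · rintro ⟨σ, h⟩
    have : NeZero (k + x) := ⟨by lia⟩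
    refine ⟨by have := h.lt; lia, ?_, ?_⟩
    · rintro ⟨rfl, hk⟩
      obtain rfl : k = 3 := by lia
      exact not_isDirPlacement_four_three σ h
    · rintro ⟨rfl, hk⟩
      obtain rfl : k = 5 := by lia
      exact not_isDirPlacement_six_five σ h
  · rintro ⟨hx, h4, h6⟩
    obtain ⟨n, hn⟩ : ∃ n, n = k + x := ⟨_, rfl⟩
    rw [← hn] at h4 h6 ⊢
    by_cases hodd : n % 2 = 1
    · exact exists_isDirPlacement_odd (by lia) hodd (by lia)
    by_cases hlt : n < 12
    · have : n = 2 ∨ n = 4 ∨ n = 6 ∨ n = 8 ∨ n = 10 := by lia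
      rcases this with rfl | rfl | rfl | rfl | rfl
      · exact exists_isDirPlacement_two (by lia)
      · exact exists_isDirPlacement_four (by lia)
      · exact exists_isDirPlacement_six (by lia)
      · exact exists_isDirPlacement_eight (by lia)
      · exact exists_isDirPlacement_ten (by lia)
    obtain ⟨m, rfl | rfl⟩ : ∃ m, n = 4 * m ∨ n = 4 * m + 2 := ⟨n / 4, by lia⟩
    · exact exists_isDirPlacement_four_mul (by lia) (by lia)
    · exact exists_isDirPlacement_four_mul_add_two (by lia) (by lia)
end

section
/- For every circuit C⃗_n of order n = k + x with n > k (i.e. x ≥ 1) and (x, n) ∉ {(1,4), (1,6)}, the k-labeled packing number satisfies λ^k(C⃗_n) ≤ ⌊n/2⌋ + ⌊⌈n/2⌉ / k⌋. -/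
open Finset in
/-- The number of vertices of `↔K_n` carrying the label `a`. -/
def labelClassSize {n p : ℕ} [NeZero n] (f : ZMod n → Fin p) (a : Fin p) : ℕ :=
  #{w | f w = a}

open Finset in
theorem card_filter_labelClassSize {n p : ℕ} [NeZero n] (f : ZMod n → Fin p)
    (P : ℕ → Prop) [DecidablePred P] :
    #{w | P (labelClassSize f (f w))} =
      ∑ a with P (labelClassSize f a), labelClassSize f a := by
  rw [card_eq_sum_card_fiberwise (f := f) (t := ({a | P (labelClassSize f a)} : Finset (Fin p)))
    (fun w hw => by simpa using hw)]
  refine sum_congr rfl fun a ha => ?_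
  unfold labelClassSize at ha ⊢
  congr 1
  ext w
  simp only [mem_filter, mem_univ, true_and] at ha ⊢
  constructor
  · exact fun h => h.2
  · rintro rfl
    exact ⟨ha, rfl⟩

open Finset in
/-- In a labeled packing, the successor of a vertex that is alone in its label class
lies in a class with at least `k` vertices. -/
theorem IsDirLabeledPacking.le_labelClassSize_succ {n k p : ℕ} [NeZero n]
    {f : ZMod n → Fin p} {σ : Fin k → (ZMod n ≃ ZMod n)} (h : IsDirLabeledPacking n k p f σ)
    (i₀ : Fin k) {v : ZMod n} (hv : labelClassSize f (f (σ i₀ v)) = 1) :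
    k ≤ labelClassSize f (f (σ i₀ (v + 1))) := by
  obtain ⟨-, ⟨-, hdisj⟩, hlab⟩ := h
  have hfix (i : Fin k) : σ i v = σ i₀ v :=
    card_le_one.1 hv.le _ (by simpa using hlab i i₀ v) _ (by simp)
  have hinj : Function.Injective fun i => σ i (v + 1) := by
    intro i j hij
    by_contra hne
    refine Set.disjoint_left.1 (hdisj i j hne) ⟨(v, v + 1), ⟨v, rfl⟩, rfl⟩
      ⟨(v, v + 1), ⟨v, rfl⟩, ?_⟩
    simp only [hfix] at hij ⊢
    rw [hij]
  calc k = #(univ.image fun i => σ i (v + 1)) := by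
        rw [card_image_of_injective _ hinj, card_univ, Fintype.card_fin]
    _ ≤ labelClassSize f (f (σ i₀ (v + 1))) := by
        refine card_le_card fun w hw => ?_
        obtain ⟨i, -, rfl⟩ := mem_image.1 hw
        simpa using hlab i i₀ (v + 1)

open Finset in
/-- In a labeled packing, there are at most as many vertices alone in their label class as
vertices in classes of size at least `k`. -/
theorem IsDirLabeledPacking.card_singleton_le {n k p : ℕ} [NeZero n]
    {f : ZMod n → Fin p} {σ : Fin k → (ZMod n ≃ ZMod n)} (h : IsDirLabeledPacking n k p f σ)
    (hk : 0 < k) :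
    #{w | labelClassSize f (f w) = 1} ≤ #{w | k ≤ labelClassSize f (f w)} := by
  let i₀ : Fin k := ⟨0, hk⟩
  refine card_le_card_of_injOn (fun w => σ i₀ ((σ i₀).symm w + 1)) (fun w hw => ?_) ?_
  · simp only [coe_filter, mem_univ, true_and, Set.mem_ofPred_eq] at hw ⊢
    exact h.le_labelClassSize_succ i₀ (by simpa using hw)
  · intro w _ w' _ hww
    simpa using hww

open Finset in
theorem IsDirLabeledPacking.le_bound {n k p : ℕ} [NeZero n]
    {f : ZMod n → Fin p} {σ : Fin k → (ZMod n ≃ ZMod n)} (h : IsDirLabeledPacking n k p f σ)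
    (hk : 1 ≤ k) : p ≤ n / 2 + ((n + 1) / 2) / k := by
  rcases hk.eq_or_lt with rfl | hk2
  · have := Fintype.card_le_of_surjective f h.1
    rw [Fintype.card_fin, ZMod.card] at this
    omega
  have hpos (a : Fin p) : 1 ≤ labelClassSize f a := by
    obtain ⟨w, hw⟩ := h.1 a
    exact card_pos.2 ⟨w, by simpa using hw⟩
  let s := labelClassSize f
  have hle := h.card_singleton_le hk
  rw [card_filter_labelClassSize f (· = 1), card_filter_labelClassSize f (k ≤ ·)] at hle
  have hone : ∑ a with s a = 1, s a = #{a | s a = 1} := by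
    rw [card_eq_sum_ones]
    exact sum_congr rfl fun a ha => by simpa using ha
  have hbig : #{a | k ≤ s a} * k ≤ ∑ a with k ≤ s a, s a := by
    rw [← smul_eq_mul]
    refine card_nsmul_le_sum _ _ _ fun a ha => ?_
    simpa using ha
  have hrest : #{a | s a ≠ 1 ∧ ¬ k ≤ s a} * 2 ≤ ∑ a with s a ≠ 1 ∧ ¬ k ≤ s a, s a := by
    rw [← smul_eq_mul]
    refine card_nsmul_le_sum _ _ _ fun a ha => ?_
    have := hpos a
    simp only [mem_filter, mem_univ, true_and] at ha
    change 1 ≤ s a at this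
    omega
  have hsplit (g : Fin p → ℕ) : ∑ a, g a = ∑ a with s a = 1, g a + ∑ a with k ≤ s a, g a +
      ∑ a with s a ≠ 1 ∧ ¬ k ≤ s a, g a := by
    simp only [sum_filter, ← sum_add_distrib]
    refine sum_congr rfl fun a _ => ?_
    split_ifs <;> omega
  have hn : ∑ a, s a = n := by
    have := card_filter_labelClassSize f fun _ => True
    simpa [ZMod.card] using this.symm
  have hp := hsplit fun _ => 1
  simp only [← card_eq_sum_ones, card_univ, Fintype.card_fin] at hp
  have hs := hsplit s
  rw [hn, hone] at hs
  change ∑ a with s a = 1, s a ≤ ∑ a with k ≤ s a, s a at hle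
  rw [hone] at hle
  generalize ∑ a with k ≤ s a, s a = B at *
  generalize #{a | k ≤ s a} = q at *
  rcases le_total B ((n + 1) / 2) with hB | hB
  · have : q ≤ (n + 1) / 2 / k := (Nat.le_div_iff_mul_le hk).2 (hbig.trans hB)
    omega
  · obtain ⟨d, rfl⟩ := Nat.exists_eq_add_of_le hB
    have : q ≤ (n + 1) / 2 / k + d := by
      rw [← Nat.add_mul_div_right _ _ hk, Nat.le_div_iff_mul_le hk]
      exact hbig.trans (Nat.add_le_add_left (Nat.le_mul_of_pos_right d hk) _)
    omega

/-- For every circuit `C⃗_n` of order `n = k + x` with `n > k`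
(i.e. `x ≥ 1`) and `(x, n) ∉ {(1,4), (1,6)}`, we have
`λ^k(C⃗_n) ≤ ⌊n/2⌋ + ⌊⌈n/2⌉/k⌋`. -/
theorem dirLabeledPackingNumber_le (k x : ℕ) (hk : 1 ≤ k) (hx : 1 ≤ x)
    (h4 : ¬(x = 1 ∧ k + x = 4)) (h6 : ¬(x = 1 ∧ k + x = 6)) :
    dirLabeledPackingNumber (k + x) k ≤ (k + x) / 2 + ((k + x + 1) / 2) / k := by
  have : NeZero (k + x) := ⟨by omega⟩
  refine csSup_le' ?_
  rintro p ⟨f, σ, h⟩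
  exact h.le_bound hk
end
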